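/- Suppose there exist four distinct primes p₁, p₂, p₃, p₄ such that the pushforward of μ to ℤ/Nℤ, where N = p₁p₂p₃p₄, is the uniform measure on ℤ/Nℤ. Then, as n → ∞, the probability that the characteristic polynomial φ of M ~ M_n(μ) is irreducible over ℚ and its Galois group contains the alternating group A_n tends to 1. -/

import Mathlib

/- STATEMENT 0: If μ is uniform modulo a product N = p₁p₂p₃p₄ of four distinct primes,
then with high probability the characteristic polynomial φ of M ~ M_n(μ) is irreducible
over ℚ and Gal(φ) ≥ A_n. -/

open scoped Classical

attribute [local instance] Polynomial.Gal.splits_ℚ_ℂ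

noncomputable section

/-- The probability of an event `E` for a random `n × n` integer matrix with
independent entries of law `μ`. -/
def matrixProbZ (n : ℕ) (μ : ℤ → ℝ) (E : Set (Matrix (Fin n) (Fin n) ℤ)) : ℝ :=
  ∑' M : Matrix (Fin n) (Fin n) ℤ, if M ∈ E then (∏ i, ∏ j, μ (M i j)) else 0

/-- The characteristic polynomial of an integer matrix, viewed over ℚ. -/
def charQ {n : ℕ} (M : Matrix (Fin n) (Fin n) ℤ) : Polynomial ℚ :=
  (Matrix.charpoly M).map (Int.castRingHom ℚ)

/-- `p` has `n` distinct complex roots and its Galois group, as a group of permutations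
of the complex roots, contains the alternating group. -/
def GalGeAlt (n : ℕ) (p : Polynomial ℚ) : Prop :=
  Fintype.card (p.rootSet ℂ) = n ∧
    alternatingGroup (p.rootSet ℂ) ≤ (Polynomial.Gal.galActionHom p ℂ).range

/-- Two permutations whose supports share exactly one point have a 3-cycle as commutator. -/
theorem Equiv.Perm.isThreeCycle_commutator_of_inter_singleton {α : Type*} [Fintype α]
    [DecidableEq α] {c d : Equiv.Perm α} {a : α} (hc : c a ≠ a) (hd : d a ≠ a)
    (h : ∀ x, c x ≠ x → d x ≠ x → x = a) :
    (c * d * c⁻¹ * d⁻¹).IsThreeCycle := by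
  have hcd : ∀ x, x ≠ a → c x ≠ x → d x = x := by
    intro x hx h1
    by_contra h2
    exact hx (h x h1 h2)
  have hdc : ∀ x, x ≠ a → d x ≠ x → c x = x := by
    intro x hx h1
    by_contra h2
    exact hx (h x h2 h1)
  have hu : d (c a) = c a := hcd _ hc (by simpa using hc)
  have hw : c (d a) = d a := hdc _ hd (by simpa using hd)
  have huw : c a ≠ d a := by
    intro e
    rw [e] at hu
    exact hd (by simpa using hu)
  have key : c * d * c⁻¹ * d⁻¹ = Equiv.swap a (d a) * Equiv.swap a (c a) := by
    rw [mul_inv_eq_iff_eq_mul, mul_inv_eq_iff_eq_mul]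
    ext x
    simp only [Equiv.Perm.mul_apply]
    by_cases hxa : x = a
    · rw [hxa, hu, Equiv.swap_apply_right, Equiv.swap_apply_left, hw]
    by_cases hxc : c x = x
    · rw [hxc]
      by_cases hdx : d x = a
      · rw [hdx, Equiv.swap_apply_left, Equiv.swap_apply_of_ne_of_ne hc huw]
      · have h1 : d x ≠ c a := by
          intro e
          have : x = c a := d.injective (e.trans hu.symm)
          rw [this] at hxc
          exact hc (c.injective hxc)
        have h2 : d x ≠ d a := fun e => hxa (d.injective e)
        rw [Equiv.swap_apply_of_ne_of_ne hdx h1, Equiv.swap_apply_of_ne_of_ne hdx h2]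
        by_cases h3 : d x = x
        · rw [h3, hxc]
        · exact hdc _ hdx (by simpa using h3)
    · rw [hcd x hxa hxc]
      by_cases hcx : c x = a
      · rw [hcx, Equiv.swap_apply_of_ne_of_ne hd huw.symm, Equiv.swap_apply_right]
      · rw [hcd (c x) hcx (by simpa using hxc)]
        have h1 : c x ≠ c a := fun e => hxa (c.injective e)
        have h2 : c x ≠ d a := by
          intro e
          exact hxc (c.injective (by rw [e, hw]))
        rw [Equiv.swap_apply_of_ne_of_ne hcx h1, Equiv.swap_apply_of_ne_of_ne hcx h2]
  rw [key]
  exact Equiv.Perm.isThreeCycle_swap_mul_swap_same hd.symm hc.symm huw.symm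

open MulAction Equiv.Perm in
/-- A primitive permutation group containing a cycle of prime length at most half the degree
contains the alternating group. -/
theorem Equiv.Perm.alternatingGroup_le_of_isPreprimitive_of_isCycle_prime {α : Type*}
    [Fintype α] [DecidableEq α] {G : Subgroup (Equiv.Perm α)} (hG : IsPreprimitive G α)
    {c : Equiv.Perm α} (hc : c.IsCycle) (hp : c.support.card.Prime)
    (h2 : 2 * c.support.card ≤ Fintype.card α) (hcG : c ∈ G) :
    alternatingGroup α ≤ G := by
  have hp2 := hp.two_le
  obtain ⟨m, hm⟩ : ∃ m, Fintype.card α = c.support.card + (m + 1) :=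
    ⟨Fintype.card α - c.support.card - 1, by omega⟩
  have hsc : Set.ncard ((c.support)ᶜ : Set α) = m + 1 := by
    apply Nat.add_left_cancel
    rw [Set.ncard_add_ncard_compl, Set.ncard_coe_finset, Nat.card_eq_fintype_card, hm]
  have hprim : IsMultiplyPreprimitive G α (m + 2) := by
    apply hG.isMultiplyPreprimitive hsc
    · rw [Nat.card_eq_fintype_card]; omega
    have := isPretransitive_of_isCycle_mem hc hcG
    apply IsPreprimitive.of_prime_card
    convert! hp
    rw [Nat.card_eq_fintype_card, Fintype.card_subtype]
    congr 1
    ext x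
    rw [Finset.mem_filter_univ]
    exact (SubMulAction.mem_ofFixingSubgroup_iff _).trans (by simp)
  have htrans : IsMultiplyPretransitive G α (m + 2) := hprim.isMultiplyPretransitive
  have htr : IsMultiplyPretransitive G α c.support.card :=
    isMultiplyPretransitive_of_le (n := m + 2) (by omega) (by
      rw [Nat.card_eq_fintype_card]; omega)
  obtain ⟨a, ha⟩ : ∃ a, a ∈ c.support := Finset.card_pos.1 (by omega)
  have hcompl : c.supportᶜ.card = m + 1 := by
    rw [Finset.card_compl]; omega
  obtain ⟨S, hS, hScard⟩ := Finset.exists_subset_card_eq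
    (show c.support.card - 1 ≤ c.supportᶜ.card by omega)
  have haS : a ∉ S := fun h => by
    have := hS h
    simp only [Finset.mem_compl] at this
    exact this ha
  let e1 : Fin c.support.card ↪ α :=
    (c.support.equivFin.symm.toEmbedding).trans (Function.Embedding.subtype _)
  have hcard : (insert a S).card = c.support.card := by
    rw [Finset.card_insert_of_notMem haS]; omega
  let e2 : Fin c.support.card ↪ α :=
    ((finCongr hcard.symm).toEmbedding.trans (insert a S).equivFin.symm.toEmbedding).trans
      (Function.Embedding.subtype _)
  obtain ⟨g, hg⟩ := htr.exists_smul_eq e1 e2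
  have himg : ∀ y, y ∈ insert a S ↔ ∃ x ∈ c.support, (g : Equiv.Perm α) x = y := by
    intro y
    constructor
    · intro hy
      obtain ⟨i, hi⟩ : ∃ i, e2 i = y :=
        ⟨finCongr hcard ((insert a S).equivFin ⟨y, hy⟩), by simp [e2]⟩
      refine ⟨e1 i, by simp [e1], ?_⟩
      rw [← hi, ← hg]; rfl
    · rintro ⟨x, hx, rfl⟩
      have : x = e1 (c.support.equivFin ⟨x, hx⟩) := by simp [e1]
      have h3 := congrArg (fun e : Fin c.support.card ↪ α => e (c.support.equivFin ⟨x, hx⟩)) hg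
      have h4 : (g : Equiv.Perm α) (e1 (c.support.equivFin ⟨x, hx⟩)) =
        e2 (c.support.equivFin ⟨x, hx⟩) := h3
      rw [this, h4]
      simp only [e2, Function.Embedding.trans_apply, Function.Embedding.subtype_apply]
      exact Subtype.prop _
  set d : Equiv.Perm α := g * c * (g : Equiv.Perm α)⁻¹ with hd
  have hdsupp : ∀ y, d y ≠ y ↔ y ∈ insert a S := by
    intro y
    rw [himg]
    constructor
    · intro h
      refine ⟨(g : Equiv.Perm α)⁻¹ y, ?_, by simp⟩
      rw [mem_support]
      intro h5
      apply h
      change (g : Equiv.Perm α) (c ((g : Equiv.Perm α)⁻¹ y)) = y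
      rw [h5]; simp
    · rintro ⟨x, hx, rfl⟩ h
      rw [mem_support] at hx
      apply hx
      simpa [hd, mul_apply] using h
  have hdG : d ∈ G := G.mul_mem (G.mul_mem g.2 hcG) (G.inv_mem g.2)
  refine alternatingGroup_le_of_isPreprimitive_of_isThreeCycle_mem hG
    (isThreeCycle_commutator_of_inter_singleton (c := c) (d := d) (a := a)
      (mem_support.1 ha) ((hdsupp a).2 (Finset.mem_insert_self _ _)) ?_) ?_
  · intro x h1 h2
    rw [hdsupp, Finset.mem_insert] at h2
    rcases h2 with h2 | h2
    · exact h2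
    · have := hS h2
      rw [Finset.mem_compl, mem_support] at this
      exact absurd h1 this
  · exact G.mul_mem (G.mul_mem (G.mul_mem hcG hdG) (G.inv_mem hcG)) (G.inv_mem hdG)

open MulAction Pointwise in
/-- A nontrivial block meeting the support of a prime-length cycle `σ ^ N` contains that support
and is stable under `σ`. -/
theorem MulAction.IsBlock.invariant_of_pow_isCycle_prime {α : Type*} [Fintype α] [DecidableEq α]
    {G : Subgroup (Equiv.Perm α)} {B : Set α} (hB : IsBlock G B) {σ : Equiv.Perm α} (hσ : σ ∈ G)
    {N : ℕ} (hc : (σ ^ N).IsCycle) (hp : (σ ^ N).support.card.Prime) {x y : α} (hx : x ∈ B)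
    (hy : y ∈ B) (hxy : y ≠ x) (hcx : (σ ^ N) x ≠ x) :
    (∀ z ∈ B, σ z ∈ B) ∧ (((σ ^ N).support : Finset α) : Set α) ⊆ B := by
  have key : ∀ g ∈ G, ∀ a ∈ B, g a ∈ B → ∀ z ∈ B, g z ∈ B := by
    intro g hg a ha hga z hz
    have h := (isBlock_iff_smul_eq_of_mem.1 hB) (g := ⟨g, hg⟩) ha hga
    rw [← h]
    exact Set.smul_mem_smul_set (a := (⟨g, hg⟩ : G)) hz
  have hpow : ∀ g : Equiv.Perm α, (∀ z ∈ B, g z ∈ B) → ∀ m : ℕ, ∀ z ∈ B, (g ^ m) z ∈ B := by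
    intro g hg m
    induction m with
    | zero => intro z hz; simpa using hz
    | succ m ih => intro z hz; rw [pow_succ', Equiv.Perm.mul_apply]; exact hg _ (ih z hz)
  set c := σ ^ N with hcdef
  have hcG : c ∈ G := G.pow_mem hσ N
  have hcxB : ∀ z ∈ B, c z ∈ B := by
    by_cases hcy : c y = y
    · exact key c hcG y hy (by rwa [hcy])
    · obtain ⟨j, hj⟩ := hc.exists_pow_eq hcx hcy
      have hcop : j.Coprime (orderOf c) := by
        rw [hc.orderOf, Nat.coprime_comm, hp.coprime_iff_not_dvd]
        intro hd
        rw [← hc.orderOf] at hd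
        rw [orderOf_dvd_iff_pow_eq_one.1 hd] at hj
        exact hxy (by simpa using hj.symm)
      obtain ⟨m, hm⟩ := exists_pow_eq_self_of_coprime hcop
      have := hpow (c ^ j) (key _ (G.pow_mem hcG j) x hx (by rwa [hj])) m
      rwa [hm] at this
  have hsupp : ((c.support : Finset α) : Set α) ⊆ B := by
    intro z hz
    obtain ⟨j, rfl⟩ := hc.exists_pow_eq hcx (Equiv.Perm.mem_support.1 (Finset.mem_coe.1 hz))
    exact hpow c hcxB j x hx
  refine ⟨key σ hσ x hx (hsupp ?_), hsupp⟩
  rw [Finset.mem_coe, Equiv.Perm.mem_support]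
  have hcomm : c * σ = σ * c := by rw [hcdef, pow_mul_comm']
  intro h
  apply hcx
  rw [← Equiv.Perm.mul_apply, hcomm, Equiv.Perm.mul_apply] at h
  exact σ.injective h

open MulAction Pointwise in
/-- A transitive permutation group contains the alternating group as soon as it contains elements
having powers that are cycles of prime length in `[k₀, n / 2]`, such that no size in `[k₀, n / 2]`
is the size of an invariant set of each of them. -/
theorem Equiv.Perm.alternatingGroup_le_of_pow_isCycle_prime {α : Type*} [Fintype α]
    [DecidableEq α] {G : Subgroup (Equiv.Perm α)} (hG : IsPretransitive G α) {ι : Type*}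
    [Nonempty ι] (σ : ι → Equiv.Perm α) (hσ : ∀ i, σ i ∈ G) (N : ι → ℕ) (k₀ : ℕ)
    (hc : ∀ i, (σ i ^ N i).IsCycle) (hp : ∀ i, (σ i ^ N i).support.card.Prime)
    (hk : ∀ i, k₀ ≤ (σ i ^ N i).support.card)
    (h2 : ∀ i, 2 * (σ i ^ N i).support.card ≤ Fintype.card α)
    (hinv : ∀ k, k₀ ≤ k → 2 * k ≤ Fintype.card α →
      ∃ i, ∀ B : Finset α, (∀ x ∈ B, σ i x ∈ B) → B.card ≠ k) :
    alternatingGroup α ≤ G := by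
  have hprim : IsPreprimitive G α := by
    refine { isTrivialBlock_of_isBlock := ?_ }
    intro B hB
    by_contra hcon
    rw [IsTrivialBlock, not_or, Set.not_subsingleton_iff] at hcon
    obtain ⟨hnt, hnu⟩ := hcon
    have hmain : ∀ i, ∃ g : G, (∀ z ∈ g • B, σ i z ∈ g • B) ∧
        (((σ i ^ N i).support : Finset α) : Set α) ⊆ g • B := by
      intro i
      obtain ⟨z, hz⟩ := hnt.nonempty
      obtain ⟨x, hx⟩ := (hc i).nonempty_support
      obtain ⟨g, hg⟩ := exists_smul_eq G z x
      have hx' : x ∈ g • B := hg ▸ Set.smul_mem_smul_set hz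
      have hnt' : (g • B).Nontrivial := by
        obtain ⟨a, ha, b, hb, hab⟩ := hnt
        exact ⟨g • a, Set.smul_mem_smul_set ha, g • b, Set.smul_mem_smul_set hb,
          fun h => hab (MulAction.injective g h)⟩
      obtain ⟨y, hy, hyx⟩ := hnt'.exists_ne x
      exact ⟨g, (hB.translate g).invariant_of_pow_isCycle_prime (hσ i) (hc i) (hp i) hx' hy hyx
        (Equiv.Perm.mem_support.1 hx)⟩
    choose g hg1 hg2 using hmain
    have hcard : ∀ g : G, (g • B).ncard = B.ncard := fun g => Set.ncard_smul_set g B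
    obtain ⟨i₀⟩ := ‹Nonempty ι›
    have hkB : k₀ ≤ B.ncard := by
      rw [← hcard (g i₀)]
      refine (hk i₀).trans ?_
      rw [← Set.ncard_coe_finset]
      exact Set.ncard_le_ncard (hg2 i₀) (Set.toFinite _)
    have hB2 : 2 * B.ncard ≤ Fintype.card α := by
      by_contra hlt
      apply hnu
      apply hB.eq_univ_of_card_lt
      rw [Nat.card_eq_fintype_card]; omega
    obtain ⟨i, hi⟩ := hinv _ hkB hB2
    refine hi (Set.toFinite (g i • B)).toFinset ?_ ?_
    · intro x hx
      rw [Set.Finite.mem_toFinset] at hx ⊢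
      exact hg1 i x hx
    · rw [← hcard (g i), Set.ncard_eq_toFinset_card _ (Set.toFinite _)]
  obtain ⟨i₀⟩ := ‹Nonempty ι›
  exact alternatingGroup_le_of_isPreprimitive_of_isCycle_prime hprim (hc i₀) (hp i₀) (h2 i₀)
    (G.pow_mem (hσ i₀) _)

open Polynomial in
/-- `f` has an irreducible factor of prime degree `r ≥ R`, of multiplicity one, such that no other
irreducible factor has degree divisible by `r` and no irreducible factor has multiplicity `r`. -/
def HasIsolatedPrimeFactor {F : Type*} [Field F] (f : F[X]) (R : ℕ) : Prop :=
  ∃ φ : F[X], φ.Monic ∧ Irreducible φ ∧ φ.natDegree.Prime ∧ R ≤ φ.natDegree ∧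
    2 * φ.natDegree ≤ f.natDegree ∧ φ ∣ f ∧ ¬ φ ^ 2 ∣ f ∧
    (∀ ψ : F[X], ψ.Monic → Irreducible ψ → ψ ∣ f → φ.natDegree ∣ ψ.natDegree → ψ = φ) ∧
    ∀ ψ : F[X], ψ.Monic → Irreducible ψ → ¬ ψ ^ φ.natDegree ∣ f

open Polynomial in
theorem Polynomial.minpoly_pow_dvd_of_pow_dvd_map {F k : Type*} [Field F] [PerfectField F] [Field k]
    [Algebra F k] {α : k} (hα : IsIntegral F α) (e : ℕ) (f : F[X]) (hf : f ≠ 0)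
    (h : (X - C α) ^ e ∣ f.map (algebraMap F k)) : minpoly F α ^ e ∣ f := by
  induction e generalizing f with
  | zero => simp
  | succ e ih =>
    have h0 : aeval α f = 0 := by
      rw [aeval_def, ← eval_map]
      exact dvd_iff_isRoot.1 ((dvd_pow_self _ (Nat.succ_ne_zero e)).trans h)
    obtain ⟨g, rfl⟩ := minpoly.dvd F α h0
    have hg : g ≠ 0 := right_ne_zero_of_mul hf
    rw [pow_succ']
    refine mul_dvd_mul_left _ (ih g hg ?_)
    have hne : (minpoly F α * g).map (algebraMap F k) ≠ 0 := map_ne_zero hf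
    rw [← le_rootMultiplicity_iff hne] at h
    rw [← le_rootMultiplicity_iff (map_ne_zero hg)]
    rw [Polynomial.map_mul] at h hne
    rw [rootMultiplicity_mul hne] at h
    have h1 := rootMultiplicity_le_one_of_separable
      ((PerfectField.separable_of_irreducible (minpoly.irreducible hα)).map
        (f := algebraMap F k)) α
    omega

open Polynomial in
theorem FiniteField.natDegree_minpoly_dvd_iff {p : ℕ} [Fact p.Prime] {k : Type*} [Field k]
    [Algebra (ZMod p) k] {α : k} (hα : IsIntegral (ZMod p) α) (i : ℕ) :
    (minpoly (ZMod p) α).natDegree ∣ i ↔ α ^ p ^ i = α := by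
  rw [Irreducible.natDegree_dvd_iff_dvd_X_pow_card_pow_sub_X (minpoly.irreducible hα),
    Nat.card_zmod, minpoly.dvd_iff]
  simp [sub_eq_zero]

section FrobeniusPerm

open Polynomial

variable {p : ℕ} [Fact p.Prime] {k : Type*} [Field k] [Algebra (ZMod p) k]
  {Ω : Type*} [Fintype Ω] [DecidableEq Ω] {σ : Equiv.Perm Ω} {r : Ω → k} {f : (ZMod p)[X]}

omit [Fact p.Prime] [Algebra (ZMod p) k] [Fintype Ω] [DecidableEq Ω] in
theorem frobeniusPerm_pow (hr : ∀ x, r (σ x) = r x ^ p) (i : ℕ) (x : Ω) :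
    r ((σ ^ i) x) = r x ^ p ^ i := by
  induction i with
  | zero => simp
  | succ i ih => rw [pow_succ', Equiv.Perm.mul_apply, hr, ih, ← pow_mul, pow_succ]

/-- Sets invariant under a lift of Frobenius correspond to factors over the prime field. -/
theorem exists_monic_dvd_of_frobeniusPerm_invariant (hr : ∀ x, r (σ x) = r x ^ p)
    (hf : f.map (algebraMap (ZMod p) k) = ∏ x, (X - C (r x))) (B : Finset Ω)
    (hB : ∀ x ∈ B, σ x ∈ B) : ∃ g : (ZMod p)[X], g.Monic ∧ g.natDegree = B.card ∧ g ∣ f := by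
  have : CharP k p := charP_of_injective_algebraMap (algebraMap (ZMod p) k).injective p
  set g : k[X] := ∏ x ∈ B, (X - C (r x)) with hg
  have himg : B.image σ = B := by
    refine Finset.eq_of_subset_of_card_le ?_ ?_
    · intro y hy
      obtain ⟨x, hx, rfl⟩ := Finset.mem_image.1 hy
      exact hB x hx
    · rw [Finset.card_image_of_injective _ σ.injective]
  have hfix : g.map (frobenius k p) = g := by
    rw [hg, Polynomial.map_prod]
    conv_rhs => rw [← himg]
    rw [Finset.prod_image (fun _ _ _ _ h => σ.injective h)]
    refine Finset.prod_congr rfl fun x _ => ?_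
    simp [hr, frobenius_def]
  have hlift : g ∈ lifts (algebraMap (ZMod p) k) := by
    rw [lifts_iff_coeff_lifts]
    intro n
    have h1 : g.coeff n ^ p = g.coeff n := by
      conv_rhs => rw [← hfix]
      rw [coeff_map, frobenius_def]
    have h2 : g.coeff n ∈ (⊥ : Subfield k) := (Subfield.mem_bot_iff_pow_eq_self k p).2 h1
    have h3 : (⊥ : Subfield k) ≤ (algebraMap (ZMod p) k).fieldRange := bot_le
    exact h3 h2
  have hmon : g.Monic := monic_prod_of_monic _ _ fun x _ => monic_X_sub_C _
  obtain ⟨g₀, h1, h2, h3⟩ := lifts_and_natDegree_eq_and_monic hlift hmon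
  refine ⟨g₀, h3, ?_, ?_⟩
  · rw [h2, hg, natDegree_prod_of_monic _ _ fun x _ => monic_X_sub_C _]
    simp
  · rw [← map_dvd_map (algebraMap (ZMod p) k) (algebraMap (ZMod p) k).injective h3, h1, hf, hg]
    exact Finset.prod_dvd_prod_of_subset _ _ _ (Finset.subset_univ _)

theorem exists_pow_isCycle_of_frobeniusPerm (hr : ∀ x, r (σ x) = r x ^ p)
    (hf : f.map (algebraMap (ZMod p) k) = ∏ x, (X - C (r x))) {R : ℕ}
    (h : HasIsolatedPrimeFactor f R) :
    ∃ N, (σ ^ N).IsCycle ∧ (σ ^ N).support.card.Prime ∧ R ≤ (σ ^ N).support.card ∧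
      2 * (σ ^ N).support.card ≤ Fintype.card Ω := by
  obtain ⟨φ, hφm, hφi, hφp, hφR, hφ2, hφf, hφsq, hφu, hφpow⟩ := h
  have hfdeg : f.natDegree = Fintype.card Ω := by
    rw [← natDegree_map (algebraMap (ZMod p) k), hf,
      natDegree_prod_of_monic _ _ fun x _ => monic_X_sub_C _]
    simp
  have hf0 : f ≠ 0 := by
    rintro rfl
    rw [Polynomial.map_zero] at hf
    exact (monic_prod_of_monic Finset.univ (fun x => X - C (r x))
      fun x _ => monic_X_sub_C _).ne_zero hf.symm
  have hroot : ∀ x, aeval (r x) f = 0 := by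
    intro x
    rw [aeval_def, ← eval_map, hf, eval_prod]
    exact Finset.prod_eq_zero (Finset.mem_univ x) (by simp)
  have h_int : ∀ x, IsIntegral (ZMod p) (r x) := fun x =>
    IsAlgebraic.isIntegral ⟨f, hf0, hroot x⟩
  set d := φ.natDegree with hd
  have hpt : ∀ x m, (σ ^ m) x = x → (minpoly (ZMod p) (r x)).natDegree ∣ m := by
    intro x m hm
    rw [FiniteField.natDegree_minpoly_dvd_iff (h_int x), ← frobeniusPerm_pow hr, hm]
  set T : Finset Ω := Finset.univ.filter fun x => aeval (r x) φ = 0 with hT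
  have hTmin : ∀ x ∈ T, minpoly (ZMod p) (r x) = φ := by
    intro x hx
    exact (minpoly.eq_of_irreducible_of_monic hφi (Finset.mem_filter.1 hx).2 hφm).symm
  have hTσ : ∀ x ∈ T, ∀ m : ℕ, (σ ^ m) x ∈ T := by
    intro x hx m
    induction m with
    | zero => simpa using hx
    | succ m ih =>
      rw [pow_succ', Equiv.Perm.mul_apply]
      rw [hT, Finset.mem_filter] at ih ⊢
      refine ⟨Finset.mem_univ _, ?_⟩
      rw [hr, ← expand_aeval, ZMod.expand_card, map_pow, ih.2,
        zero_pow (Fact.out (p := p.Prime)).ne_zero]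
  have hTcard : T.card = d := by
    obtain ⟨h, rfl⟩ := hφf
    have hh0 : h ≠ 0 := right_ne_zero_of_mul hf0
    have hsplit : (φ.map (algebraMap (ZMod p) k)).Splits := by
      refine Splits.of_dvd ?_ (map_ne_zero hf0) (Polynomial.map_dvd _ (dvd_mul_right φ h))
      rw [hf]
      exact Splits.prod fun x _ => Splits.X_sub_C _
    have h1 : (Finset.univ.val.map r) = (φ.map (algebraMap (ZMod p) k)).roots +
        (h.map (algebraMap (ZMod p) k)).roots := by
      rw [← roots_mul, ← Polynomial.map_mul, hf]
      · rw [roots_prod _ _ (monic_prod_of_monic Finset.univ (fun x => X - C (r x))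
          fun x _ => monic_X_sub_C _).ne_zero]
        simp [Multiset.bind_singleton]
      · exact mul_ne_zero (map_ne_zero hφm.ne_zero) (map_ne_zero hh0)
    have h2 := congrArg (fun s => Multiset.card (s.filter fun α => aeval α φ = 0)) h1
    simp only [Multiset.filter_add, Multiset.card_add] at h2
    rw [Multiset.filter_eq_self (s := (φ.map (algebraMap (ZMod p) k)).roots).2,
      Multiset.filter_eq_nil (s := (h.map (algebraMap (ZMod p) k)).roots).2, Multiset.card_zero, add_zero,
      ← hsplit.natDegree_eq_card_roots, natDegree_map, Multiset.filter_map,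
      Multiset.card_map] at h2
    · rw [hd, ← h2, hT, ← Finset.filter_val, Finset.card_val]
      rfl
    · intro α hα hα0
      rw [mem_roots (map_ne_zero hh0), IsRoot, eval_map, ← aeval_def] at hα
      apply hφsq
      rw [pow_two]
      refine mul_dvd_mul_left _ ?_
      rw [minpoly.eq_of_irreducible_of_monic hφi hα0 hφm]
      exact minpoly.dvd _ _ hα
    · intro α hα
      rw [mem_roots (map_ne_zero hφm.ne_zero), IsRoot, eval_map, ← aeval_def] at hα
      exact hα
  -- the complement of `T`
  have hper : ∀ x, Function.IsPeriodicPt σ (orderOf σ) x := by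
    intro x
    rw [Function.IsPeriodicPt, Function.IsFixedPt, ← Equiv.Perm.coe_pow, pow_orderOf_eq_one]
    rfl
  have hpos : ∀ x, 0 < Function.minimalPeriod σ x := fun x =>
    Function.minimalPeriod_pos_of_mem_periodicPts ⟨_, orderOf_pos σ, hper x⟩
  have hfix : ∀ x m, (σ ^ m) x = x ↔ Function.minimalPeriod σ x ∣ m := by
    intro x m
    rw [← Function.isPeriodicPt_iff_minimalPeriod_dvd, Function.IsPeriodicPt, Function.IsFixedPt,
      ← Equiv.Perm.coe_pow]
  have hout : ∀ x ∉ T, ¬ d ∣ Function.minimalPeriod σ x := by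
    intro x hx hdvd
    set ψ := minpoly (ZMod p) (r x) with hψ
    have hψi : Irreducible ψ := minpoly.irreducible (h_int x)
    have hψm : ψ.Monic := minpoly.monic (h_int x)
    have hψd : ¬ d ∣ ψ.natDegree := by
      intro h1
      have := hφu ψ hψm hψi (minpoly.dvd _ _ (hroot x)) h1
      apply hx
      rw [hT, Finset.mem_filter]
      exact ⟨Finset.mem_univ _, by rw [← this]; exact minpoly.aeval _ _⟩
    set F : Finset Ω := Finset.univ.filter fun y => r y = r x with hF
    have hFcard : F.card < d := by
      by_contra hge
      apply hφpow ψ hψm hψi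
      refine (pow_dvd_pow ψ (not_lt.1 hge)).trans
        (minpoly_pow_dvd_of_pow_dvd_map (h_int x) _ f hf0 ?_)
      rw [hf]
      have : (X - C (r x)) ^ F.card = ∏ y ∈ F, (X - C (r y)) := by
        rw [← Finset.prod_const]
        refine Finset.prod_congr rfl fun y hy => ?_
        rw [(Finset.mem_filter.1 hy).2]
      rw [this]
      exact Finset.prod_dvd_prod_of_subset _ _ _ (Finset.subset_univ _)
    -- the orbit of `x` under `σ ^ deg ψ` stays in `F`
    have hmaps : ∀ j : ℕ, ((σ ^ ψ.natDegree) ^ j) x ∈ F := by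
      intro j
      rw [hF, Finset.mem_filter]
      refine ⟨Finset.mem_univ _, ?_⟩
      rw [← pow_mul, frobeniusPerm_pow hr]
      exact (FiniteField.natDegree_minpoly_dvd_iff (h_int x) _).1 (dvd_mul_right _ _)
    obtain ⟨a, ha, b, hb, hab, heq⟩ := Finset.exists_ne_map_eq_of_card_lt_of_maps_to
      (s := Finset.range (F.card + 1)) (t := F) (by simp)
      (f := fun j => ((σ ^ ψ.natDegree) ^ j) x) (fun j _ => hmaps j)
    wlog hlt : a < b generalizing a b
    · exact this b hb a ha hab.symm heq.symm (lt_of_le_of_ne (not_lt.1 hlt) hab.symm)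
    have hb' := Finset.mem_range.1 hb
    have hc : (σ ^ (ψ.natDegree * (b - a))) x = x := by
      have h3 : ((σ ^ ψ.natDegree) ^ a) (((σ ^ ψ.natDegree) ^ (b - a)) x) =
          ((σ ^ ψ.natDegree) ^ a) x := by
        rw [← Equiv.Perm.mul_apply, ← pow_add, Nat.add_sub_cancel' hlt.le]
        exact heq.symm
      rw [pow_mul]
      exact ((σ ^ ψ.natDegree) ^ a).injective h3
    rw [hfix] at hc
    rcases hφp.dvd_mul.1 (hdvd.trans hc) with h4 | h4
    · exact hψd h4
    · have := Nat.le_of_dvd (by omega) h4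
      omega
  have hin : ∀ x ∈ T, Function.minimalPeriod σ x = d := by
    intro x hx
    have hdvd : d ∣ Function.minimalPeriod σ x := by
      have := hpt x _ ((hfix x _).2 dvd_rfl)
      rwa [hTmin x hx] at this
    refine le_antisymm ?_ (Nat.le_of_dvd (hpos x) hdvd)
    rw [← hTcard]
    have hinj : Set.InjOn (fun j => (σ ^ j) x)
        (Finset.range (Function.minimalPeriod σ x) : Set ℕ) := by
      intro a ha b hb hab
      simp only [Finset.coe_range, Set.mem_Iio] at ha hb
      have hab' : σ^[a] x = σ^[b] x := by
        simpa only [Equiv.Perm.coe_pow] using hab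
      exact Function.iterate_injOn_Iio_minimalPeriod ha hb hab'
    have := Finset.card_le_card_of_injOn (t := T) _ (fun j _ => hTσ x hx j) hinj
    simpa using this
  set N := ∏ x ∈ Tᶜ, Function.minimalPeriod σ x with hN
  have hNd : ¬ d ∣ N := by
    intro h1
    obtain ⟨x, hx, hx'⟩ := (hφp.prime.dvd_finsetProd_iff _).1 h1
    exact hout x (Finset.mem_compl.1 hx) hx'
  have hsupp : (σ ^ N).support = T := by
    ext x
    rw [Equiv.Perm.mem_support, ne_eq, hfix]
    by_cases hx : x ∈ T
    · simp [hx, hin x hx, hNd]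
    · simp only [hx, iff_false, not_not]
      exact Finset.dvd_prod_of_mem _ (Finset.mem_compl.2 hx)
  have hord : orderOf (σ ^ N) = d := by
    have := Fact.mk hφp
    refine orderOf_eq_prime ?_ ?_
    · ext x
      rw [← pow_mul, Equiv.Perm.one_apply, hfix]
      by_cases hx : x ∈ T
      · rw [hin x hx]; exact dvd_mul_left _ _
      · exact (Finset.dvd_prod_of_mem _ (Finset.mem_compl.2 hx)).trans (dvd_mul_right _ _)
    · intro h1
      rw [h1, Equiv.Perm.support_one] at hsupp
      rw [← hsupp, Finset.card_empty] at hTcard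
      exact hφp.ne_zero hTcard.symm
  refine ⟨N, ?_, ?_, ?_, ?_⟩
  · refine Equiv.Perm.isCycle_of_prime_order (by rwa [hord]) ?_
    rw [hsupp, hord, hTcard]
    have := hφp.pos
    omega
  · rwa [hsupp, hTcard]
  · rwa [hsupp, hTcard]
  · rwa [hsupp, hTcard, ← hfdeg]

end FrobeniusPerm

open NumberField in
/-- Existence of Frobenius elements in the Galois group of a number field. -/
theorem exists_galois_frobenius {L : Type} [Field L] [ha : Algebra ℚ L] [hd : FiniteDimensional ℚ L]
    [IsGalois ℚ L] (p : ℕ) [hp : Fact p.Prime] :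
    ∃ (τ : L ≃ₐ[ℚ] L) (k : Type) (_ : Field k) (_ : Algebra (ZMod p) k)
      (π : integralClosure ℤ L →+* k),
      ∀ x y : integralClosure ℤ L, τ (x : L) = y → π y = π x ^ p := by
  have hchar : CharZero L := algebraRat.charZero L
  obtain rfl : ha = DivisionRing.toRatAlgebra (R := L) := Subsingleton.elim _ _
  have : NumberField L := { to_charZero := hchar, to_finiteDimensional := hd }
  have : IsGaloisGroup (L ≃ₐ[ℚ] L) ℤ (𝓞 L) := inferInstance
  have : Algebra.IsInvariant ℤ (𝓞 L) (L ≃ₐ[ℚ] L) := this.isInvariant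
  have hm : (Ideal.span {(p : ℤ)}).IsMaximal :=
    PrincipalIdealRing.isMaximal_of_irreducible (Nat.prime_iff_prime_int.1 hp.out).irreducible
  obtain ⟨Q, hQ, hQp⟩ :=
    Ideal.exists_maximal_ideal_liesOver_of_isIntegral (S := 𝓞 L) (Ideal.span {(p : ℤ)})
  have hpQ : (p : 𝓞 L) ∈ Q := by
    have : (p : ℤ) ∈ Q.under ℤ := by rw [← hQp.over]; exact Ideal.mem_span_singleton_self _
    rw [Ideal.mem_comap] at this
    simpa using this
  have hne : Q ≠ ⊥ := by
    intro h
    rw [h, Ideal.mem_bot] at hpQ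
    exact hp.out.ne_zero (by exact_mod_cast hpQ)
  have : Finite (𝓞 L ⧸ Q) := Ideal.finiteQuotientOfFreeOfNeBot Q hne
  obtain ⟨σ, hσ⟩ := IsArithFrobAt.exists_of_isInvariant ℤ (L ≃ₐ[ℚ] L) Q
  have hcard : Nat.card (ℤ ⧸ Q.under ℤ) = p := by
    rw [← hQp.over, Nat.card_congr (Int.quotientSpanNatEquivZMod p).toEquiv, Nat.card_zmod]
  let _ : Field (𝓞 L ⧸ Q) := Ideal.Quotient.field Q
  have hcharp : CharP (𝓞 L ⧸ Q) p := by
    refine (CharP.charP_iff_prime_eq_zero hp.out).2 ?_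
    rw [← map_natCast (Ideal.Quotient.mk Q), Ideal.Quotient.eq_zero_iff_mem]
    exact hpQ
  let _ : Algebra (ZMod p) (𝓞 L ⧸ Q) := ZMod.algebra _ p
  refine ⟨σ, 𝓞 L ⧸ Q, inferInstance, inferInstance, Ideal.Quotient.mk Q, ?_⟩
  intro x y hxy
  have hx := hσ x
  have e : MulSemiringAction.toAlgHom ℤ (𝓞 L) σ x = y := Subtype.ext hxy
  rw [hcard, e] at hx
  exact (Ideal.Quotient.eq.2 hx).trans (map_pow (Ideal.Quotient.mk Q) (x : 𝓞 L) p)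

open Polynomial in
theorem Polynomial.Separable.map_eq_prod_rootSet {F L : Type*} [Field F] [Field L] [Algebra F L]
    {f : F[X]} (hm : f.Monic) (hsep : f.Separable) (hs : (f.map (algebraMap F L)).Splits) :
    f.map (algebraMap F L) = ∏ x : f.rootSet L, (X - C (x : L)) := by
  rw [hs.eq_prod_roots_of_monic (hm.map _)]
  have hnd := nodup_roots (hsep.map (f := algebraMap F L))
  have h1 : (f.map (algebraMap F L)).roots = (f.aroots L).toFinset.val := by
    rw [Multiset.toFinset_val, aroots_def, Multiset.dedup_eq_self.2 hnd]
  rw [h1]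
  have h2 : (((f.aroots L).toFinset.val.map fun a => X - C a).prod : L[X]) =
    ∏ a ∈ (f.aroots L).toFinset, (X - C a) := rfl
  rw [h2]
  refine (Finset.prod_subtype _ (p := fun x => x ∈ f.rootSet L) ?_ _)
  intro x
  rw [rootSet, Finset.mem_coe]

open Polynomial in
/-- The Galois group of an integer polynomial contains an element lifting the Frobenius at a
given prime. -/
theorem exists_galois_frobenius_rootSet {L : Type} [Field L] [Algebra ℚ L] (χ : ℤ[X])
    (hχ : χ.Monic) {f : ℚ[X]} (hf : f = χ.map (Int.castRingHom ℚ)) (hsep : f.Separable)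
    [hL : IsSplittingField ℚ L f] (p : ℕ) [hp : Fact p.Prime] :
    ∃ (τ : L ≃ₐ[ℚ] L) (k : Type) (_ : Field k) (_ : Algebra (ZMod p) k) (r : f.rootSet L → k),
      (∀ x y : f.rootSet L, τ x = y → r y = r x ^ p) ∧
      (χ.map (Int.castRingHom (ZMod p))).map (algebraMap (ZMod p) k) = ∏ x, (X - C (r x)) := by
  have : IsGalois ℚ L := IsGalois.of_separable_splitting_field hsep
  have : FiniteDimensional ℚ L := IsSplittingField.finiteDimensional L f
  obtain ⟨τ, k, _, _, π, hτ⟩ := exists_galois_frobenius (L := L) p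
  have h_int : ∀ x : f.rootSet L, IsIntegral ℤ (x : L) := by
    intro x
    refine ⟨χ, hχ, ?_⟩
    have h := aeval_eq_zero_of_mem_rootSet x.2
    generalize (x : L) = y at h
    rw [hf, aeval_def, eval₂_map] at h
    have h3 : (algebraMap ℚ L).comp (Int.castRingHom ℚ) = algebraMap ℤ L := Subsingleton.elim _ _
    rw [h3] at h
    exact h
  let s : f.rootSet L → integralClosure ℤ L := fun x => ⟨x, h_int x⟩
  refine ⟨τ, k, inferInstance, inferInstance, fun x => π (s x), ?_, ?_⟩
  · intro x y hxy
    exact hτ (s x) (s y) hxy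
  · have hinj : Function.Injective (algebraMap (integralClosure ℤ L) L) := Subtype.val_injective
    have h1 : χ.map (algebraMap ℤ (integralClosure ℤ L)) = ∏ x : f.rootSet L, (X - C (s x)) := by
      apply map_injective _ hinj
      rw [Polynomial.map_map, Polynomial.map_prod]
      have h := hsep.map_eq_prod_rootSet (hf ▸ hχ.map _) (IsSplittingField.splits L f)
      have h' : f.map (algebraMap ℚ L) =
          χ.map ((algebraMap (integralClosure ℤ L) L).comp (algebraMap ℤ _)) := by
        rw [hf, Polynomial.map_map]
        congr 1
        exact Subsingleton.elim _ _
      rw [← h', h]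
      refine Finset.prod_congr rfl fun x _ => ?_
      rw [Polynomial.map_sub, map_X, map_C]
      rfl
    have h2 := congrArg (Polynomial.map π) h1
    rw [Polynomial.map_map, Polynomial.map_prod] at h2
    rw [Polynomial.map_map]
    have h3 : (algebraMap (ZMod p) k).comp (Int.castRingHom (ZMod p)) =
      π.comp (algebraMap ℤ (integralClosure ℤ L)) := Subsingleton.elim _ _
    rw [h3, h2]
    refine Finset.prod_congr rfl fun x _ => ?_
    rw [Polynomial.map_sub, map_X, map_C]

open Polynomial in
/-- The Galois group of an integer polynomial contains a permutation of the complex roots lifting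
the Frobenius at a given prime. -/
theorem exists_frobeniusPerm_mem_galActionHom_range (χ : ℤ[X]) (hχ : χ.Monic) {f : ℚ[X]}
    (hf : f = χ.map (Int.castRingHom ℚ)) (hsep : f.Separable) (p : ℕ) [hp : Fact p.Prime] :
    ∃ σ ∈ (Gal.galActionHom f ℂ).range,
      ∃ (k : Type) (_ : Field k) (_ : Algebra (ZMod p) k) (r : f.rootSet ℂ → k),
        (∀ x, r (σ x) = r x ^ p) ∧
        (χ.map (Int.castRingHom (ZMod p))).map (algebraMap (ZMod p) k) = ∏ x, (X - C (r x)) := by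
  have hspl := IsSplittingField.splittingField f
  obtain ⟨τ, k, _, _, r, h1, h2⟩ := exists_galois_frobenius_rootSet χ hχ hf hsep (hL := hspl) p
  refine ⟨Gal.galActionHom f ℂ τ, ⟨τ, rfl⟩, k, inferInstance, inferInstance,
    fun x => r ((Gal.rootsEquivRoots f ℂ).symm x), ?_, ?_⟩
  · intro x
    have h3 : (Gal.rootsEquivRoots f ℂ).symm (Gal.galActionHom f ℂ τ x) =
        τ • (Gal.rootsEquivRoots f ℂ).symm x := by
      rw [Equiv.symm_apply_eq]; rfl
    exact h1 _ _ (congrArg Subtype.val h3).symm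
  · rw [h2, ← (Gal.rootsEquivRoots f ℂ).prod_comp]
    simp

open Polynomial in
theorem irreducible_and_galGeAlt_of_reductions {n : ℕ} (M : Matrix (Fin n) (Fin n) ℤ)
    {ι : Type*} [Nonempty ι] (p : ι → ℕ) (hp : ∀ i, (p i).Prime) (k₀ : ℕ)
    (h1 : ∀ g : ℤ[X], g.Monic → 1 ≤ g.natDegree → g.natDegree < k₀ → ¬ g ∣ M.charpoly)
    (h2 : ∀ k, k₀ ≤ k → 2 * k ≤ n → ∃ i, ∀ g : (ZMod (p i))[X], g.Monic → g.natDegree = k →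
      ¬ g ∣ M.charpoly.map (Int.castRingHom (ZMod (p i))))
    (h3 : ∀ i, haveI := Fact.mk (hp i);
      HasIsolatedPrimeFactor (M.charpoly.map (Int.castRingHom (ZMod (p i)))) k₀) :
    Irreducible (charQ M) ∧ GalGeAlt n (charQ M) := by
  set χ := M.charpoly with hχdef
  have hχ : χ.Monic := Matrix.charpoly_monic M
  have hdeg : χ.natDegree = n := by simp [hχdef, Matrix.charpoly_natDegree_eq_dim]
  have hχ1 : χ ≠ 1 := by
    intro h
    obtain ⟨i⟩ := ‹Nonempty ι›
    have := Fact.mk (hp i)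
    obtain ⟨φ, -, -, h5, -, h6, -⟩ := h3 i
    rw [h] at h6
    have := h5.pos
    simp at h6
    omega
  have hirrZ : Irreducible χ := by
    rw [hχ.irreducible_iff_natDegree']
    refine ⟨hχ1, ?_⟩
    intro f g hf hg hfg hmem
    rw [Finset.mem_Ioc, hdeg] at hmem
    by_cases hlt : g.natDegree < k₀
    · exact h1 g hg hmem.1 hlt ⟨f, by rw [← hfg, mul_comm]⟩
    · obtain ⟨i, hi⟩ := h2 g.natDegree (not_lt.1 hlt) (by omega)
      have := Fact.mk (hp i)
      refine hi (g.map (Int.castRingHom (ZMod (p i)))) (hg.map (Int.castRingHom (ZMod (p i))))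
        (hg.natDegree_map (Int.castRingHom (ZMod (p i)))) ?_
      exact Polynomial.map_dvd _ ⟨f, by rw [← hfg, mul_comm]⟩
  have hirr : Irreducible (charQ M) :=
    (hχ.irreducible_iff_irreducible_map_fraction_map (K := ℚ)).1 hirrZ
  refine ⟨hirr, ?_⟩
  have hsep : (charQ M).Separable := hirr.separable
  have hcard : Fintype.card ((charQ M).rootSet ℂ) = n := by
    rw [card_rootSet_eq_natDegree hsep (IsAlgClosed.splits _), charQ, hχ.natDegree_map, hdeg]
  have hfrob := fun i => haveI := Fact.mk (hp i)
    exists_frobeniusPerm_mem_galActionHom_range χ hχ (f := charQ M) rfl hsep (p i)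
  choose σ hσ k hk ha r hr hprod using hfrob
  have hcyc := fun i => haveI := Fact.mk (hp i)
    exists_pow_isCycle_of_frobeniusPerm (hr i) (hprod i) (h3 i)
  choose N hN1 hN2 hN3 hN4 using hcyc
  have htrans : MulAction.IsPretransitive (Gal.galActionHom (charQ M) ℂ).range
      ((charQ M).rootSet ℂ) := by
    have h := Gal.galAction_isPretransitive (charQ M) ℂ hirr
    refine ⟨fun x y => ?_⟩
    obtain ⟨g, hg⟩ := h.exists_smul_eq x y
    exact ⟨⟨Gal.galActionHom (charQ M) ℂ g, g, rfl⟩, hg⟩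
  refine ⟨hcard, Equiv.Perm.alternatingGroup_le_of_pow_isCycle_prime htrans σ hσ N k₀ hN1 hN2 hN3
    hN4 ?_⟩
  intro m hm1 hm2
  rw [hcard] at hm2
  obtain ⟨i, hi⟩ := h2 m hm1 hm2
  refine ⟨i, fun B hB hBm => ?_⟩
  have := Fact.mk (hp i)
  obtain ⟨g, hg1, hg2, hg3⟩ := exists_monic_dvd_of_frobeniusPerm_invariant (hr i) (hprod i) B hB
  exact hi g hg1 (hg2.trans hBm) hg3

open Polynomial in
/-- The finite set of monic polynomials of degree `m` over a finite field. -/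
def monicsOfDegree (F : Type*) [Field F] [Fintype F] (m : ℕ) : Finset F[X] :=
  Finset.univ.image fun c : Fin m → F => X ^ m + ∑ i, C (c i) * X ^ (i : ℕ)

section Monics

open Polynomial

variable {F : Type*} [Field F] [Fintype F]

omit [Fintype F] in
theorem coeff_X_pow_add_sum {m : ℕ} (c : Fin m → F) (i : Fin m) :
    (X ^ m + ∑ i, C (c i) * X ^ (i : ℕ) : F[X]).coeff i = c i := by
  have h : (i : ℕ) ≠ m := i.2.ne
  simp [coeff_X_pow, finsetSum_coeff, coeff_C_mul, h, Fin.val_inj]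

theorem mem_monicsOfDegree {m : ℕ} {f : F[X]} :
    f ∈ monicsOfDegree F m ↔ f.Monic ∧ f.natDegree = m := by
  simp only [monicsOfDegree, Finset.mem_image, Finset.mem_univ, true_and]
  constructor
  · rintro ⟨c, rfl⟩
    have hd : (∑ i, C (c i) * X ^ (i : ℕ) : F[X]).degree < m :=
      Polynomial.degree_sum_fin_lt c
    refine ⟨monic_X_pow_add hd, natDegree_eq_of_degree_eq_some ?_⟩
    rw [degree_add_eq_left_of_degree_lt (by simpa using hd), degree_X_pow]
  · rintro ⟨hf, rfl⟩
    refine ⟨fun i => f.coeff i, ?_⟩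
    conv_rhs => rw [hf.as_sum]
    rw [Finset.sum_range fun i => C (f.coeff i) * X ^ i]

theorem card_monicsOfDegree (m : ℕ) :
    (monicsOfDegree F m).card = Fintype.card F ^ m := by
  rw [monicsOfDegree, Finset.card_image_of_injective, Finset.card_univ, Fintype.card_fun,
    Fintype.card_fin]
  intro c c' h
  funext i
  rw [← coeff_X_pow_add_sum c i, ← coeff_X_pow_add_sum c' i]
  exact congrArg (fun f : F[X] => f.coeff i) h

theorem sum_monicsOfDegree_filter_dvd {D : F[X]} (hD : D.Monic) {m : ℕ} (h : D.natDegree ≤ m)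
    (f : F[X] → ℝ) :
    ∑ g ∈ (monicsOfDegree F m).filter (D ∣ ·), f g =
      ∑ g ∈ monicsOfDegree F (m - D.natDegree), f (D * g) := by
  symm
  refine Finset.sum_bij (fun g _ => D * g) ?_ ?_ ?_ fun _ _ => rfl
  · intro g hg
    rw [mem_monicsOfDegree] at hg
    rw [Finset.mem_filter, mem_monicsOfDegree]
    refine ⟨⟨hD.mul hg.1, ?_⟩, dvd_mul_right _ _⟩
    rw [hD.natDegree_mul hg.1, hg.2]
    omega
  · intro a _ b _ hab
    exact mul_left_cancel₀ hD.ne_zero hab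
  · intro g hg
    rw [Finset.mem_filter, mem_monicsOfDegree] at hg
    obtain ⟨⟨hg, hm⟩, k, rfl⟩ := hg
    have hk : k.Monic := hD.of_mul_monic_left hg
    refine ⟨k, ?_, rfl⟩
    rw [mem_monicsOfDegree]
    rw [hD.natDegree_mul hk] at hm
    exact ⟨hk, by omega⟩

theorem filter_dvd_monicsOfDegree_eq_empty {D : F[X]} {m : ℕ} (h : m < D.natDegree) :
    (monicsOfDegree F m).filter (D ∣ ·) = ∅ := by
  rw [Finset.filter_eq_empty_iff]
  intro g hg hdvd
  rw [mem_monicsOfDegree] at hg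
  have := natDegree_le_of_dvd hdvd hg.1.ne_zero
  omega

variable (F) in
/-- The average of `f` over monic polynomials of degree `m`. -/
def monicAvg (m : ℕ) (f : F[X] → ℝ) : ℝ :=
  (∑ g ∈ monicsOfDegree F m, f g) / (Fintype.card F : ℝ) ^ m

theorem card_pos_real : (0 : ℝ) < Fintype.card F := by
  exact_mod_cast Fintype.card_pos

theorem two_le_card_real : (2 : ℝ) ≤ Fintype.card F := by
  exact_mod_cast Fintype.one_lt_card (α := F)

theorem monicAvg_mono {m : ℕ} {f g : F[X] → ℝ}
    (h : ∀ a : F[X], a.Monic → a.natDegree = m → f a ≤ g a) : monicAvg F m f ≤ monicAvg F m g := by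
  refine div_le_div_of_nonneg_right (Finset.sum_le_sum fun a ha => ?_)
    (pow_pos card_pos_real m).le
  rw [mem_monicsOfDegree] at ha
  exact h a ha.1 ha.2

theorem monicAvg_nonneg {m : ℕ} {f : F[X] → ℝ} (h : ∀ a, 0 ≤ f a) : 0 ≤ monicAvg F m f :=
  div_nonneg (Finset.sum_nonneg fun a _ => h a) (pow_pos card_pos_real m).le

theorem monicAvg_one (m : ℕ) : monicAvg F m (fun _ => 1) = 1 := by
  have : ((Fintype.card F : ℝ) ^ m) ≠ 0 := (pow_pos card_pos_real m).ne'
  simp [monicAvg, card_monicsOfDegree, this]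

theorem monicAvg_sum {ι : Type*} (s : Finset ι) (m : ℕ) (f : ι → F[X] → ℝ) :
    monicAvg F m (fun a => ∑ i ∈ s, f i a) = ∑ i ∈ s, monicAvg F m (f i) := by
  simp only [monicAvg, ← Finset.sum_div]
  rw [Finset.sum_comm]

theorem monicAvg_const_mul (c : ℝ) (m : ℕ) (f : F[X] → ℝ) :
    monicAvg F m (fun a => c * f a) = c * monicAvg F m f := by
  simp only [monicAvg, ← Finset.mul_sum, mul_div_assoc]

theorem monicAvg_add (m : ℕ) (f g : F[X] → ℝ) :
    monicAvg F m (fun a => f a + g a) = monicAvg F m f + monicAvg F m g := by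
  simp only [monicAvg, Finset.sum_add_distrib, add_div]

theorem monicAvg_ite_dvd {D : F[X]} (hD : D.Monic) {m : ℕ} (h : D.natDegree ≤ m)
    (f : F[X] → ℝ) :
    monicAvg F m (fun g => if D ∣ g then f g else 0) =
      ((Fintype.card F : ℝ) ^ D.natDegree)⁻¹ *
        monicAvg F (m - D.natDegree) (fun g => f (D * g)) := by
  rw [monicAvg, ← Finset.sum_filter, sum_monicsOfDegree_filter_dvd hD h, monicAvg]
  have h0 := (card_pos_real (F := F)).ne'
  conv_lhs => rw [← Nat.sub_add_cancel h, pow_add, Nat.add_sub_cancel]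
  field_simp

theorem monicAvg_ite_dvd_of_lt {D : F[X]} {m : ℕ} (h : m < D.natDegree) (f : F[X] → ℝ) :
    monicAvg F m (fun g => if D ∣ g then f g else 0) = 0 := by
  rw [monicAvg, ← Finset.sum_filter, filter_dvd_monicsOfDegree_eq_empty h]
  simp

theorem monicAvg_dvd {D : F[X]} (hD : D.Monic) {m : ℕ} (h : D.natDegree ≤ m) :
    monicAvg F m (fun g => if D ∣ g then 1 else 0) =
      ((Fintype.card F : ℝ) ^ D.natDegree)⁻¹ := by
  rw [monicAvg_ite_dvd hD h fun _ => 1, monicAvg_one, mul_one]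

theorem monicAvg_dvd_le {D : F[X]} (hD : D.Monic) (m : ℕ) :
    monicAvg F m (fun g => if D ∣ g then 1 else 0) ≤
      ((Fintype.card F : ℝ) ^ D.natDegree)⁻¹ := by
  by_cases h : D.natDegree ≤ m
  · exact (monicAvg_dvd hD h).le
  · rw [monicAvg_ite_dvd_of_lt (not_le.1 h) fun _ => 1]
    exact inv_nonneg.2 (pow_pos card_pos_real _).le

variable (F) in
/-- The finite set of monic irreducible polynomials of degree `d`. -/
def monicIrreducibles (d : ℕ) : Finset F[X] :=
  (monicsOfDegree F d).filter Irreducible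

theorem mem_monicIrreducibles {d : ℕ} {f : F[X]} :
    f ∈ monicIrreducibles F d ↔ f.Monic ∧ f.natDegree = d ∧ Irreducible f := by
  rw [monicIrreducibles, Finset.mem_filter, mem_monicsOfDegree, and_assoc]

/-- Number of irreducible factors of degree at most `y`, counted with multiplicity. -/
def bigOmegaUpTo (y : ℕ) (g : F[X]) : ℕ :=
  (UniqueFactorizationMonoid.normalizedFactors g).countP (fun φ => φ.natDegree ≤ y)

omit [Fintype F] in
theorem Polynomial.Monic.of_mem_normalizedFactors {g φ : F[X]}
    (h : φ ∈ UniqueFactorizationMonoid.normalizedFactors g) : φ.Monic := by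
  have h0 := (UniqueFactorizationMonoid.irreducible_of_normalized_factor φ h).ne_zero
  have h1 := UniqueFactorizationMonoid.normalize_normalized_factor φ h
  rw [← h1]
  exact Polynomial.monic_normalize h0

omit [Fintype F] in
theorem Polynomial.Monic.natDegree_eq_sum_count {g : F[X]} (hg : g.Monic) :
    g.natDegree = ∑ φ ∈ (UniqueFactorizationMonoid.normalizedFactors g).toFinset,
      (UniqueFactorizationMonoid.normalizedFactors g).count φ * φ.natDegree := by
  have h1 := UniqueFactorizationMonoid.prod_normalizedFactors_eq hg.ne_zero
  rw [hg.normalize_eq_self] at h1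
  conv_lhs => rw [← h1]
  rw [natDegree_multiset_prod_of_monic _ fun f hf => Polynomial.Monic.of_mem_normalizedFactors hf,
    Finset.sum_multiset_map_count]
  rfl

omit [Fintype F] in
theorem Polynomial.Monic.pow_dvd_iff_le_count {g φ : F[X]} (hg : g.Monic) (hφ : φ.Monic)
    (hi : Irreducible φ) (e : ℕ) :
    φ ^ e ∣ g ↔ e ≤ (UniqueFactorizationMonoid.normalizedFactors g).count φ := by
  have h := UniqueFactorizationMonoid.emultiplicity_eq_count_normalizedFactors hi hg.ne_zero
  rw [hφ.normalize_eq_self] at h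
  rw [pow_dvd_iff_le_emultiplicity, h]
  exact Nat.cast_le

theorem sum_Icc_sum_divisorsAntidiagonal {M : Type*} [AddCommMonoid M] (n : ℕ) (h : ℕ → ℕ → M)
    (h0 : ∀ d e, 1 ≤ d → n < d * e → h d e = 0) :
    ∑ j ∈ Finset.Icc 1 n, ∑ x ∈ j.divisorsAntidiagonal, h x.1 x.2 =
      ∑ d ∈ Finset.Icc 1 n, ∑ e ∈ Finset.Icc 1 n, h d e := by
  rw [← Finset.sum_product', ← Finset.sum_filter_of_ne (s := Finset.Icc 1 n ×ˢ Finset.Icc 1 n)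
    (p := fun x : ℕ × ℕ => x.1 * x.2 ∈ Finset.Icc 1 n),
    ← Finset.sum_fiberwise_of_maps_to (s := Finset.filter _ _) (t := Finset.Icc 1 n)
      (g := fun x : ℕ × ℕ => x.1 * x.2) fun x hx => (Finset.mem_filter.1 hx).2]
  · refine Finset.sum_congr rfl fun j hj => Finset.sum_congr ?_ fun _ _ => rfl
    ext ⟨d, e⟩
    simp only [Nat.mem_divisorsAntidiagonal, Finset.mem_filter, Finset.mem_product,
      Finset.mem_Icc] at hj ⊢
    constructor
    · rintro ⟨rfl, h1⟩
      have hd : 0 < d := Nat.pos_of_ne_zero (by rintro rfl; simp at h1)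
      have he : 0 < e := Nat.pos_of_ne_zero (by rintro rfl; simp at h1)
      have := Nat.le_mul_of_pos_right d he
      have := Nat.le_mul_of_pos_left e hd
      exact ⟨⟨⟨⟨by omega, by omega⟩, by omega, by omega⟩, hj⟩, rfl⟩
    · rintro ⟨-, rfl⟩
      exact ⟨rfl, by omega⟩
  · intro x hx hne
    simp only [Finset.mem_product, Finset.mem_Icc] at hx ⊢
    have : 1 ≤ x.1 * x.2 := Nat.mul_pos (by omega) (by omega)
    exact ⟨this, not_lt.1 fun hlt => hne (h0 _ _ hx.1.1 hlt)⟩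

theorem natDegree_eq_sum_dvd_pow {g : F[X]} (hg : g.Monic) :
    g.natDegree = ∑ j ∈ Finset.Icc 1 g.natDegree, ∑ x ∈ j.divisorsAntidiagonal,
      ∑ φ ∈ monicIrreducibles F x.1, if φ ^ x.2 ∣ g then x.1 else 0 := by
  set n := g.natDegree with hn
  rw [sum_Icc_sum_divisorsAntidiagonal n
    (fun d e => ∑ φ ∈ monicIrreducibles F d, if φ ^ e ∣ g then d else 0)]
  · have key : ∀ d ∈ Finset.Icc 1 n, ∑ e ∈ Finset.Icc 1 n, ∑ φ ∈ monicIrreducibles F d,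
        (if φ ^ e ∣ g then d else 0) = ∑ φ ∈ monicIrreducibles F d,
          (UniqueFactorizationMonoid.normalizedFactors g).count φ * φ.natDegree := by
      intro d hd
      rw [Finset.sum_comm]
      refine Finset.sum_congr rfl fun φ hφ => ?_
      rw [mem_monicIrreducibles] at hφ
      obtain ⟨hφ, rfl, hi⟩ := hφ
      rw [← Finset.sum_filter, Finset.sum_const, smul_eq_mul]
      congr 1
      have hle : (UniqueFactorizationMonoid.normalizedFactors g).count φ ≤ n := by
        have h1 := natDegree_le_of_dvd ((hg.pow_dvd_iff_le_count hφ hi _).2 le_rfl) hg.ne_zero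
        rw [natDegree_pow] at h1
        exact (Nat.le_mul_of_pos_right _ hi.natDegree_pos).trans h1
      rw [show (UniqueFactorizationMonoid.normalizedFactors g).count φ = (Finset.Icc 1
        ((UniqueFactorizationMonoid.normalizedFactors g).count φ)).card by simp]
      congr 1
      ext e
      simp only [Finset.mem_filter, Finset.mem_Icc, hg.pow_dvd_iff_le_count hφ hi]
      omega
    rw [Finset.sum_congr rfl key, ← Finset.sum_biUnion]
    · conv_lhs => rw [hn, hg.natDegree_eq_sum_count]
      refine Finset.sum_subset ?_ ?_
      · intro φ hφ
        rw [Multiset.mem_toFinset] at hφ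
        have hm := Polynomial.Monic.of_mem_normalizedFactors hφ
        have hi := UniqueFactorizationMonoid.irreducible_of_normalized_factor φ hφ
        have hd := UniqueFactorizationMonoid.dvd_of_mem_normalizedFactors hφ
        rw [Finset.mem_biUnion]
        refine ⟨φ.natDegree, Finset.mem_Icc.2 ⟨hi.natDegree_pos, ?_⟩,
          mem_monicIrreducibles.2 ⟨hm, rfl, hi⟩⟩
        exact natDegree_le_of_dvd hd hg.ne_zero
      · intro φ _ hφ
        rw [Multiset.mem_toFinset] at hφ
        rw [Multiset.count_eq_zero_of_notMem hφ, zero_mul]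
    · intro a _ b _ hab
      rw [Function.onFun, Finset.disjoint_left]
      intro φ h1 h2
      rw [mem_monicIrreducibles] at h1 h2
      exact hab (h1.2.1.symm.trans h2.2.1)
  · intro d e hd hde
    refine Finset.sum_eq_zero fun φ hφ => if_neg fun hdvd => ?_
    rw [mem_monicIrreducibles] at hφ
    have := natDegree_le_of_dvd hdvd hg.ne_zero
    rw [natDegree_pow, hφ.2.1, mul_comm] at this
    omega

/-- Recurrence for the averages of a completely multiplicative function. -/
theorem monicAvg_recurrence (w : F[X] → ℝ) (c : ℕ → ℝ)
    (hw : ∀ φ h : F[X], φ.Monic → Irreducible φ → h.Monic → w (φ * h) = c φ.natDegree * w h)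
    (m : ℕ) :
    m * monicAvg F m w = ∑ j ∈ Finset.Icc 1 m,
      ((∑ x ∈ j.divisorsAntidiagonal, ((monicIrreducibles F x.1).card : ℝ) * x.1 * c x.1 ^ x.2) /
        (Fintype.card F : ℝ) ^ j) * monicAvg F (m - j) w := by
  have hpow : ∀ (e : ℕ) (φ h : F[X]), φ.Monic → Irreducible φ → h.Monic →
      w (φ ^ e * h) = c φ.natDegree ^ e * w h := by
    intro e φ h hφ hi hh
    induction e with
    | zero => simp
    | succ e ih => rw [pow_succ', mul_assoc, hw _ _ hφ hi ((hφ.pow e).mul hh), ih, pow_succ',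
        mul_assoc]
  calc (m : ℝ) * monicAvg F m w = monicAvg F m (fun g => (g.natDegree : ℝ) * w g) := by
        rw [← monicAvg_const_mul]
        refine le_antisymm (monicAvg_mono ?_) (monicAvg_mono ?_) <;>
        · rintro a - rfl
          exact le_rfl
    _ = monicAvg F m (fun g => ∑ j ∈ Finset.Icc 1 m, ∑ x ∈ j.divisorsAntidiagonal,
          ∑ φ ∈ monicIrreducibles F x.1, (x.1 : ℝ) * if φ ^ x.2 ∣ g then w g else 0) := by
        have h : ∀ a : F[X], a.Monic → a.natDegree = m → (a.natDegree : ℝ) * w a =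
            ∑ j ∈ Finset.Icc 1 m, ∑ x ∈ j.divisorsAntidiagonal,
              ∑ φ ∈ monicIrreducibles F x.1, (x.1 : ℝ) * if φ ^ x.2 ∣ a then w a else 0 := by
          rintro a ha rfl
          conv_lhs => rw [natDegree_eq_sum_dvd_pow ha]
          push_cast
          simp only [Finset.sum_mul, ite_mul, zero_mul, mul_ite, mul_zero]
        exact le_antisymm (monicAvg_mono fun a h1 h2 => (h a h1 h2).le)
          (monicAvg_mono fun a h1 h2 => (h a h1 h2).ge)
    _ = _ := by
        rw [monicAvg_sum]
        refine Finset.sum_congr rfl fun j hj => ?_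
        rw [monicAvg_sum, Finset.sum_div, Finset.sum_mul]
        refine Finset.sum_congr rfl fun x hx => ?_
        rw [Nat.mem_divisorsAntidiagonal] at hx
        rw [Finset.mem_Icc] at hj
        rw [monicAvg_sum]
        have h : ∀ φ ∈ monicIrreducibles F x.1,
            monicAvg F m (fun a => (x.1 : ℝ) * if φ ^ x.2 ∣ a then w a else 0) =
              x.1 * c x.1 ^ x.2 / (Fintype.card F : ℝ) ^ j * monicAvg F (m - j) w := by
          intro φ hφ
          rw [mem_monicIrreducibles] at hφ
          have hdeg : (φ ^ x.2).natDegree = j := by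
            rw [natDegree_pow, hφ.2.1, mul_comm, hx.1]
          rw [monicAvg_const_mul, monicAvg_ite_dvd (hφ.1.pow _) (by omega), hdeg]
          have : monicAvg F (m - j) (fun g => w (φ ^ x.2 * g)) =
              c x.1 ^ x.2 * monicAvg F (m - j) w := by
            rw [← monicAvg_const_mul]
            have h (a : F[X]) (ha : a.Monic) : w (φ ^ x.2 * a) = c x.1 ^ x.2 * w a := by
              rw [hpow _ _ _ hφ.1 hφ.2.2 ha, hφ.2.1]
            exact le_antisymm (monicAvg_mono fun a h1 _ => (h a h1).le)
              (monicAvg_mono fun a h1 _ => (h a h1).ge)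
          rw [this]
          ring
        rw [Finset.sum_congr rfl h, Finset.sum_const, nsmul_eq_mul]
        ring

/-- Gauss's formula for the number of irreducible polynomials. -/
theorem sum_card_monicIrreducibles {j : ℕ} (hj : 1 ≤ j) :
    ∑ x ∈ j.divisorsAntidiagonal, ((monicIrreducibles F x.1).card : ℝ) * x.1 =
      (Fintype.card F : ℝ) ^ j := by
  have h0 := (card_pos_real (F := F))
  have h (m : ℕ) := monicAvg_recurrence (F := F) (fun _ => 1) (fun _ => 1) (by simp) m
  simp only [monicAvg_one, one_pow, mul_one] at h
  obtain ⟨k, rfl⟩ : ∃ k, j = k + 1 := ⟨j - 1, by omega⟩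
  have h1 := h (k + 1)
  rw [← Finset.insert_Icc_right_eq_Icc_add_one (by omega), Finset.sum_insert (by simp), ← h k,
    Nat.cast_add_one] at h1
  have h2 : (∑ x ∈ (k + 1).divisorsAntidiagonal, ((monicIrreducibles F x.1).card : ℝ) * x.1) /
    (Fintype.card F : ℝ) ^ (k + 1) = 1 := by linarith
  rwa [div_eq_one_iff_eq (by positivity)] at h2

theorem card_monicIrreducibles_mul_le (d : ℕ) :
    ((monicIrreducibles F d).card : ℝ) * d ≤ (Fintype.card F : ℝ) ^ d := by
  rcases Nat.eq_zero_or_pos d with rfl | hd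
  · simp
  rw [← sum_card_monicIrreducibles hd]
  exact Finset.single_le_sum (f := fun x : ℕ × ℕ => ((monicIrreducibles F x.1).card : ℝ) * x.1)
    (fun _ _ => by positivity) (a := (d, 1)) (by simp; omega)

theorem half_le_card_monicIrreducibles {r : ℕ} (hr : r.Prime) :
    1 / (2 * r : ℝ) ≤ ((monicIrreducibles F r).card : ℝ) * ((Fintype.card F : ℝ) ^ r)⁻¹ := by
  have h := sum_card_monicIrreducibles (F := F) hr.one_le
  rw [Nat.sum_divisorsAntidiagonal fun d _ => ((monicIrreducibles F d).card : ℝ) * d,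
    Nat.Prime.sum_divisors hr] at h
  have h1 := card_monicIrreducibles_mul_le (F := F) 1
  have hr0 : (0 : ℝ) < r := by exact_mod_cast hr.pos
  have hq := two_le_card_real (F := F)
  have h2 : 2 * (Fintype.card F : ℝ) ≤ (Fintype.card F : ℝ) ^ r := by
    obtain ⟨k, rfl⟩ : ∃ k, r = k + 2 := ⟨r - 2, by have := hr.two_le; omega⟩
    calc 2 * (Fintype.card F : ℝ) ≤ (Fintype.card F : ℝ) ^ 2 := by nlinarith
      _ ≤ _ := pow_le_pow_right₀ (by linarith) (by omega)
  have hp : 0 < (Fintype.card F : ℝ) ^ r := by positivity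
  rw [← div_eq_mul_inv, div_le_div_iff₀ (by positivity) hp]
  simp only [Nat.cast_one, mul_one, pow_one] at h h1
  nlinarith

end Monics

/-- The central binomial probability `binom(2m, m) / 4^m`. -/
def centralProb (m : ℕ) : ℝ := (m.centralBinom : ℝ) / 4 ^ m

theorem centralProb_succ (m : ℕ) :
    2 * (m + 1) * centralProb (m + 1) = (2 * m + 1) * centralProb m := by
  have h : ((m : ℝ) + 1) * (m + 1).centralBinom = 2 * (2 * m + 1) * m.centralBinom := by
    exact_mod_cast Nat.succ_mul_centralBinom_succ m
  simp only [centralProb, pow_succ]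
  field_simp
  linarith

theorem centralProb_nonneg (m : ℕ) : 0 ≤ centralProb m := by
  unfold centralProb
  positivity

theorem sum_centralProb (m : ℕ) :
    ∑ i ∈ Finset.range m, centralProb i = 2 * m * centralProb m := by
  induction m with
  | zero => simp
  | succ m ih => rw [Finset.sum_range_succ, ih]; push_cast; rw [centralProb_succ]; ring

theorem centralProb_sq_le (m : ℕ) : centralProb m ^ 2 * (2 * m + 1) ≤ 1 := by
  induction m with
  | zero => simp [centralProb]
  | succ m ih =>
    have h := centralProb_succ m
    have h1 : centralProb (m + 1) = (2 * m + 1) * centralProb m / (2 * (m + 1)) := by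
      field_simp
      linarith
    rw [h1, div_pow, div_mul_eq_mul_div, div_le_one (by positivity)]
    push_cast
    have h2 : 0 ≤ (2 * (m : ℝ) + 1) * (2 * m + 3) := by positivity
    nlinarith [mul_le_mul_of_nonneg_left ih h2]

/-- A discrete Grönwall-type bound for the recurrence `m a_m ≤ ½ ∑_{i<m} a_i + ½ ∑_{i<m-y} a_i`. -/
theorem le_two_mul_centralProb_of_recurrence (a : ℕ → ℝ) (y : ℕ)
    (h0 : a 0 ≤ 1)
    (h : ∀ m : ℕ, m * a m ≤ (∑ i ∈ Finset.range m, a i) / 2 +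
      (∑ i ∈ Finset.range (m - y), a i) / 2) :
    (∀ m ≤ y, a m ≤ centralProb m) ∧ ∀ m, y ≤ m → a m ≤ 2 * centralProb y := by
  have h1 : ∀ m ≤ y, a m ≤ centralProb m := by
    intro m
    induction m using Nat.strong_induction_on with
    | _ m ih =>
      intro hm
      rcases Nat.eq_zero_or_pos m with rfl | hpos
      · simpa [centralProb] using h0
      have h2 := h m
      rw [Nat.sub_eq_zero_of_le hm, Finset.range_zero, Finset.sum_empty] at h2
      have h3 : ∑ i ∈ Finset.range m, a i ≤ ∑ i ∈ Finset.range m, centralProb i :=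
        Finset.sum_le_sum fun i hi =>
          ih i (Finset.mem_range.1 hi) ((Finset.mem_range.1 hi).le.trans hm)
      rw [sum_centralProb] at h3
      have : (0 : ℝ) < m := by exact_mod_cast hpos
      nlinarith
  refine ⟨h1, ?_⟩
  have hS : ∀ k : ℕ, (∀ i < k, y ≤ i → a i ≤ 2 * centralProb y) →
      ∑ i ∈ Finset.range k, a i ≤ 2 * (max k y : ℕ) * centralProb y := by
    intro k
    induction k with
    | zero =>
      intro _
      have := centralProb_nonneg y
      simp only [Finset.range_zero, Finset.sum_empty]
      positivity
    | succ k ih =>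
      intro hk
      by_cases hky : k + 1 ≤ y
      · rw [max_eq_right hky, ← sum_centralProb]
        calc ∑ i ∈ Finset.range (k + 1), a i ≤ ∑ i ∈ Finset.range (k + 1), centralProb i :=
              Finset.sum_le_sum fun i hi => h1 i (by have := Finset.mem_range.1 hi; omega)
          _ ≤ _ := Finset.sum_le_sum_of_subset_of_nonneg
              (by simpa using hky) fun i _ _ => centralProb_nonneg i
      · have h2 := ih fun i hi => hk i (by omega)
        rw [max_eq_left (by omega)] at h2 ⊢
        rw [Finset.sum_range_succ]
        have := hk k (by omega) (by omega)
        push_cast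
        linarith
  intro m
  induction m using Nat.strong_induction_on with
  | _ m ih =>
    intro hm
    rcases Nat.eq_zero_or_pos m with rfl | hpos
    · obtain rfl : y = 0 := by omega
      simp only [centralProb, Nat.centralBinom_zero, Nat.cast_one, pow_zero]
      linarith
    have h2 := h m
    have h3 := hS m fun i hi hy => ih i hi hy
    have h4 := hS (m - y) fun i hi hy => ih i (by omega) hy
    have h5 : ((max m y : ℕ) : ℝ) ≤ m := by
      rw [max_eq_left hm]
    have h6 : ((max (m - y) y : ℕ) : ℝ) ≤ m := by
      exact_mod_cast max_le (by omega) hm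
    have hc := centralProb_nonneg y
    have h7 := mul_le_mul_of_nonneg_right h5 hc
    have h8 := mul_le_mul_of_nonneg_right h6 hc
    have : (0 : ℝ) < m := by exact_mod_cast hpos
    nlinarith

theorem sum_Icc_sub_eq_sum_range {M : Type*} [AddCommMonoid M] (a : ℕ → M) (y m : ℕ) :
    ∑ j ∈ Finset.Icc (y + 1) m, a (m - j) = ∑ i ∈ Finset.range (m - y), a i := by
  refine Finset.sum_nbij' (fun j => m - j) (fun i => m - i) ?_ ?_ ?_ ?_ fun _ _ => rfl <;>
  · intro x hx
    simp only [Finset.mem_Icc, Finset.mem_range] at hx ⊢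
    omega

section Half

open Polynomial UniqueFactorizationMonoid

variable {F : Type*} [Field F] [Fintype F]

omit [Fintype F] in
theorem bigOmegaUpTo_mul {f g : F[X]} (hf : f ≠ 0) (hg : g ≠ 0) (y : ℕ) :
    bigOmegaUpTo y (f * g) = bigOmegaUpTo y f + bigOmegaUpTo y g := by
  rw [bigOmegaUpTo, normalizedFactors_mul hf hg, Multiset.countP_add, bigOmegaUpTo, bigOmegaUpTo]

omit [Fintype F] in
theorem bigOmegaUpTo_irreducible {φ : F[X]} (hφ : φ.Monic) (hi : Irreducible φ) (y : ℕ) :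
    bigOmegaUpTo y φ = if φ.natDegree ≤ y then 1 else 0 := by
  rw [bigOmegaUpTo, normalizedFactors_irreducible hi, hφ.normalize_eq_self]
  rw [← Multiset.cons_zero, Multiset.countP_cons, Multiset.countP_zero, zero_add]

theorem monicAvg_half_pow_recurrence (y m : ℕ) :
    m * monicAvg F m (fun g => (1 / 2 : ℝ) ^ bigOmegaUpTo y g) ≤
      (∑ i ∈ Finset.range m, monicAvg F i (fun g => (1 / 2 : ℝ) ^ bigOmegaUpTo y g)) / 2 +
      (∑ i ∈ Finset.range (m - y), monicAvg F i (fun g => (1 / 2 : ℝ) ^ bigOmegaUpTo y g)) / 2 := by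
  set c : ℕ → ℝ := fun d => if d ≤ y then 1 / 2 else 1 with hc
  have hnn (i : ℕ) : 0 ≤ monicAvg F i (fun g => (1 / 2 : ℝ) ^ bigOmegaUpTo y g) :=
    monicAvg_nonneg fun a => by positivity
  have hc1 (d : ℕ) : c d ≤ 1 := by simp only [hc]; split_ifs <;> norm_num
  have hc0 (d : ℕ) : 0 ≤ c d := by simp only [hc]; split_ifs <;> norm_num
  have hq := card_pos_real (F := F)
  rw [monicAvg_recurrence _ c]
  · have hcoef : ∀ j ∈ Finset.Icc 1 m,
        (∑ x ∈ j.divisorsAntidiagonal, ((monicIrreducibles F x.1).card : ℝ) * x.1 * c x.1 ^ x.2) /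
          (Fintype.card F : ℝ) ^ j ≤ 1 / 2 + if y + 1 ≤ j then 1 / 2 else 0 := by
      intro j hj
      rw [Finset.mem_Icc] at hj
      rw [div_le_iff₀ (by positivity), ← sum_card_monicIrreducibles hj.1, Finset.mul_sum]
      refine Finset.sum_le_sum fun x hx => ?_
      rw [Nat.mem_divisorsAntidiagonal] at hx
      rw [mul_comm]
      refine mul_le_mul_of_nonneg_right ?_ (by positivity)
      have hx2 : x.2 ≠ 0 := by rintro h; rw [h] at hx; omega
      split_ifs with h
      · exact (pow_le_one₀ (hc0 _) (hc1 _)).trans (by norm_num)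
      · have hx1 : x.1 ≤ y := by
          have := Nat.le_mul_of_pos_right x.1 (Nat.pos_of_ne_zero hx2)
          omega
        refine (pow_le_of_le_one (hc0 _) (hc1 _) hx2).trans ?_
        simp [hc, hx1]
    calc _ ≤ ∑ j ∈ Finset.Icc 1 m, (1 / 2 + if y + 1 ≤ j then 1 / 2 else 0) *
          monicAvg F (m - j) (fun g => (1 / 2 : ℝ) ^ bigOmegaUpTo y g) :=
        Finset.sum_le_sum fun j hj => mul_le_mul_of_nonneg_right (hcoef j hj) (hnn _)
      _ = _ := by
        have h1 := sum_Icc_sub_eq_sum_range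
          (fun i => monicAvg F i (fun g => (1 / 2 : ℝ) ^ bigOmegaUpTo y g)) 0 m
        have h2 := sum_Icc_sub_eq_sum_range
          (fun i => monicAvg F i (fun g => (1 / 2 : ℝ) ^ bigOmegaUpTo y g)) y m
        rw [zero_add, Nat.sub_zero] at h1
        simp only [add_mul, ite_mul, zero_mul, Finset.sum_add_distrib]
        rw [← h1, ← h2, Finset.sum_div, Finset.sum_div, ← Finset.sum_filter]
        congr 1
        · exact Finset.sum_congr rfl fun _ _ => by ring
        · refine Finset.sum_congr ?_ fun _ _ => by ring
          ext j
          simp only [Finset.mem_filter, Finset.mem_Icc]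
          omega
  · intro φ h hφ hi hh
    rw [bigOmegaUpTo_mul hφ.ne_zero hh.ne_zero, pow_add, bigOmegaUpTo_irreducible hφ hi]
    simp only [hc]
    split_ifs <;> simp

theorem monicAvg_half_pow_le {y m : ℕ} (h : y ≤ m) :
    monicAvg F m (fun g => (1 / 2 : ℝ) ^ bigOmegaUpTo y g) ≤ 2 * centralProb y := by
  refine (le_two_mul_centralProb_of_recurrence
    (fun m => monicAvg F m (fun g => (1 / 2 : ℝ) ^ bigOmegaUpTo y g)) y ?_
    (monicAvg_half_pow_recurrence y)).2 m h
  refine (monicAvg_mono fun a _ _ => ?_).trans (monicAvg_one 0).le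
  exact pow_le_one₀ (by norm_num) (by norm_num)

end Half

section Typical

open Polynomial UniqueFactorizationMonoid

variable {F : Type*} [Field F] [Fintype F]

theorem disjoint_monicIrreducibles {a b : ℕ} (hab : a ≠ b) :
    Disjoint (monicIrreducibles F a) (monicIrreducibles F b) := by
  rw [Finset.disjoint_left]
  intro φ h1 h2
  rw [mem_monicIrreducibles] at h1 h2
  exact hab (h1.2.1.symm.trans h2.2.1)

variable (F) in
/-- The finite set of monic irreducible polynomials with degree in `s`. -/
def monicIrreduciblesIn (s : Finset ℕ) : Finset F[X] := s.biUnion (monicIrreducibles F)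

theorem mem_monicIrreduciblesIn {s : Finset ℕ} {φ : F[X]} :
    φ ∈ monicIrreduciblesIn F s ↔ φ.Monic ∧ Irreducible φ ∧ φ.natDegree ∈ s := by
  simp only [monicIrreduciblesIn, Finset.mem_biUnion, mem_monicIrreducibles]
  constructor
  · rintro ⟨d, hd, h1, rfl, h2⟩
    exact ⟨h1, h2, hd⟩
  · rintro ⟨h1, h2, h3⟩
    exact ⟨_, h3, h1, rfl, h2⟩

theorem sum_monicIrreduciblesIn {M : Type*} [AddCommMonoid M] (s : Finset ℕ) (f : F[X] → M) :
    ∑ φ ∈ monicIrreduciblesIn F s, f φ = ∑ d ∈ s, ∑ φ ∈ monicIrreducibles F d, f φ :=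
  Finset.sum_biUnion fun _ _ _ _ hab => disjoint_monicIrreducibles hab

omit [Fintype F] in
theorem isCoprime_of_monic_irreducible {φ ψ : F[X]} (hφ : φ.Monic) (hφi : Irreducible φ)
    (hψ : ψ.Monic) (hψi : Irreducible ψ) (h : φ ≠ ψ) : IsCoprime φ ψ := by
  refine (EuclideanDomain.dvd_or_coprime φ ψ hφi).resolve_left fun hd => h ?_
  exact eq_of_monic_of_associated hφ hψ (hφi.associated_of_dvd hψi hd)

theorem sum_monicIrreducibles_inv_pow_le (d : ℕ) (hd : 1 ≤ d) :
    ((monicIrreducibles F d).card : ℝ) * ((Fintype.card F : ℝ) ^ d)⁻¹ ≤ 1 / d := by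
  have h := card_monicIrreducibles_mul_le (F := F) d
  have hq := card_pos_real (F := F)
  have hd0 : (0 : ℝ) < d := by exact_mod_cast hd
  rwa [← div_eq_mul_inv, div_le_div_iff₀ (by positivity) hd0, one_mul]

/-- Exponential moment of the number of small irreducible divisors. -/
theorem monicAvg_one_add_pow_le {η : ℝ} (hη : 0 ≤ η) (s : Finset ℕ) (hs : ∀ d ∈ s, 1 ≤ d) (m : ℕ) :
    monicAvg F m (fun g => (1 + η) ^ ((monicIrreduciblesIn F s).filter (· ∣ g)).card) ≤
      Real.exp (η * ∑ d ∈ s, (1 / d : ℝ)) := by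
  have hq := card_pos_real (F := F)
  calc _ ≤ monicAvg F m (fun g => ∑ S ∈ (monicIrreduciblesIn F s).powerset,
        η ^ S.card * if ∏ φ ∈ S, φ ∣ g then 1 else 0) := by
        refine monicAvg_mono fun g hg _ => ?_
        rw [← Finset.prod_const, Finset.prod_filter]
        have h1 : ∀ φ ∈ monicIrreduciblesIn F s, (if φ ∣ g then 1 + η else 1) =
            1 + if φ ∣ g then η else 0 := fun φ _ => by split_ifs <;> simp
        rw [Finset.prod_congr rfl h1, Finset.prod_one_add]
        refine Finset.sum_le_sum fun S hS => ?_
        rw [Finset.mem_powerset] at hS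
        by_cases hall : ∀ φ ∈ S, φ ∣ g
        · rw [Finset.prod_congr rfl fun φ hφ => if_pos (hall φ hφ), Finset.prod_const, if_pos,
            mul_one]
          refine Finset.prod_dvd_of_coprime (fun φ hφ ψ hψ hne => ?_) hall
          have h2 := mem_monicIrreduciblesIn.1 (hS hφ)
          have h3 := mem_monicIrreduciblesIn.1 (hS hψ)
          exact isCoprime_of_monic_irreducible h2.1 h2.2.1 h3.1 h3.2.1 hne
        · push Not at hall
          obtain ⟨φ, hφ, hnd⟩ := hall
          rw [Finset.prod_eq_zero hφ (if_neg hnd)]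
          positivity
    _ ≤ ∑ S ∈ (monicIrreduciblesIn F s).powerset,
        ∏ φ ∈ S, (η * ((Fintype.card F : ℝ) ^ φ.natDegree)⁻¹) := by
        rw [monicAvg_sum]
        refine Finset.sum_le_sum fun S hS => ?_
        rw [Finset.mem_powerset] at hS
        have hm : ∀ φ ∈ S, φ.Monic := fun φ hφ => (mem_monicIrreduciblesIn.1 (hS hφ)).1
        rw [monicAvg_const_mul, Finset.prod_mul_distrib, Finset.prod_const, Finset.prod_inv_distrib,
          Finset.prod_pow_eq_pow_sum, ← natDegree_prod_of_monic _ _ hm]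
        exact mul_le_mul_of_nonneg_left (monicAvg_dvd_le (monic_prod_of_monic _ _ hm) m)
          (by positivity)
    _ = ∏ φ ∈ monicIrreduciblesIn F s, (1 + η * ((Fintype.card F : ℝ) ^ φ.natDegree)⁻¹) :=
        (Finset.prod_one_add _).symm
    _ ≤ ∏ φ ∈ monicIrreduciblesIn F s, Real.exp (η * ((Fintype.card F : ℝ) ^ φ.natDegree)⁻¹) :=
        Finset.prod_le_prod (fun _ _ => by positivity) fun φ _ => by
          rw [add_comm]; exact Real.add_one_le_exp _
    _ = Real.exp (η * ∑ d ∈ s, ((monicIrreducibles F d).card : ℝ) *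
          ((Fintype.card F : ℝ) ^ d)⁻¹) := by
        rw [← Real.exp_sum, ← Finset.mul_sum, sum_monicIrreduciblesIn]
        congr 2
        refine Finset.sum_congr rfl fun d _ => ?_
        rw [Finset.sum_congr rfl fun φ hφ => by rw [(mem_monicIrreducibles.1 hφ).2.1],
          Finset.sum_const, nsmul_eq_mul]
    _ ≤ _ := by
        refine Real.exp_le_exp.2 (mul_le_mul_of_nonneg_left (Finset.sum_le_sum fun d hd => ?_) hη)
        exact sum_monicIrreducibles_inv_pow_le d (hs d hd)

theorem sum_Icc_pow_le {x : ℝ} (h0 : 0 ≤ x) (h1 : x ≤ 1 / 2) (a b : ℕ) :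
    ∑ e ∈ Finset.Icc a b, x ^ e ≤ 2 * x ^ a := by
  rw [← Finset.Ico_add_one_right_eq_Icc]
  refine (geom_sum_Ico_le_of_lt_one h0 (by linarith)).trans ?_
  rw [div_le_iff₀ (by linarith)]
  nlinarith [pow_nonneg h0 a]

variable (F) in
/-- The number of repeated prime power divisors of `g`. -/
def excess (m : ℕ) (g : F[X]) : ℝ :=
  ∑ φ ∈ monicIrreduciblesIn F (Finset.Icc 1 m), ∑ e ∈ Finset.Icc 2 m, if φ ^ e ∣ g then 1 else 0

theorem monicAvg_pow_dvd_le (a : ℕ) (ha : 1 ≤ a) (s : Finset ℕ) (hs : ∀ d ∈ s, 1 ≤ d) (m b : ℕ) :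
    monicAvg F m (fun g => ∑ φ ∈ monicIrreduciblesIn F s, ∑ e ∈ Finset.Icc (a + 1) b,
      if φ ^ e ∣ g then 1 else 0) ≤ 4 * (1 / 2 : ℝ) ^ a := by
  have hq := card_pos_real (F := F)
  have hq2 := two_le_card_real (F := F)
  rw [monicAvg_sum, sum_monicIrreduciblesIn]
  have hle : ∀ d ∈ s, ∑ φ ∈ monicIrreducibles F d, monicAvg F m (fun g =>
      ∑ e ∈ Finset.Icc (a + 1) b, if φ ^ e ∣ g then (1 : ℝ) else 0) ≤ 2 * ((1 / 2 : ℝ) ^ a) ^ d := by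
    intro d hd
    have hd1 := hs d hd
    set x : ℝ := ((Fintype.card F : ℝ) ^ d)⁻¹ with hx
    have hx0 : 0 ≤ x := by positivity
    have hx2 : x ≤ (1 / 2) ^ d := by
      rw [hx, one_div, inv_pow]
      exact inv_anti₀ (by positivity) (pow_le_pow_left₀ (by norm_num) hq2 d)
    have hx1 : x ≤ 1 / 2 := hx2.trans (pow_le_of_le_one (by norm_num) (by norm_num) (by omega))
    calc _ ≤ ∑ φ ∈ monicIrreducibles F d, 2 * x ^ (a + 1) := by
          refine Finset.sum_le_sum fun φ hφ => ?_
          rw [mem_monicIrreducibles] at hφ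
          rw [monicAvg_sum]
          refine le_trans (Finset.sum_le_sum fun e _ => ?_) (sum_Icc_pow_le hx0 hx1 (a + 1) b)
          refine (monicAvg_dvd_le (hφ.1.pow e) m).trans_eq ?_
          rw [natDegree_pow, hφ.2.1, hx, inv_pow, mul_comm e, pow_mul]
      _ = ((monicIrreducibles F d).card * x) * (2 * x ^ a) := by
          rw [Finset.sum_const, nsmul_eq_mul]; ring
      _ ≤ 1 * (2 * x ^ a) := by
          refine mul_le_mul_of_nonneg_right ?_ (by positivity)
          refine (sum_monicIrreducibles_inv_pow_le d hd1).trans ?_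
          rw [div_le_one (by exact_mod_cast hd1)]
          exact_mod_cast hd1
      _ ≤ _ := by
          rw [one_mul, ← pow_mul, mul_comm a, pow_mul]
          gcongr
  refine (Finset.sum_le_sum hle).trans ?_
  rw [← Finset.mul_sum]
  have h1 : (1 / 2 : ℝ) ^ a ≤ 1 / 2 := pow_le_of_le_one (by norm_num) (by norm_num) (by omega)
  have h2 := sum_Icc_pow_le (by positivity) h1 1 (s.sup id)
  have h3 : ∑ d ∈ s, ((1 / 2 : ℝ) ^ a) ^ d ≤ ∑ d ∈ Finset.Icc 1 (s.sup id), ((1 / 2 : ℝ) ^ a) ^ d :=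
    Finset.sum_le_sum_of_subset_of_nonneg
      (fun d hd => Finset.mem_Icc.2 ⟨hs d hd, Finset.le_sup (f := id) hd⟩)
      fun _ _ _ => by positivity
  rw [pow_one] at h2
  linarith

theorem bigOmegaUpTo_le {g : F[X]} (hg : g.Monic) {y : ℕ} (hy : y ≤ g.natDegree) :
    (bigOmegaUpTo y g : ℝ) ≤
      ((monicIrreduciblesIn F (Finset.Icc 1 y)).filter (· ∣ g)).card + excess F g.natDegree g := by
  have h1 : bigOmegaUpTo y g ≤ ∑ φ ∈ monicIrreduciblesIn F (Finset.Icc 1 y),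
      (normalizedFactors g).count φ := by
    rw [bigOmegaUpTo, Multiset.countP_eq_card_filter, ← Multiset.toFinset_sum_count_eq]
    calc _ ≤ ∑ φ ∈ ((normalizedFactors g).filter (·.natDegree ≤ y)).toFinset,
          (normalizedFactors g).count φ := Finset.sum_le_sum fun φ _ =>
            Multiset.count_le_of_le _ (Multiset.filter_le _ _)
      _ ≤ _ := by
        refine Finset.sum_le_sum_of_subset fun φ hφ => ?_
        rw [Multiset.mem_toFinset, Multiset.mem_filter] at hφ
        have hi := irreducible_of_normalized_factor φ hφ.1
        exact mem_monicIrreduciblesIn.2 ⟨Polynomial.Monic.of_mem_normalizedFactors hφ.1, hi,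
          Finset.mem_Icc.2 ⟨hi.natDegree_pos, hφ.2⟩⟩
  have h2 : ∀ φ ∈ monicIrreduciblesIn F (Finset.Icc 1 y), ((normalizedFactors g).count φ : ℝ) ≤
      (if φ ∣ g then 1 else 0) + ∑ e ∈ Finset.Icc 2 g.natDegree, if φ ^ e ∣ g then 1 else 0 := by
    intro φ hφ
    obtain ⟨hφ, hi, hd⟩ := mem_monicIrreduciblesIn.1 hφ
    set v := (normalizedFactors g).count φ with hv
    rcases Nat.eq_zero_or_pos v with h0 | hpos
    · rw [h0]
      have : (0 : ℝ) ≤ ∑ e ∈ Finset.Icc 2 g.natDegree, if φ ^ e ∣ g then 1 else 0 :=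
        Finset.sum_nonneg fun _ _ => by split_ifs <;> norm_num
      have : (0 : ℝ) ≤ if φ ∣ g then 1 else 0 := by split_ifs <;> norm_num
      push_cast
      linarith
    · have hdvd := (hg.pow_dvd_iff_le_count hφ hi v).2 le_rfl
      have hvd : v ≤ g.natDegree := by
        have h1 := natDegree_le_of_dvd hdvd hg.ne_zero
        rw [natDegree_pow] at h1
        exact (Nat.le_mul_of_pos_right _ hi.natDegree_pos).trans h1
      rw [if_pos ((dvd_pow_self φ hpos.ne').trans hdvd)]
      have : ∑ e ∈ Finset.Icc 2 v, (1 : ℝ) ≤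
          ∑ e ∈ Finset.Icc 2 g.natDegree, if φ ^ e ∣ g then 1 else 0 := by
        calc ∑ e ∈ Finset.Icc 2 v, (1 : ℝ) = ∑ e ∈ Finset.Icc 2 v, if φ ^ e ∣ g then 1 else 0 :=
              Finset.sum_congr rfl fun e he => by
                rw [if_pos ((hg.pow_dvd_iff_le_count hφ hi e).2 (Finset.mem_Icc.1 he).2)]
          _ ≤ _ := Finset.sum_le_sum_of_subset_of_nonneg (Finset.Icc_subset_Icc_right hvd)
              fun _ _ _ => by split_ifs <;> norm_num
      rw [Finset.sum_const, Nat.card_Icc, nsmul_eq_mul, mul_one, Nat.cast_sub (by omega)] at this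
      push_cast at this
      linarith
  calc (bigOmegaUpTo y g : ℝ) ≤ ∑ φ ∈ monicIrreduciblesIn F (Finset.Icc 1 y),
        ((normalizedFactors g).count φ : ℝ) := by exact_mod_cast h1
    _ ≤ _ := Finset.sum_le_sum h2
    _ ≤ _ := by
      rw [Finset.sum_add_distrib, ← Finset.sum_filter, Finset.sum_const, nsmul_eq_mul, mul_one]
      refine add_le_add le_rfl (Finset.sum_le_sum_of_subset_of_nonneg
        (Finset.biUnion_subset_biUnion_of_subset_left _ (Finset.Icc_subset_Icc_right hy))
        fun _ _ _ => Finset.sum_nonneg fun _ _ => by split_ifs <;> norm_num)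

end Typical

section Typical2

open Polynomial UniqueFactorizationMonoid

variable {F : Type*} [Field F] [Fintype F]

/-- `g` does not have unusually many irreducible factors at any dyadic scale. -/
def IsTypicalPoly (K : ℕ) (g : F[X]) : Prop :=
  ∀ i : ℕ, 2 ^ i ≤ g.natDegree → (bigOmegaUpTo (2 ^ i) g : ℝ) ≤ 0.73 * i + 2 * K

theorem sum_Icc_one_div_le (n : ℕ) :
    ∑ d ∈ Finset.Icc 1 n, (1 / d : ℝ) ≤ 1 + Real.log n := by
  have h := harmonic_le_one_add_log n
  rw [harmonic_eq_sum_Icc] at h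
  push_cast at h
  simpa only [one_div] using h

/-- An upper bound for the proportion of atypical polynomials. -/
def atypicalBound (K : ℕ) : ℝ :=
  Real.exp 0.05 * (1 - Real.exp (-0.0008))⁻¹ * Real.exp (-(0.0487 * K)) + 2 / K

theorem monicAvg_not_isTypicalPoly_le {K : ℕ} (hK : 1 ≤ K) (m : ℕ) :
    monicAvg F m (fun g => if IsTypicalPoly K g then 0 else 1) ≤ atypicalBound K := by
  have hK0 : (0 : ℝ) < K := by exact_mod_cast hK
  set ω : ℕ → F[X] → ℕ := fun i g =>
    ((monicIrreduciblesIn F (Finset.Icc 1 (2 ^ i))).filter (· ∣ g)).card with hω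
  have hlog : (0.0487 : ℝ) ≤ Real.log (1 + 0.05) :=
    le_trans (by norm_num) (Real.le_log_one_add_of_nonneg (x := 0.05) (by norm_num))
  have hE0 (g : F[X]) : 0 ≤ excess F m g :=
    Finset.sum_nonneg fun _ _ => Finset.sum_nonneg fun _ _ => by split_ifs <;> norm_num
  have hpt : ∀ g : F[X], g.Monic → g.natDegree = m → (if IsTypicalPoly K g then (0 : ℝ) else 1) ≤
      (∑ i ∈ Finset.range (m + 1), Real.exp (-(0.0487 * (0.73 * i + K))) * (1 + 0.05) ^ ω i g) +
        (1 / K) * excess F m g := by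
    rintro g hg rfl
    have hs0 : ∀ i ∈ Finset.range (g.natDegree + 1),
      0 ≤ Real.exp (-(0.0487 * (0.73 * i + K))) * (1 + 0.05) ^ ω i g := fun _ _ => by positivity
    have he0 : 0 ≤ (1 / K) * excess F g.natDegree g := mul_nonneg (by positivity) (hE0 g)
    split_ifs with h
    · exact add_nonneg (Finset.sum_nonneg hs0) he0
    · rw [IsTypicalPoly] at h
      push Not at h
      obtain ⟨i, hi, hlt⟩ := h
      have hO := bigOmegaUpTo_le hg hi
      by_cases hex : (K : ℝ) < excess F g.natDegree g
      · have : 1 ≤ (1 / K) * excess F g.natDegree g := by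
          rw [one_div, inv_mul_eq_div, one_le_div hK0]
          exact hex.le
        linarith [Finset.sum_nonneg hs0]
      · have hw : 0.73 * (i : ℝ) + K ≤ ω i g := by simp only [hω]; linarith
        have hmem : i ∈ Finset.range (g.natDegree + 1) := by
          have := Nat.lt_two_pow_self (n := i)
          exact Finset.mem_range.2 (by omega)
        have h1 : 1 ≤ Real.exp (-(0.0487 * (0.73 * i + K))) * (1 + 0.05) ^ ω i g := by
          rw [← Real.exp_log (show (0 : ℝ) < 1 + 0.05 by norm_num), ← Real.exp_nat_mul,
            ← Real.exp_add]
          refine Real.one_le_exp ?_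
          have h2 : 0 ≤ 0.73 * (i : ℝ) + K := by positivity
          have h3 : 0.0487 * (0.73 * (i : ℝ) + K) ≤ ω i g * Real.log (1 + 0.05) := by
            rw [mul_comm]
            exact mul_le_mul hw hlog (by norm_num) (by positivity)
          linarith
        linarith [Finset.single_le_sum hs0 hmem]
  refine (monicAvg_mono hpt).trans ?_
  rw [monicAvg_add, monicAvg_sum, monicAvg_const_mul, atypicalBound]
  refine add_le_add ?_ ?_
  · have hterm : ∀ i ∈ Finset.range (m + 1), monicAvg F m (fun g =>
        Real.exp (-(0.0487 * (0.73 * i + K))) * (1 + 0.05) ^ ω i g) ≤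
        Real.exp 0.05 * Real.exp (-(0.0487 * K)) * Real.exp (-0.0008) ^ i := by
      intro i _
      rw [monicAvg_const_mul]
      have h1 := monicAvg_one_add_pow_le (F := F) (show (0 : ℝ) ≤ 0.05 by norm_num)
        (Finset.Icc 1 (2 ^ i)) (fun d hd => (Finset.mem_Icc.1 hd).1) m
      have h2 := sum_Icc_one_div_le (2 ^ i)
      rw [Nat.cast_pow, Real.log_pow] at h2
      have h3 := Real.log_two_lt_d9
      push_cast at h2
      calc _ ≤ Real.exp (-(0.0487 * (0.73 * i + K))) *
            Real.exp (0.05 * ∑ d ∈ (Finset.Icc 1 (2 ^ i) : Finset ℕ), (1 / (d : ℝ))) :=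
            mul_le_mul_of_nonneg_left h1 (Real.exp_pos _).le
        _ ≤ _ := by
          rw [← Real.exp_nat_mul, ← Real.exp_add, ← Real.exp_add, ← Real.exp_add]
          refine Real.exp_le_exp.2 ?_
          have hi : (0 : ℝ) ≤ i := by positivity
          nlinarith
    refine (Finset.sum_le_sum hterm).trans ?_
    rw [← Finset.mul_sum]
    have hr0 := Real.exp_pos (-0.0008)
    have hr1 : Real.exp (-0.0008) < 1 := by rw [Real.exp_lt_one_iff]; norm_num
    have hg := geom_sum_Ico_le_of_lt_one hr0.le hr1 (m := 0) (n := m + 1)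
    rw [pow_zero, ← Finset.range_eq_Ico, one_div] at hg
    calc _ ≤ Real.exp 0.05 * Real.exp (-(0.0487 * K)) * (1 - Real.exp (-0.0008))⁻¹ :=
          mul_le_mul_of_nonneg_left hg (by positivity)
      _ = _ := by ring
  · have h := monicAvg_pow_dvd_le (F := F) 1 le_rfl (Finset.Icc 1 m)
      (fun d hd => (Finset.mem_Icc.1 hd).1) m m
    calc (1 / K : ℝ) * monicAvg F m (excess F m) ≤ (1 / K) * 2 := by
          refine mul_le_mul_of_nonneg_left (h.trans (by norm_num)) (by positivity)
      _ = _ := by ring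

theorem tendsto_atypicalBound : Filter.Tendsto atypicalBound Filter.atTop (nhds 0) := by
  have h1 : Filter.Tendsto (fun K : ℕ => Real.exp (-(0.0487 * (K : ℝ)))) Filter.atTop (nhds 0) :=
    Real.tendsto_exp_neg_atTop_nhds_zero.comp
      (tendsto_natCast_atTop_atTop.const_mul_atTop (by norm_num))
  have h2 := tendsto_const_div_atTop_nhds_zero_nat (2 : ℝ)
  have h3 := (h1.const_mul (Real.exp 0.05 * (1 - Real.exp (-0.0008))⁻¹)).add h2
  rw [mul_zero, add_zero] at h3
  exact h3

/-- Typical polynomials rarely have a divisor of a given intermediate degree. -/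
theorem monicAvg_typical_dvd_le (K i k m : ℕ) (hk : 2 ^ i ≤ k) (hm : 2 ^ i + k ≤ m) :
    monicAvg F m (fun g => if IsTypicalPoly K g ∧ ∃ u : F[X], u.Monic ∧ u.natDegree = k ∧ u ∣ g
      then 1 else 0) ≤ 2 * (2 : ℝ) ^ (2 * K) * (2 : ℝ) ^ (-(0.27 : ℝ) * i) := by
  set T : ℝ := 0.73 * i + 2 * K with hT
  set w : F[X] → ℝ := fun g => (1 / 2 : ℝ) ^ bigOmegaUpTo (2 ^ i) g with hw
  have hw0 (g : F[X]) : 0 ≤ w g := by simp only [hw]; positivity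
  have hq := card_pos_real (F := F)
  have hpt : ∀ g : F[X], g.Monic → g.natDegree = m →
      (if IsTypicalPoly K g ∧ ∃ u : F[X], u.Monic ∧ u.natDegree = k ∧ u ∣ g then (1 : ℝ) else 0) ≤
        (2 : ℝ) ^ T * ∑ u ∈ monicsOfDegree F k, if u ∣ g then w g else 0 := by
    rintro g hg rfl
    have hs0 : ∀ u ∈ monicsOfDegree F k, 0 ≤ if u ∣ g then w g else 0 := fun u _ => by
      split_ifs
      exacts [hw0 g, le_rfl]
    split_ifs with h
    · obtain ⟨ht, u, hu, huk, hdvd⟩ := h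
      have h1 := ht i (by omega)
      have h2 := Finset.single_le_sum hs0 (mem_monicsOfDegree.2 ⟨hu, huk⟩)
      rw [if_pos hdvd] at h2
      refine le_trans ?_ (mul_le_mul_of_nonneg_left h2 (by positivity))
      simp only [hw]
      rw [one_div, inv_pow, ← Real.rpow_natCast 2 (bigOmegaUpTo _ _), ← Real.rpow_neg (by norm_num),
        ← Real.rpow_add (by norm_num)]
      exact Real.one_le_rpow (by norm_num) (by linarith)
    · exact mul_nonneg (by positivity) (Finset.sum_nonneg hs0)
  refine (monicAvg_mono hpt).trans ?_
  rw [monicAvg_const_mul, monicAvg_sum]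
  have hsum : ∑ u ∈ monicsOfDegree F k, monicAvg F m (fun g => if u ∣ g then w g else 0) =
      monicAvg F k w * monicAvg F (m - k) w := by
    have h1 : ∀ u ∈ monicsOfDegree F k, monicAvg F m (fun g => if u ∣ g then w g else 0) =
        w u / (Fintype.card F : ℝ) ^ k * monicAvg F (m - k) w := by
      intro u hu
      rw [mem_monicsOfDegree] at hu
      rw [monicAvg_ite_dvd hu.1 (hu.2.le.trans ((Nat.le_add_left k _).trans hm)), hu.2]
      have h2 : monicAvg F (m - k) (fun g => w (u * g)) = w u * monicAvg F (m - k) w := by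
        rw [← monicAvg_const_mul]
        have h3 (a : F[X]) (ha : a.Monic) : w (u * a) = w u * w a := by
          simp only [hw]
          rw [bigOmegaUpTo_mul hu.1.ne_zero ha.ne_zero, pow_add]
        exact le_antisymm (monicAvg_mono fun a h _ => (h3 a h).le)
          (monicAvg_mono fun a h _ => (h3 a h).ge)
      rw [h2]
      ring
    rw [Finset.sum_congr rfl h1, ← Finset.sum_mul, ← Finset.sum_div]
    rfl
  rw [hsum]
  have ha := monicAvg_half_pow_le (F := F) hk
  have hb := monicAvg_half_pow_le (F := F) (y := 2 ^ i) (m := m - k) (by omega)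
  have hc := centralProb_sq_le (2 ^ i)
  have hc0 := centralProb_nonneg (2 ^ i)
  have hab : monicAvg F k w * monicAvg F (m - k) w ≤ 2 * (2 : ℝ) ^ (-(i : ℝ)) := by
    calc _ ≤ (2 * centralProb (2 ^ i)) * (2 * centralProb (2 ^ i)) :=
          mul_le_mul ha hb (monicAvg_nonneg hw0) (by positivity)
      _ ≤ 2 / 2 ^ i := by
          rw [le_div_iff₀ (by positivity)]
          push_cast at hc
          nlinarith [sq_nonneg (centralProb (2 ^ i))]
      _ = _ := by rw [Real.rpow_neg (by norm_num), Real.rpow_natCast, div_eq_mul_inv]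
  refine (mul_le_mul_of_nonneg_left hab (by positivity)).trans_eq ?_
  rw [mul_comm 2 (2 ^ (2 * K)), mul_assoc, mul_left_comm, mul_left_comm _ 2]
  congr 1
  rw [← Real.rpow_natCast 2 (2 * K), ← Real.rpow_add (by norm_num), ← Real.rpow_add (by norm_num)]
  congr 1
  rw [hT]
  push_cast
  ring

end Typical2

section Krylov

open Polynomial Matrix

variable {F : Type*} [Field F]

/-- `g` is the minimal monic polynomial annihilating the vector `v` under `M`. -/
def IsKrylovPoly {n : ℕ} (M : Matrix (Fin n) (Fin n) F) (v : Fin n → F) (g : F[X]) : Prop :=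
  g.Monic ∧ LinearIndependent F (fun i : Fin g.natDegree => (M ^ (i : ℕ)) *ᵥ v) ∧
    aeval M g *ᵥ v = 0

theorem exists_isKrylovPoly {n : ℕ} (M : Matrix (Fin n) (Fin n) F) (v : Fin n → F) :
    ∃ g, IsKrylovPoly M v g ∧ g ∣ M.charpoly := by
  let I : Ideal F[X] :=
    { carrier := {f | aeval M f *ᵥ v = 0}
      add_mem' := fun {a b} ha hb => by
        simp only [Set.mem_ofPred_eq] at ha hb ⊢
        rw [map_add, add_mulVec, ha, hb, add_zero]
      zero_mem' := by simp
      smul_mem' := fun c x hx => by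
        simp only [Set.mem_ofPred_eq, smul_eq_mul] at hx ⊢
        rw [map_mul, ← mulVec_mulVec, hx, mulVec_zero] }
  have hχ : M.charpoly ∈ I := by
    change aeval M M.charpoly *ᵥ v = 0
    rw [aeval_self_charpoly, zero_mulVec]
  obtain ⟨g₀, hg₀⟩ := (IsPrincipalIdealRing.principal I).principal
  have hmem (f : F[X]) : f ∈ I ↔ g₀ ∣ f := by
    rw [hg₀]; exact Ideal.mem_span_singleton
  have h0 : g₀ ≠ 0 := by
    rintro rfl
    exact M.charpoly_monic.ne_zero (zero_dvd_iff.1 ((hmem _).1 hχ))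
  refine ⟨normalize g₀, ⟨monic_normalize h0, ?_, ?_⟩, normalize_dvd_iff.2 ((hmem _).1 hχ)⟩
  · rw [Fintype.linearIndependent_iff]
    intro c hc
    have hf : (∑ i, C (c i) * X ^ (i : ℕ) : F[X]) ∈ I := by
      change aeval M (∑ i, C (c i) * X ^ (i : ℕ) : F[X]) *ᵥ v = 0
      rw [← hc, map_sum, sum_mulVec]
      refine Finset.sum_congr rfl fun i _ => ?_
      rw [map_mul, aeval_C, map_pow, aeval_X, Algebra.algebraMap_eq_smul_one, smul_mul_assoc,
        one_mul, smul_mulVec]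
    have hz := eq_zero_of_dvd_of_degree_lt (normalize_dvd_iff.2 ((hmem _).1 hf))
      ((degree_sum_fin_lt c).trans_le (degree_eq_natDegree (by simpa using h0)).ge)
    intro i
    have := congrArg (fun f : F[X] => f.coeff i) hz
    simpa [finsetSum_coeff, coeff_C_mul, coeff_X_pow, Fin.val_inj] using this
  · exact (hmem _).2 (dvd_normalize_iff.2 dvd_rfl)

variable [Fintype F]

theorem card_matrix_prescribed {n d : ℕ} (u w : Fin d → Fin n → F) (hu : LinearIndependent F u) :
    Fintype.card F ^ (n * d) *
      (Finset.univ.filter fun M : Matrix (Fin n) (Fin n) F => ∀ i, M *ᵥ u i = w i).card =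
        Fintype.card F ^ (n * n) := by
  let f : Matrix (Fin n) (Fin n) F →+ (Fin d → Fin n → F) :=
    { toFun := fun M i => M *ᵥ u i
      map_zero' := by ext; simp
      map_add' := fun A B => by ext; simp [add_mulVec] }
  have hsurj : Function.Surjective f := by
    intro w
    obtain ⟨π, hπ⟩ := LinearMap.exists_leftInverse_of_injective
      (Fintype.linearCombination F u) (LinearMap.ker_eq_bot.2
        ((linearIndependent_iff_injective_fintypeLinearCombination).1 hu))
    refine ⟨LinearMap.toMatrix' (Fintype.linearCombination F w ∘ₗ π), ?_⟩
    funext i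
    have h1 : π (u i) = Pi.single i 1 := by
      have := LinearMap.congr_fun hπ (Pi.single i 1)
      simpa [Fintype.linearCombination_apply_single] using this
    change LinearMap.toMatrix' _ *ᵥ u i = w i
    rw [LinearMap.toMatrix'_mulVec, LinearMap.comp_apply, h1,
      Fintype.linearCombination_apply_single, one_smul]
  have hcard := Finset.card_eq_sum_card_fiberwise
    (s := (Finset.univ : Finset (Matrix (Fin n) (Fin n) F)))
    (t := (Finset.univ : Finset (Fin d → Fin n → F))) (f := f) (by simp)
  have hfib (w' : Fin d → Fin n → F) :
      (Finset.univ.filter fun M => f M = w').card = (Finset.univ.filter fun M => f M = w).card :=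
    AddMonoidHom.card_fiber_eq_of_mem_range f (hsurj w') (hsurj w)
  rw [Finset.sum_congr rfl fun w' _ => hfib w', Finset.sum_const, smul_eq_mul] at hcard
  have h1 : (Finset.univ.filter fun M => f M = w) =
      Finset.univ.filter fun M : Matrix (Fin n) (Fin n) F => ∀ i, M *ᵥ u i = w i := by
    ext M
    simp only [Finset.mem_filter, Finset.mem_univ, true_and]
    exact funext_iff
  rw [h1] at hcard
  rw [Finset.card_univ, Finset.card_univ] at hcard
  have e1 : Fintype.card (Matrix (Fin n) (Fin n) F) = Fintype.card F ^ (n * n) := by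
    change Fintype.card (Fin n → Fin n → F) = _
    simp [← pow_mul]
  have e2 : Fintype.card (Fin d → Fin n → F) = Fintype.card F ^ (n * d) := by
    simp [← pow_mul]
  rw [e1, e2] at hcard
  exact hcard.symm

theorem card_isKrylovPoly_le {n : ℕ} {v : Fin n → F} (hv : v ≠ 0) (g : F[X]) :
    Fintype.card F ^ n *
      (Finset.univ.filter fun M : Matrix (Fin n) (Fin n) F => IsKrylovPoly M v g).card ≤
        Fintype.card F ^ (n * n) := by
  have hq : 0 < Fintype.card F := Fintype.card_pos
  obtain hd | ⟨d, hd⟩ : g.natDegree = 0 ∨ ∃ d, g.natDegree = d + 1 := by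
    rcases g.natDegree with _ | d
    exacts [Or.inl rfl, Or.inr ⟨d, rfl⟩]
  · rw [Finset.filter_false_of_mem, Finset.card_empty, mul_zero]
    · exact Nat.zero_le _
    · rintro M - ⟨hg, -, h⟩
      rw [hg.natDegree_eq_zero.1 hd] at h
      exact hv (by simpa using h)
  let u : (Fin d → Fin n → F) → Fin (d + 1) → Fin n → F := fun u' => Fin.cons v u'
  let w : (Fin d → Fin n → F) → Fin (d + 1) → Fin n → F := fun u' =>
    Fin.snoc u' (-∑ i : Fin (d + 1), g.coeff i • u u' i)
  let B : (Fin d → Fin n → F) → Finset (Matrix (Fin n) (Fin n) F) := fun u' =>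
    Finset.univ.filter fun M => LinearIndependent F (u u') ∧ ∀ i, M *ᵥ u u' i = w u' i
  have hsub : (Finset.univ.filter fun M : Matrix (Fin n) (Fin n) F => IsKrylovPoly M v g) ⊆
      Finset.univ.biUnion B := by
    intro M hM
    obtain ⟨hg, hli, hz⟩ := (Finset.mem_filter.1 hM).2
    rw [Finset.mem_biUnion]
    have hu : u (fun i => M ^ ((i : ℕ) + 1) *ᵥ v) =
        fun i : Fin (d + 1) => M ^ (i : ℕ) *ᵥ v := by
      funext i
      refine Fin.cases ?_ (fun i => ?_) i <;> simp [u]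
    refine ⟨fun i => M ^ ((i : ℕ) + 1) *ᵥ v, Finset.mem_univ _,
      Finset.mem_filter.2 ⟨Finset.mem_univ _, ?_, ?_⟩⟩
    · rw [hu]
      exact hli.comp (Fin.cast hd.symm) (Fin.cast_injective _)
    · intro i
      simp only [w]
      rw [hu]
      refine Fin.lastCases ?_ (fun i => ?_) i
      · have hlead : g.coeff (d + 1) = 1 := by rw [← hd]; exact hg.coeff_natDegree
        rw [Fin.snoc_last, eq_neg_iff_add_eq_zero, ← hz, aeval_eq_sum_range, hd,
          Finset.sum_range_succ, hlead, one_smul, add_mulVec, sum_mulVec,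
          Finset.sum_range, add_comm, mulVec_mulVec, ← pow_succ']
        simp [smul_mulVec]
      · rw [Fin.snoc_castSucc, mulVec_mulVec, Fin.val_castSucc, pow_succ']
  by_cases hdn : d + 1 ≤ n
  · have hB (u') : Fintype.card F ^ (n * (d + 1)) * (B u').card ≤ Fintype.card F ^ (n * n) := by
      by_cases hli : LinearIndependent F (u u')
      · rw [← card_matrix_prescribed (u u') (w u') hli]
        simp only [B, hli, true_and]
        exact le_rfl
      · simp [B, hli]
    have h1 := (Finset.card_le_card hsub).trans Finset.card_biUnion_le
    have h2 : Fintype.card F ^ (n * (d + 1)) *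
        (Finset.univ.filter fun M : Matrix (Fin n) (Fin n) F => IsKrylovPoly M v g).card ≤
        Fintype.card F ^ (n * d) * Fintype.card F ^ (n * n) := by
      refine (Nat.mul_le_mul_left _ h1).trans ?_
      rw [Finset.mul_sum]
      refine (Finset.sum_le_card_nsmul _ _ _ fun u' _ => hB u').trans_eq ?_
      simp [← pow_mul]
    rw [mul_add, mul_one, pow_add, mul_assoc] at h2
    exact Nat.le_of_mul_le_mul_left h2 (pow_pos hq _)
  · rw [Finset.filter_false_of_mem, Finset.card_empty, mul_zero]
    · exact Nat.zero_le _
    · rintro M - ⟨hg, h, -⟩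
      have := h.fintype_card_le_finrank
      simp at this
      omega

variable (F) in
/-- The proportion of `n × n` matrices over a finite field satisfying `E`. -/
def matProb (n : ℕ) (E : Matrix (Fin n) (Fin n) F → Prop) : ℝ :=
  ((Finset.univ.filter E).card : ℝ) / (Fintype.card F : ℝ) ^ (n * n)

theorem matProb_krylov_le {n : ℕ} {v : Fin n → F} (hv : v ≠ 0) (Q : F[X] → Prop) :
    matProb F n (fun M => ∃ g, IsKrylovPoly M v g ∧ Q g) ≤
      ∑ m ∈ Finset.range (n + 1), ((1 / 2 : ℝ) ^ (n - m)) *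
        monicAvg F m (fun g => if Q g then 1 else 0) := by
  have hq := card_pos_real (F := F)
  have hq2 := two_le_card_real (F := F)
  have hsub : (Finset.univ.filter fun M : Matrix (Fin n) (Fin n) F =>
      ∃ g, IsKrylovPoly M v g ∧ Q g) ⊆ (Finset.range (n + 1)).biUnion fun m =>
        ((monicsOfDegree F m).filter Q).biUnion fun g => Finset.univ.filter fun M =>
          IsKrylovPoly M v g := by
    intro M hM
    obtain ⟨g, hK, hQ⟩ := (Finset.mem_filter.1 hM).2
    simp only [Finset.mem_biUnion, Finset.mem_filter, Finset.mem_univ, true_and, Finset.mem_range]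
    refine ⟨g.natDegree, ?_, g, ⟨mem_monicsOfDegree.2 ⟨hK.1, rfl⟩, hQ⟩, hK⟩
    have := hK.2.1.fintype_card_le_finrank
    simp at this
    omega
  have hcard : ((Finset.univ.filter fun M : Matrix (Fin n) (Fin n) F =>
      ∃ g, IsKrylovPoly M v g ∧ Q g).card : ℝ) ≤ ∑ m ∈ Finset.range (n + 1),
        ∑ g ∈ (monicsOfDegree F m).filter Q,
          ((Finset.univ.filter fun M : Matrix (Fin n) (Fin n) F => IsKrylovPoly M v g).card : ℝ) := by
    have h := (Finset.card_le_card hsub).trans (Finset.card_biUnion_le.trans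
      (Finset.sum_le_sum fun m _ => Finset.card_biUnion_le))
    exact_mod_cast h
  rw [matProb, div_le_iff₀ (by positivity), Finset.sum_mul]
  refine hcard.trans (Finset.sum_le_sum fun m hm => ?_)
  have hmn : m ≤ n := by have := Finset.mem_range.1 hm; omega
  rw [monicAvg, ← Finset.sum_filter, Finset.sum_const, nsmul_eq_mul, mul_one]
  have h1 : ∀ g ∈ (monicsOfDegree F m).filter Q, ((Finset.univ.filter fun M :
      Matrix (Fin n) (Fin n) F => IsKrylovPoly M v g).card : ℝ) ≤
        (Fintype.card F : ℝ) ^ (n * n) / (Fintype.card F : ℝ) ^ n := by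
    intro g _
    rw [le_div_iff₀ (by positivity), mul_comm]
    exact_mod_cast card_isKrylovPoly_le hv g
  refine (Finset.sum_le_card_nsmul _ _ _ h1).trans ?_
  rw [nsmul_eq_mul]
  have h2 : ((Fintype.card F : ℝ) ^ n)⁻¹ ≤ (1 / 2) ^ (n - m) * ((Fintype.card F : ℝ) ^ m)⁻¹ := by
    rw [← Nat.sub_add_cancel hmn, pow_add, mul_inv, Nat.add_sub_cancel]
    refine mul_le_mul_of_nonneg_right ?_ (by positivity)
    rw [one_div, inv_pow]
    exact inv_anti₀ (by positivity) (pow_le_pow_left₀ (by norm_num) hq2 _)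
  calc _ = (((monicsOfDegree F m).filter Q).card : ℝ) * (Fintype.card F : ℝ) ^ (n * n) *
        ((Fintype.card F : ℝ) ^ n)⁻¹ := by ring
    _ ≤ (((monicsOfDegree F m).filter Q).card : ℝ) * (Fintype.card F : ℝ) ^ (n * n) *
        ((1 / 2) ^ (n - m) * ((Fintype.card F : ℝ) ^ m)⁻¹) :=
        mul_le_mul_of_nonneg_left h2 (by positivity)
    _ = _ := by ring

end Krylov

section Medium

open Polynomial Matrix

variable {F : Type*} [Field F]

/-- The monic annihilator of the all-ones vector. -/
def krylovPoly {n : ℕ} (M : Matrix (Fin n) (Fin n) F) : F[X] :=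
  (exists_isKrylovPoly M fun _ => 1).choose

theorem krylovPoly_spec {n : ℕ} (M : Matrix (Fin n) (Fin n) F) :
    IsKrylovPoly M (fun _ => 1) (krylovPoly M) :=
  (exists_isKrylovPoly M fun _ => 1).choose_spec.1

theorem krylovPoly_dvd {n : ℕ} (M : Matrix (Fin n) (Fin n) F) :
    krylovPoly M ∣ M.charpoly :=
  (exists_isKrylovPoly M fun _ => 1).choose_spec.2

theorem exists_charpoly_eq_krylovPoly_mul {n : ℕ} (M : Matrix (Fin n) (Fin n) F) :
    ∃ h : F[X], h.Monic ∧ M.charpoly = krylovPoly M * h ∧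
      (krylovPoly M).natDegree + h.natDegree = n := by
  obtain ⟨h, hh⟩ := krylovPoly_dvd M
  have hm : h.Monic := (krylovPoly_spec M).1.of_mul_monic_left (hh ▸ M.charpoly_monic)
  refine ⟨h, hm, hh, ?_⟩
  rw [← (krylovPoly_spec M).1.natDegree_mul hm, ← hh, charpoly_natDegree_eq_dim, Fintype.card_fin]

theorem exists_monic_dvd_of_dvd_mul {u g h : F[X]} (hu : u.Monic) (hh : h.Monic)
    (hd : u ∣ g * h) :
    ∃ w, w.Monic ∧ w ∣ g ∧ w.natDegree ≤ u.natDegree ∧ u.natDegree ≤ w.natDegree + h.natDegree := by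
  obtain ⟨a, b, ha, hb, rfl⟩ := exists_dvd_and_dvd_of_dvd_mul hd
  have ha0 : a ≠ 0 := left_ne_zero_of_mul hu.ne_zero
  have hb0 : b ≠ 0 := right_ne_zero_of_mul hu.ne_zero
  refine ⟨normalize a, monic_normalize ha0, normalize_dvd_iff.2 ha, ?_, ?_⟩
  · rw [natDegree_eq_of_degree_eq degree_normalize, natDegree_mul ha0 hb0]
    omega
  · rw [natDegree_eq_of_degree_eq degree_normalize, natDegree_mul ha0 hb0]
    have := natDegree_le_of_dvd hb hh.ne_zero
    omega

/-- The characteristic polynomial is, up to a factor of degree less than `J`, a typical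
polynomial. -/
def IsKrylovTypical {n : ℕ} (K J : ℕ) (M : Matrix (Fin n) (Fin n) F) : Prop :=
  n < (krylovPoly M).natDegree + J ∧ IsTypicalPoly K (krylovPoly M)

variable [Fintype F]

theorem matProb_mono {n : ℕ} {E E' : Matrix (Fin n) (Fin n) F → Prop} (h : ∀ M, E M → E' M) :
    matProb F n E ≤ matProb F n E' := by
  unfold matProb
  gcongr
  exact h _

theorem matProb_nonneg {n : ℕ} (E : Matrix (Fin n) (Fin n) F → Prop) : 0 ≤ matProb F n E := by
  unfold matProb
  positivity

theorem sum_half_pow_sub_le (n : ℕ) : ∑ m ∈ Finset.range (n + 1), (1 / 2 : ℝ) ^ (n - m) ≤ 2 := by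
  have h := Finset.sum_range_reflect (fun m => (1 / 2 : ℝ) ^ m) (n + 1)
  simp only [Nat.add_sub_cancel] at h
  rw [h]
  exact sum_geometric_two_le _

theorem sum_half_pow_sub_ite_le (n J : ℕ) :
    ∑ m ∈ Finset.range (n + 1), (1 / 2 : ℝ) ^ (n - m) * (if n < m + J then 0 else 1) ≤
      2 * (1 / 2) ^ J := by
  have h := Finset.sum_range_reflect
    (fun m => (1 / 2 : ℝ) ^ m * (if m < J then 0 else 1)) (n + 1)
  simp only [Nat.add_sub_cancel] at h
  have h2 : ∑ m ∈ Finset.range (n + 1), (1 / 2 : ℝ) ^ (n - m) * (if n < m + J then 0 else 1) =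
      ∑ m ∈ Finset.range (n + 1), (1 / 2 : ℝ) ^ (n - m) * (if n - m < J then 0 else 1) := by
    refine Finset.sum_congr rfl fun m hm => ?_
    have := Finset.mem_range.1 hm
    congr 1
    refine if_congr (by omega) rfl rfl
  rw [h2, h]
  have h3 : ∑ m ∈ Finset.range (n + 1), (1 / 2 : ℝ) ^ m * (if m < J then 0 else 1) ≤
      ∑ m ∈ Finset.range (J + (n + 1)), (1 / 2 : ℝ) ^ m * (if m < J then 0 else 1) :=
    Finset.sum_le_sum_of_subset_of_nonneg
      (fun x hx => Finset.mem_range.2 (by have := Finset.mem_range.1 hx; omega))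
      fun _ _ _ => by positivity
  refine h3.trans ?_
  rw [Finset.sum_range_add, Finset.sum_eq_zero, zero_add]
  · simp only [pow_add, not_lt.2 (Nat.le_add_right J _), if_false, mul_one]
    rw [← Finset.mul_sum, mul_comm]
    gcongr
    exact sum_geometric_two_le _
  · intro x hx
    simp [Finset.mem_range.1 hx]

theorem matProb_krylovPoly_le {n : ℕ} (hn : 1 ≤ n) (Q : F[X] → Prop) :
    matProb F n (fun M => Q (krylovPoly M)) ≤
      ∑ m ∈ Finset.range (n + 1), ((1 / 2 : ℝ) ^ (n - m)) *
        monicAvg F m (fun g => if Q g then 1 else 0) := by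
  have hv : (fun _ : Fin n => (1 : F)) ≠ 0 := by
    intro h
    exact one_ne_zero (congrFun h ⟨0, hn⟩)
  exact (matProb_mono fun M hM => ⟨krylovPoly M, krylovPoly_spec M, hM⟩).trans
    (matProb_krylov_le hv Q)

theorem matProb_not_isKrylovTypical_le {n : ℕ} (hn : 1 ≤ n) {K : ℕ} (hK : 1 ≤ K) (J : ℕ) :
    matProb F n (fun M => ¬ IsKrylovTypical K J M) ≤
      2 * (1 / 2) ^ J + 2 * atypicalBound K := by
  refine (matProb_krylovPoly_le hn fun g => ¬ (n < g.natDegree + J ∧ IsTypicalPoly K g)).trans ?_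
  have hA : 0 ≤ atypicalBound K :=
    (monicAvg_nonneg fun _ => by split_ifs <;> norm_num).trans
      (monicAvg_not_isTypicalPoly_le (F := F) hK 0)
  have hm (m : ℕ) : monicAvg F m (fun g => if ¬ (n < g.natDegree + J ∧ IsTypicalPoly K g)
      then 1 else 0) ≤ (if n < m + J then 0 else 1) + atypicalBound K := by
    refine (monicAvg_mono (g := fun g => (if n < m + J then 0 else 1) * 1 +
      if IsTypicalPoly K g then 0 else 1) ?_).trans ?_
    · rintro a ha rfl
      by_cases h1 : n < a.natDegree + J <;> by_cases h2 : IsTypicalPoly K a <;> simp [h1, h2]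
    · rw [monicAvg_add, monicAvg_const_mul, monicAvg_one, mul_one]
      gcongr
      exact monicAvg_not_isTypicalPoly_le hK m
  calc _ ≤ ∑ m ∈ Finset.range (n + 1), (1 / 2 : ℝ) ^ (n - m) *
        ((if n < m + J then 0 else 1) + atypicalBound K) := by
        refine Finset.sum_le_sum fun m _ => ?_
        gcongr
        refine (hm m).trans_eq' ?_
        congr!
    _ ≤ _ := by
        simp only [mul_add]
        rw [Finset.sum_add_distrib, ← Finset.sum_mul]
        gcongr
        · exact sum_half_pow_sub_ite_le n J
        · exact sum_half_pow_sub_le n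

/-- The constant in the bound for divisors of intermediate degree. -/
def mediumConst (K J : ℕ) : ℝ := 2 * (J * (2 * 2 ^ (2 * K) * (4 : ℝ) ^ (0.27 : ℝ)))

theorem two_rpow_neg_log_le {k : ℕ} (hk : 1 ≤ k) :
    (2 : ℝ) ^ (-(0.27 : ℝ) * (Nat.log 2 k - 1 : ℕ)) ≤ (4 : ℝ) ^ (0.27 : ℝ) *
      (k : ℝ) ^ (-(0.27 : ℝ)) := by
  have h1 : k < 2 ^ (Nat.log 2 k).succ := Nat.lt_pow_succ_log_self (by norm_num) k
  have hk0 : (0 : ℝ) < k := by exact_mod_cast hk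
  have h2 : (k : ℝ) / 4 ≤ (2 : ℝ) ^ (Nat.log 2 k - 1 : ℕ) := by
    rw [div_le_iff₀ (by norm_num)]
    have : k ≤ 2 ^ (Nat.log 2 k - 1) * 4 := by
      refine h1.le.trans ?_
      rw [show (4 : ℕ) = 2 ^ 2 by norm_num, ← pow_add]
      exact Nat.pow_le_pow_right (by norm_num) (by omega)
    exact_mod_cast this
  have h3 : (2 : ℝ) ^ (-(0.27 : ℝ) * (Nat.log 2 k - 1 : ℕ)) =
      ((2 : ℝ) ^ (Nat.log 2 k - 1 : ℕ)) ^ (-(0.27 : ℝ)) := by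
    rw [← Real.rpow_natCast, ← Real.rpow_mul (by norm_num), mul_comm]
  rw [h3]
  refine (Real.rpow_le_rpow_of_nonpos (by positivity) h2 (by norm_num)).trans_eq ?_
  rw [Real.div_rpow hk0.le (by norm_num), Real.rpow_neg (by norm_num : (0 : ℝ) ≤ 4), div_inv_eq_mul,
    mul_comm]

theorem matProb_isKrylovTypical_dvd_le {n K J k : ℕ} (hJ : 1 ≤ J) (hk : 2 * J ≤ k)
    (hkn : 2 * k ≤ n) :
    matProb F n (fun M => IsKrylovTypical K J M ∧
      ∃ u : F[X], u.Monic ∧ u.natDegree = k ∧ u ∣ M.charpoly) ≤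
        mediumConst K J * (k : ℝ) ^ (-(0.27 : ℝ)) := by
  set i := Nat.log 2 k - 1 with hi
  have hlog : 1 ≤ Nat.log 2 k := Nat.log_pos (by norm_num) (by omega)
  have hik : 2 ^ i * 2 ≤ k := by
    rw [← pow_succ, hi, Nat.sub_add_cancel hlog]
    exact Nat.pow_log_le_self 2 (by omega)
  obtain ⟨Q, hQ⟩ : ∃ Q : F[X] → Prop, ∀ g, Q g ↔ n < g.natDegree + J ∧ ∃ j ∈ Finset.range J,
      IsTypicalPoly K g ∧ ∃ u : F[X], u.Monic ∧ u.natDegree = k - j ∧ u ∣ g := ⟨_, fun _ => Iff.rfl⟩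
  have h1 : matProb F n (fun M => IsKrylovTypical K J M ∧
      ∃ u : F[X], u.Monic ∧ u.natDegree = k ∧ u ∣ M.charpoly) ≤
        matProb F n (fun M => Q (krylovPoly M)) := by
    refine matProb_mono fun M hM => (hQ _).2 ?_
    obtain ⟨⟨hd, ht⟩, u, hu, huk, hdvd⟩ := hM
    obtain ⟨h, hh, heq, hdeg⟩ := exists_charpoly_eq_krylovPoly_mul M
    rw [heq] at hdvd
    obtain ⟨w, hw, hwg, hw1, hw2⟩ := exists_monic_dvd_of_dvd_mul hu hh hdvd
    exact ⟨hd, k - w.natDegree, Finset.mem_range.2 (by omega), ht, w, hw, by omega, hwg⟩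
  refine h1.trans ((matProb_krylovPoly_le (by omega) _).trans ?_)
  set c : ℝ := J * (2 * 2 ^ (2 * K) * (2 : ℝ) ^ (-(0.27 : ℝ) * i)) with hc
  have hc0 : 0 ≤ c := by positivity
  have hm (m : ℕ) : monicAvg F m (fun g => if Q g then 1 else 0) ≤ c := by
    by_cases hmn : n < m + J
    · refine (monicAvg_mono (g := fun g => ∑ j ∈ Finset.range J, if IsTypicalPoly K g ∧
        ∃ u : F[X], u.Monic ∧ u.natDegree = k - j ∧ u ∣ g then 1 else 0) ?_).trans ?_
      · intro a ha hd
        split_ifs with h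
        · obtain ⟨-, j, hj, h⟩ := (hQ a).1 h
          refine le_trans ?_ (Finset.single_le_sum (fun _ _ => ?_) hj)
          · rw [if_pos h]
          · split_ifs <;> norm_num
        · exact Finset.sum_nonneg fun _ _ => by split_ifs <;> norm_num
      · rw [monicAvg_sum]
        have hj (j : ℕ) (hj : j ∈ Finset.range J) := monicAvg_typical_dvd_le (F := F) K i (k - j) m
          (by have := Finset.mem_range.1 hj; omega) (by have := Finset.mem_range.1 hj; omega)
        refine (Finset.sum_le_card_nsmul _ _ (2 * 2 ^ (2 * K) * (2 : ℝ) ^ (-(0.27 : ℝ) * i))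
          fun j h => ?_).trans_eq ?_
        · convert hj j h
        · rw [Finset.card_range, nsmul_eq_mul]
    · refine (monicAvg_mono (g := fun _ => 0 * 1) ?_).trans ?_
      · rintro a ha rfl
        rw [if_neg fun h => hmn ((hQ a).1 h).1, zero_mul]
      · rw [monicAvg_const_mul, zero_mul]
        exact hc0
  calc _ ≤ ∑ m ∈ Finset.range (n + 1), (1 / 2 : ℝ) ^ (n - m) * c := by
        refine Finset.sum_le_sum fun m _ => ?_
        gcongr
        exact hm m
    _ ≤ 2 * c := by
        rw [← Finset.sum_mul]
        gcongr
        exact sum_half_pow_sub_le n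
    _ ≤ _ := by
        have := two_rpow_neg_log_le (k := k) (by omega)
        calc 2 * c ≤ 2 * (J * (2 * 2 ^ (2 * K) * ((4 : ℝ) ^ (0.27 : ℝ) *
              (k : ℝ) ^ (-(0.27 : ℝ))))) := by rw [hc]; gcongr
          _ = _ := by rw [mediumConst]; ring

end Medium

section PrimeFactor

open Polynomial Matrix

variable {F : Type*} [Field F] [Fintype F]

theorem monicAvg_no_factor_le {s : Finset ℕ} {m : ℕ} (hs : ∀ d ∈ s, 2 * d ≤ m) {Λ : ℝ}
    (hΛ0 : 0 < Λ)
    (hΛ : Λ ≤ ∑ φ ∈ monicIrreduciblesIn F s, ((Fintype.card F : ℝ) ^ φ.natDegree)⁻¹) :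
    monicAvg F m (fun g => if ∃ φ ∈ monicIrreduciblesIn F s, φ ∣ g then 0 else 1) ≤ 1 / Λ := by
  set S := monicIrreduciblesIn F s with hS
  set w : F[X] → ℝ := fun φ => ((Fintype.card F : ℝ) ^ φ.natDegree)⁻¹ with hw
  have hq := card_pos_real (F := F)
  have hw0 (φ) : 0 ≤ w φ := by simp only [hw]; positivity
  set L := ∑ φ ∈ S, w φ with hL
  have hL0 : 0 < L := hΛ0.trans_le hΛ
  have hdeg : ∀ φ ∈ S, φ.Monic ∧ Irreducible φ ∧ 2 * φ.natDegree ≤ m := fun φ hφ => by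
    rw [hS, mem_monicIrreduciblesIn] at hφ
    exact ⟨hφ.1, hφ.2.1, hs _ hφ.2.2⟩
  set N : F[X] → ℝ := fun g => ∑ φ ∈ S, if φ ∣ g then 1 else 0 with hN
  have hN1 : monicAvg F m N = L := by
    simp only [hN, monicAvg_sum, hL]
    refine Finset.sum_congr rfl fun φ hφ => ?_
    exact monicAvg_dvd (hdeg φ hφ).1 (by have := hdeg φ hφ; omega)
  have hN2 : monicAvg F m (fun g => N g * N g) ≤ L * L + L := by
    have h1 : (fun g => N g * N g) = fun g => ∑ φ ∈ S, ∑ ψ ∈ S,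
        (if φ ∣ g then (1 : ℝ) else 0) * if ψ ∣ g then 1 else 0 := by
      funext g
      simp only [hN, Finset.sum_mul_sum]
    have h2 : L * L + L = ∑ φ ∈ S, ∑ ψ ∈ S, (w φ * w ψ + if φ = ψ then w φ else 0) := by
      simp only [Finset.sum_add_distrib, Finset.sum_ite_eq, ← Finset.sum_mul_sum]
      rw [Finset.sum_congr rfl fun x hx => if_pos hx]
    rw [h1, h2, monicAvg_sum]
    refine Finset.sum_le_sum fun φ hφ => ?_
    rw [monicAvg_sum]
    refine Finset.sum_le_sum fun ψ hψ => ?_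
    obtain ⟨a1, a2, a3⟩ := hdeg φ hφ
    obtain ⟨b1, b2, b3⟩ := hdeg ψ hψ
    by_cases h : φ = ψ
    · subst h
      rw [if_pos rfl]
      have h3 : (fun g => (if φ ∣ g then (1 : ℝ) else 0) * if φ ∣ g then 1 else 0) =
          fun g => if φ ∣ g then 1 else 0 := by
        funext g
        split_ifs <;> simp
      rw [h3, monicAvg_dvd a1 (by omega)]
      have := mul_nonneg (hw0 φ) (hw0 φ)
      simp only [hw] at this ⊢
      linarith
    · rw [if_neg h, add_zero]
      have hc := isCoprime_of_monic_irreducible a1 a2 b1 b2 h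
      have h3 : (fun g => (if φ ∣ g then (1 : ℝ) else 0) * if ψ ∣ g then 1 else 0) =
          fun g => if φ * ψ ∣ g then 1 else 0 := by
        funext g
        have : φ * ψ ∣ g ↔ φ ∣ g ∧ ψ ∣ g :=
          ⟨fun h => ⟨(dvd_mul_right _ _).trans h, (dvd_mul_left _ _).trans h⟩,
            fun h => hc.mul_dvd h.1 h.2⟩
        by_cases h1 : φ ∣ g <;> by_cases h2 : ψ ∣ g <;> simp [this, h1, h2]
      rw [h3, monicAvg_dvd (a1.mul b1) (by rw [a1.natDegree_mul b1]; omega), a1.natDegree_mul b1,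
        pow_add, mul_inv]
  calc monicAvg F m (fun g => if ∃ φ ∈ S, φ ∣ g then 0 else 1) ≤
        monicAvg F m (fun g => (1 / (L * L)) * (N g * N g) + (((-2 / L) * N g) + 1 * 1)) := by
        refine monicAvg_mono fun g _ _ => ?_
        have h1 : (1 / (L * L)) * (N g * N g) + (((-2 / L) * N g) + 1 * 1) = (N g / L - 1) ^ 2 := by
          field_simp
          ring
        rw [h1]
        split_ifs with h
        · positivity
        · have : N g = 0 := Finset.sum_eq_zero fun φ hφ => if_neg fun hd => h ⟨φ, hφ, hd⟩
          rw [this]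
          norm_num
    _ = (1 / (L * L)) * monicAvg F m (fun g => N g * N g) + (((-2 / L) * L) + 1) := by
        rw [monicAvg_add, monicAvg_add, monicAvg_const_mul, monicAvg_const_mul, monicAvg_const_mul,
          monicAvg_one, hN1, mul_one]
    _ ≤ (1 / (L * L)) * (L * L + L) + (((-2 / L) * L) + 1) := by gcongr
    _ = 1 / L := by field_simp; ring
    _ ≤ 1 / Λ := one_div_le_one_div_of_le hΛ0 hΛ

/-- `g` is divisible by `φ ψ` where `φ`, `ψ` are irreducible, the degree of `φ` lies in `s` and
divides that of `ψ`. -/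
def HasLinkedPair (s : Finset ℕ) (g : F[X]) : Prop :=
  ∃ φ ψ : F[X], φ ∈ monicIrreduciblesIn F s ∧ ψ.Monic ∧ Irreducible ψ ∧
    φ.natDegree ∣ ψ.natDegree ∧ φ * ψ ∣ g

theorem monicAvg_hasLinkedPair_le {s : Finset ℕ} (hs : ∀ d ∈ s, 1 ≤ d) (m : ℕ) :
    monicAvg F m (fun g => if HasLinkedPair s g then 1 else 0) ≤
      (∑ d ∈ s, ((d : ℝ) ^ 2)⁻¹) * (1 + Real.log m) := by
  have hq := card_pos_real (F := F)
  calc _ ≤ monicAvg F m (fun g => ∑ r ∈ s, ∑ t ∈ Finset.Icc 1 m, ∑ φ ∈ monicIrreducibles F r,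
        ∑ ψ ∈ monicIrreducibles F (r * t), if φ * ψ ∣ g then 1 else 0) := by
        refine monicAvg_mono fun g hg hgm => ?_
        have h0 (φ ψ : F[X]) : (0 : ℝ) ≤ if φ * ψ ∣ g then 1 else 0 := by split_ifs <;> norm_num
        have h1 (φ : F[X]) (t : Finset F[X]) : (0 : ℝ) ≤ ∑ ψ ∈ t, if φ * ψ ∣ g then 1 else 0 :=
          Finset.sum_nonneg fun _ _ => h0 _ _
        have h2 (t t' : Finset F[X]) : (0 : ℝ) ≤ ∑ φ ∈ t, ∑ ψ ∈ t', if φ * ψ ∣ g then 1 else 0 :=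
          Finset.sum_nonneg fun _ _ => h1 _ _
        have h3 (r : ℕ) : (0 : ℝ) ≤ ∑ t ∈ Finset.Icc 1 m, ∑ φ ∈ monicIrreducibles F r,
            ∑ ψ ∈ monicIrreducibles F (r * t), if φ * ψ ∣ g then 1 else 0 :=
          Finset.sum_nonneg fun _ _ => h2 _ _
        split_ifs with h
        · obtain ⟨φ, ψ, hφ, hψ, hψi, ⟨t, ht⟩, hd⟩ := h
          rw [mem_monicIrreduciblesIn] at hφ
          have hψd : ψ.natDegree ≤ m := by
            rw [← hgm]
            exact natDegree_le_of_dvd ((dvd_mul_left _ _).trans hd) hg.ne_zero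
          have hψ1 := hψi.natDegree_pos
          have ht1 : t ≠ 0 := by rintro rfl; omega
          have htm : t ≤ m := le_trans (Nat.le_mul_of_pos_left t (hs _ hφ.2.2)) (ht ▸ hψd)
          refine le_trans ?_ (Finset.single_le_sum (fun r _ => h3 r) hφ.2.2)
          refine le_trans ?_ (Finset.single_le_sum (fun _ _ => h2 _ _)
            (Finset.mem_Icc.2 ⟨by omega, htm⟩ : t ∈ Finset.Icc 1 m))
          refine le_trans ?_ (Finset.single_le_sum (fun _ _ => h1 _ _)
            (mem_monicIrreducibles.2 ⟨hφ.1, rfl, hφ.2.1⟩))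
          refine le_trans ?_ (Finset.single_le_sum (fun _ _ => h0 _ _)
            (mem_monicIrreducibles.2 ⟨hψ, ht, hψi⟩))
          rw [if_pos hd]
        · exact Finset.sum_nonneg fun r _ => h3 r
    _ ≤ ∑ r ∈ s, ∑ t ∈ Finset.Icc 1 m, ((r : ℝ) ^ 2)⁻¹ * (1 / t) := by
        rw [monicAvg_sum]
        refine Finset.sum_le_sum fun r hr => ?_
        rw [monicAvg_sum]
        refine Finset.sum_le_sum fun t ht => ?_
        have hr1 : (0 : ℝ) < r := by exact_mod_cast hs r hr
        have ht1 : (0 : ℝ) < t := by exact_mod_cast (Finset.mem_Icc.1 ht).1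
        have hrt : 1 ≤ r * t := Nat.mul_pos (hs r hr) (Finset.mem_Icc.1 ht).1
        rw [monicAvg_sum]
        calc _ ≤ ∑ φ ∈ monicIrreducibles F r, ∑ ψ ∈ monicIrreducibles F (r * t),
              ((Fintype.card F : ℝ) ^ r)⁻¹ * ((Fintype.card F : ℝ) ^ (r * t))⁻¹ := by
              refine Finset.sum_le_sum fun φ hφ => ?_
              rw [monicAvg_sum]
              refine Finset.sum_le_sum fun ψ hψ => ?_
              rw [mem_monicIrreducibles] at hφ hψ
              refine (monicAvg_dvd_le (hφ.1.mul hψ.1) m).trans_eq ?_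
              rw [hφ.1.natDegree_mul hψ.1, hφ.2.1, hψ.2.1, pow_add, mul_inv]
          _ = (((monicIrreducibles F r).card : ℝ) * ((Fintype.card F : ℝ) ^ r)⁻¹) *
              (((monicIrreducibles F (r * t)).card : ℝ) * ((Fintype.card F : ℝ) ^ (r * t))⁻¹) := by
              simp only [Finset.sum_const, nsmul_eq_mul]
              ring
          _ ≤ (1 / r) * (1 / (r * t : ℕ)) := by
              gcongr
              · exact sum_monicIrreducibles_inv_pow_le r (hs r hr)
              · exact sum_monicIrreducibles_inv_pow_le _ hrt
          _ = _ := by push_cast; field_simp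
    _ ≤ _ := by
        rw [← Finset.sum_mul_sum]
        gcongr
        exact sum_Icc_one_div_le m

theorem monicAvg_exists_pow_dvd_le {a : ℕ} (ha : 1 ≤ a) (m : ℕ) :
    monicAvg F m (fun g => if ∃ ψ : F[X], ψ.Monic ∧ Irreducible ψ ∧ ψ ^ (a + 1) ∣ g
      then 1 else 0) ≤ 4 * (1 / 2 : ℝ) ^ a := by
  refine (monicAvg_mono fun g hg hgm => ?_).trans (monicAvg_pow_dvd_le (F := F) a ha
    (Finset.Icc 1 m) (fun d hd => (Finset.mem_Icc.1 hd).1) m (a + 1))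
  have h0 (φ : F[X]) : (0 : ℝ) ≤ ∑ e ∈ Finset.Icc (a + 1) (a + 1), if φ ^ e ∣ g then 1 else 0 :=
    Finset.sum_nonneg fun _ _ => by split_ifs <;> norm_num
  split_ifs with h
  · obtain ⟨ψ, hψ, hψi, hd⟩ := h
    have hψd : ψ.natDegree ≤ m := by
      rw [← hgm]
      exact natDegree_le_of_dvd ((dvd_pow_self _ (by omega)).trans hd) hg.ne_zero
    refine le_trans ?_ (Finset.single_le_sum (fun φ _ => h0 φ) (mem_monicIrreduciblesIn.2
      ⟨hψ, hψi, Finset.mem_Icc.2 ⟨hψi.natDegree_pos, hψd⟩⟩))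
    rw [Finset.Icc_self, Finset.sum_singleton, if_pos hd]
  · exact Finset.sum_nonneg fun φ _ => h0 φ

omit [Fintype F] in
theorem pow_dvd_of_pow_dvd_mul {ψ g h : F[X]} (hψi : Irreducible ψ) (hh : h ≠ 0)
    {a r : ℕ} (hr : a + h.natDegree ≤ r) (hd : ψ ^ r ∣ g * h) : ψ ^ a ∣ g := by
  obtain ⟨x, y, hx, hy, hxy⟩ := exists_dvd_and_dvd_of_dvd_mul hd
  obtain ⟨i, hi, hxi⟩ := (dvd_prime_pow hψi.prime r).1 ⟨y, hxy⟩
  obtain ⟨j, hj, hyj⟩ := (dvd_prime_pow hψi.prime r).1 ⟨x, hxy.trans (mul_comm _ _)⟩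
  have h1 : (ψ ^ (i + j)).natDegree = (ψ ^ r).natDegree := by
    rw [pow_add]
    refine natDegree_eq_of_degree_eq (degree_eq_degree_of_associated ?_)
    rw [hxy]
    exact (hxi.mul_mul hyj).symm
  have hψ1 := hψi.natDegree_pos
  rw [natDegree_pow, natDegree_pow] at h1
  have h2 : i + j = r := Nat.eq_of_mul_eq_mul_right hψ1 h1
  have h3 : (ψ ^ j).natDegree ≤ h.natDegree := natDegree_le_of_dvd (hyj.symm.dvd.trans hy) hh
  rw [natDegree_pow] at h3
  have h4 : j ≤ h.natDegree := (Nat.le_mul_of_pos_right j hψ1).trans h3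
  exact (pow_dvd_pow ψ (by omega)).trans (hxi.symm.dvd.trans hx)

/-- The prime degrees used to produce a prime-length cycle. -/
def primeDegrees (R n : ℕ) : Finset ℕ := (Finset.Icc R (n / 4)).filter Nat.Prime

theorem hasIsolatedPrimeFactor_mul {g h : F[X]} (hg : g.Monic) (hh : h.Monic) {n R J a : ℕ}
    (hn : g.natDegree + h.natDegree = n) (hJ : h.natDegree < J) (hR : a + J ≤ R)
    (h1 : ∃ φ ∈ monicIrreduciblesIn F (primeDegrees R n), φ ∣ g)
    (h2 : ¬ HasLinkedPair (primeDegrees R n) g)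
    (h3 : ¬ ∃ ψ : F[X], ψ.Monic ∧ Irreducible ψ ∧ ψ ^ (a + 1) ∣ g) :
    HasIsolatedPrimeFactor (g * h) R := by
  obtain ⟨φ, hφ, hφg⟩ := h1
  have hφS := hφ
  obtain ⟨hφm, hφi, hφd⟩ := mem_monicIrreduciblesIn.1 hφ
  obtain ⟨hφd, hφp⟩ := Finset.mem_filter.1 hφd
  rw [Finset.mem_Icc] at hφd
  have key : ∀ ψ : F[X], Irreducible ψ → φ.natDegree ∣ ψ.natDegree → ¬ ψ ∣ h := by
    intro ψ hψi hdeg hd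
    have := natDegree_le_of_dvd hd hh.ne_zero
    have := Nat.le_of_dvd hψi.natDegree_pos hdeg
    omega
  refine ⟨φ, hφm, hφi, hφp, hφd.1, ?_, hφg.mul_right h, ?_, ?_, ?_⟩
  · rw [hg.natDegree_mul hh]
    omega
  · intro hd
    have hc : IsCoprime (φ ^ 2) h :=
      ((EuclideanDomain.dvd_or_coprime φ h hφi).resolve_left (key φ hφi dvd_rfl)).pow_left
    exact h2 ⟨φ, φ, hφS, hφm, hφi, dvd_rfl, by rw [← sq]; exact hc.dvd_of_dvd_mul_right hd⟩
  · intro ψ hψ hψi hd hdeg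
    by_contra hne
    have hψg := (hψi.prime.dvd_or_dvd hd).resolve_right (key ψ hψi hdeg)
    exact h2 ⟨φ, ψ, hφS, hψ, hψi, hdeg,
      (isCoprime_of_monic_irreducible hφm hφi hψ hψi (Ne.symm hne)).mul_dvd hφg hψg⟩
  · intro ψ hψ hψi hd
    exact h3 ⟨ψ, hψ, hψi, pow_dvd_of_pow_dvd_mul hψi hh.ne_zero (by omega) hd⟩

theorem sum_primeDegrees_inv_sq_le {R : ℕ} (hR : 1 ≤ R) (n : ℕ) :
    ∑ d ∈ primeDegrees R n, ((d : ℝ) ^ 2)⁻¹ ≤ 2 / R := by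
  have h := sum_Ioo_inv_sq_le (α := ℝ) (R - 1) (n / 4 + 1)
  rw [Nat.cast_pred hR, sub_add_cancel] at h
  refine le_trans (Finset.sum_le_sum_of_subset_of_nonneg ?_ fun _ _ _ => by positivity) h
  intro d hd
  rw [primeDegrees, Finset.mem_filter, Finset.mem_Icc] at hd
  rw [Finset.mem_Ioo]
  omega

theorem matProb_not_hasIsolatedPrimeFactor_le {n J a R : ℕ} (hn : 1 ≤ n) (hJ : 1 ≤ J)
    (hJn : 2 * J ≤ n) (ha : 1 ≤ a) (hR : a + J ≤ R) {Λ : ℝ} (hΛ0 : 0 < Λ)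
    (hΛ : Λ ≤ ∑ r ∈ primeDegrees R n, (1 / (2 * r) : ℝ)) :
    matProb F n (fun M => ¬ HasIsolatedPrimeFactor M.charpoly R) ≤
      2 * (1 / 2) ^ J + 2 * (1 / Λ + (2 / R) * (1 + Real.log n) + 4 * (1 / 2) ^ a) := by
  set s := primeDegrees R n with hs
  have hlogn : 0 ≤ Real.log n := Real.log_natCast_nonneg n
  have hR0 : (0 : ℝ) < R := by exact_mod_cast (by omega : 0 < R)
  have hs1 : ∀ d ∈ s, 1 ≤ d ∧ 4 * d ≤ n := fun d hd => by
    rw [hs, primeDegrees, Finset.mem_filter, Finset.mem_Icc] at hd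
    omega
  set δ : ℝ := 1 / Λ + (2 / R) * (1 + Real.log n) + 4 * (1 / 2) ^ a with hδ
  have hδ0 : 0 ≤ δ := by positivity
  obtain ⟨Q, hQ⟩ : ∃ Q : F[X] → Prop, ∀ g, Q g ↔ ¬ (n < g.natDegree + J) ∨
      ¬ (∃ φ ∈ monicIrreduciblesIn F s, φ ∣ g) ∨ HasLinkedPair s g ∨
      ∃ ψ : F[X], ψ.Monic ∧ Irreducible ψ ∧ ψ ^ (a + 1) ∣ g := ⟨_, fun _ => Iff.rfl⟩
  have h1 : matProb F n (fun M => ¬ HasIsolatedPrimeFactor M.charpoly R) ≤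
      matProb F n (fun M => Q (krylovPoly M)) := by
    refine matProb_mono fun M hM => ?_
    by_contra hc
    rw [hQ] at hc
    push Not at hc
    obtain ⟨h, hh, heq, hdeg⟩ := exists_charpoly_eq_krylovPoly_mul M
    refine hM ?_
    rw [heq]
    refine hasIsolatedPrimeFactor_mul (krylovPoly_spec M).1 hh hdeg (by omega) hR hc.2.1 hc.2.2.1 ?_
    rintro ⟨ψ, b1, b2, b3⟩
    exact hc.2.2.2 ψ b1 b2 b3
  have hm : ∀ m ∈ Finset.range (n + 1), monicAvg F m (fun g => if Q g then 1 else 0) ≤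
      (if n < m + J then 0 else 1) + δ := by
    intro m hmr
    have hmn : m ≤ n := by have := Finset.mem_range.1 hmr; omega
    by_cases hmJ : n < m + J
    · rw [if_pos hmJ, zero_add]
      calc _ ≤ monicAvg F m (fun g =>
            ((if ∃ φ ∈ monicIrreduciblesIn F s, φ ∣ g then 0 else 1) +
              if HasLinkedPair s g then 1 else 0) +
                if ∃ ψ : F[X], ψ.Monic ∧ Irreducible ψ ∧ ψ ^ (a + 1) ∣ g then 1 else 0) := by
            refine monicAvg_mono ?_
            rintro g hg rfl
            have hQg := hQ g
            by_cases c1 : ∃ φ ∈ monicIrreduciblesIn F s, φ ∣ g <;> by_cases c2 : HasLinkedPair s g <;>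
              by_cases c3 : ∃ ψ : F[X], ψ.Monic ∧ Irreducible ψ ∧ ψ ^ (a + 1) ∣ g <;>
              simp only [c1, c2, c3, hmJ, not_true_eq_false, not_false_eq_true, or_true, or_false,
                iff_true, iff_false] at hQg <;>
              simp [c1, c2, c3, hQg]
        _ ≤ δ := by
            rw [monicAvg_add, monicAvg_add, hδ]
            gcongr ?_ + ?_ + ?_
            · refine monicAvg_no_factor_le (fun d hd => ?_) hΛ0 ?_
              · have := hs1 d hd
                omega
              · rw [sum_monicIrreduciblesIn]
                refine hΛ.trans (Finset.sum_le_sum fun r hr => ?_)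
                rw [hs, primeDegrees, Finset.mem_filter] at hr
                refine (half_le_card_monicIrreducibles (F := F) hr.2).trans_eq ?_
                rw [← nsmul_eq_mul, ← Finset.sum_const]
                refine Finset.sum_congr rfl fun φ hφ => ?_
                rw [(mem_monicIrreducibles.1 hφ).2.1]
            · refine (monicAvg_hasLinkedPair_le (fun d hd => (hs1 d hd).1) m).trans ?_
              have hl : Real.log m ≤ Real.log n := by
                rcases Nat.eq_zero_or_pos m with rfl | hm0
                · simpa using hlogn
                · exact Real.log_le_log (by exact_mod_cast hm0) (by exact_mod_cast hmn)
              have := Real.log_natCast_nonneg m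
              gcongr
              exact sum_primeDegrees_inv_sq_le (by omega) n
            · exact monicAvg_exists_pow_dvd_le ha m
    · rw [if_neg hmJ]
      refine (monicAvg_mono (g := fun _ => 1) fun g _ _ => by split_ifs <;> norm_num).trans ?_
      rw [monicAvg_one]
      linarith
  calc _ ≤ _ := h1.trans (matProb_krylovPoly_le hn Q)
    _ ≤ ∑ m ∈ Finset.range (n + 1), (1 / 2 : ℝ) ^ (n - m) *
        ((if n < m + J then 0 else 1) + δ) := by
        refine Finset.sum_le_sum fun m hmr => ?_
        gcongr
        exact hm m hmr
    _ ≤ _ := by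
        simp only [mul_add]
        rw [Finset.sum_add_distrib, ← Finset.sum_mul]
        have h1 := sum_half_pow_sub_ite_le n J
        have h2 := mul_le_mul_of_nonneg_right (sum_half_pow_sub_le n) hδ0
        rw [hδ] at h2 ⊢
        linarith

omit [Fintype F] in
theorem HasIsolatedPrimeFactor.mono {f : F[X]} {R R' : ℕ} (hR : R' ≤ R)
    (h : HasIsolatedPrimeFactor f R) : HasIsolatedPrimeFactor f R' := by
  obtain ⟨φ, h1, h2, h3, h4, h5⟩ := h
  exact ⟨φ, h1, h2, h3, hR.trans h4, h5⟩

end PrimeFactor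

section PrimeSum

open Filter

theorem eight_mul_add_le_two_pow {j : ℕ} (hj : 7 ≤ j) : 8 * j + 9 ≤ 2 ^ j := by
  induction j, hj using Nat.le_induction with
  | base => norm_num
  | succ j hj ih => rw [pow_succ]; omega

theorem log_le_theta_sub {j : ℕ} (hj : 7 ≤ j) :
    (4 : ℝ) ^ j * Real.log 2 ≤
      Chebyshev.theta ((4 ^ (j + 1) : ℕ) : ℝ) - Chebyshev.theta ((4 ^ j : ℕ) : ℝ) := by
  have hl : 0 < Real.log 2 := Real.log_pos (by norm_num)
  have h4 : Real.log 4 = 2 * Real.log 2 := by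
    rw [show (4 : ℝ) = 2 ^ 2 by norm_num, Real.log_pow]
    norm_num
  have h1 := Chebyshev.theta_ge (4 ^ (j + 1))
  have h2 := Chebyshev.theta_le_log4_mul_x (x := ((4 ^ j : ℕ) : ℝ)) (by positivity)
  have hsq : Real.sqrt ((4 ^ (j + 1) : ℕ) : ℝ) = 2 ^ (j + 1) := by
    rw [Real.sqrt_eq_iff_mul_self_eq (by positivity) (by positivity), ← mul_pow]
    norm_num
  have hlog : Real.log ((4 ^ (j + 1) : ℕ) : ℝ) = (j + 1) * (2 * Real.log 2) := by
    push_cast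
    rw [Real.log_pow, h4]
    push_cast
    ring
  have hlog1 : Real.log (((4 ^ (j + 1) : ℕ) : ℝ) + 1) ≤ (2 * j + 3) * Real.log 2 := by
    have h : (((4 ^ (j + 1) : ℕ) : ℝ) + 1) ≤ (2 : ℝ) ^ (2 * j + 3) := by
      have : (2 : ℝ) ^ (2 * j + 3) = 4 ^ (j + 1) + 4 ^ (j + 1) := by
        rw [show 2 * j + 3 = 2 * (j + 1) + 1 by ring, pow_succ, pow_mul]
        norm_num
        ring
      rw [this]
      push_cast
      gcongr
      exact one_le_pow₀ (by norm_num)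
    refine (Real.log_le_log (by positivity) h).trans_eq ?_
    rw [Real.log_pow]
    push_cast
    ring
  rw [hsq, hlog] at h1
  rw [h4] at h2
  have h3 : (8 * j + 9 : ℝ) ≤ 2 ^ j := by exact_mod_cast eight_mul_add_le_two_pow hj
  have h5 : (4 : ℝ) ^ j = 2 ^ j * 2 ^ j := by rw [← mul_pow]; norm_num
  have h6 : (2 * j + 3 : ℝ) + 2 ^ (j + 3) * (j + 1) ≤ 4 ^ j := by
    rw [h5, pow_add]
    nlinarith [mul_le_mul_of_nonneg_right h3 (by positivity : (0 : ℝ) ≤ 2 ^ j),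
      (Nat.cast_nonneg j : (0 : ℝ) ≤ j)]
  have h7 := mul_le_mul_of_nonneg_right h6 hl.le
  push_cast at h1 h2 hlog1 ⊢
  have e1 : (4 : ℝ) ^ (j + 1) = 4 * 4 ^ j := by ring
  have e2 : (2 : ℝ) ^ (j + 3) = 8 * 2 ^ j := by ring
  have e3 : (2 : ℝ) ^ (j + 1) = 2 * 2 ^ j := by ring
  rw [e1] at h1 hlog1 ⊢
  rw [e2] at h7
  rw [e3] at h1
  nlinarith

theorem sum_prime_inv_Ioc_ge {j : ℕ} (hj : 7 ≤ j) :
    1 / (8 * (j + 1) : ℝ) ≤ ∑ p ∈ (Finset.Ioc (4 ^ j) (4 ^ (j + 1)) : Finset ℕ),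
      if p.Prime then (1 / p : ℝ) else 0 := by
  have hl : 0 < Real.log 2 := Real.log_pos (by norm_num)
  have h4 : Real.log 4 = 2 * Real.log 2 := by
    rw [show (4 : ℝ) = 2 ^ 2 by norm_num, Real.log_pow]
    norm_num
  have h := log_le_theta_sub hj
  have hle : 4 ^ j ≤ 4 ^ (j + 1) := Nat.pow_le_pow_right (by norm_num) (by omega)
  have hθ : Chebyshev.theta ((4 ^ (j + 1) : ℕ) : ℝ) - Chebyshev.theta ((4 ^ j : ℕ) : ℝ) =
      ∑ p ∈ (Finset.Ioc (4 ^ j) (4 ^ (j + 1)) : Finset ℕ), if p.Prime then Real.log p else 0 := by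
    simp only [Chebyshev.theta, Nat.floor_natCast, Finset.sum_filter]
    rw [sub_eq_iff_eq_add', Finset.sum_Ioc_consecutive _ (Nat.zero_le _) hle]
  have hb : ∑ p ∈ (Finset.Ioc (4 ^ j) (4 ^ (j + 1)) : Finset ℕ), (if p.Prime then Real.log p else 0) ≤
      (4 ^ (j + 1) * ((j + 1) * (2 * Real.log 2))) *
        ∑ p ∈ (Finset.Ioc (4 ^ j) (4 ^ (j + 1)) : Finset ℕ), if p.Prime then (1 / p : ℝ) else 0 := by
    rw [Finset.mul_sum]
    refine Finset.sum_le_sum fun p hp => ?_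
    rw [Finset.mem_Ioc] at hp
    split_ifs with hpp
    · have hp0 : (0 : ℝ) < p := by exact_mod_cast hpp.pos
      have hp4 : (p : ℝ) ≤ 4 ^ (j + 1) := by exact_mod_cast hp.2
      have h1 : Real.log p ≤ (j + 1) * (2 * Real.log 2) := by
        refine (Real.log_le_log hp0 hp4).trans_eq ?_
        rw [Real.log_pow, h4]
        push_cast
        ring
      have h0 : 0 ≤ Real.log p := Real.log_natCast_nonneg p
      rw [mul_one_div, le_div_iff₀ hp0, mul_comm]
      gcongr
    · simp
  set S := ∑ p ∈ (Finset.Ioc (4 ^ j) (4 ^ (j + 1)) : Finset ℕ), if p.Prime then (1 / p : ℝ) else 0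
  rw [hθ] at h
  have h1 := h.trans hb
  have h2 : (4 : ℝ) ^ j * Real.log 2 * 1 ≤ (4 : ℝ) ^ j * Real.log 2 * (S * (8 * (j + 1))) := by
    refine le_trans (by linarith) (h1.trans_eq ?_)
    rw [pow_succ]
    ring
  rw [div_le_iff₀ (by positivity)]
  exact le_of_mul_le_mul_left h2 (by positivity)

theorem log_sub_log_le_sum_prime_inv {s t : ℕ} (hs : 7 ≤ s) (hst : s ≤ t) :
    (1 / 8) * (Real.log (t + 1) - Real.log (s + 1)) ≤ ∑ p ∈ (Finset.Ioc (4 ^ s) (4 ^ t) : Finset ℕ),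
      if p.Prime then (1 / p : ℝ) else 0 := by
  induction t, hst using Nat.le_induction with
  | base => simp
  | succ t hst ih =>
    have h1 : 4 ^ s ≤ 4 ^ t := Nat.pow_le_pow_right (by norm_num) hst
    have h2 : 4 ^ t ≤ 4 ^ (t + 1) := Nat.pow_le_pow_right (by norm_num) (by omega)
    rw [← Finset.sum_Ioc_consecutive _ h1 h2]
    have h3 := sum_prime_inv_Ioc_ge (hs.trans hst)
    have ht : (0 : ℝ) < t + 1 := by positivity
    have h4 : Real.log ((t + 1 : ℕ) + 1) - Real.log (t + 1) ≤ 1 / (t + 1) := by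
      rw [← Real.log_div (by positivity) ht.ne']
      refine (Real.log_le_sub_one_of_pos (by positivity)).trans_eq ?_
      push_cast
      field_simp
      ring
    have h5 : 1 / (8 * (t + 1) : ℝ) = (1 / 8) * (1 / (t + 1)) := by field_simp
    rw [h5] at h3
    linarith

theorem tendsto_sqrt_log_four :
    Tendsto (fun n : ℕ => Nat.sqrt (Nat.log 4 n - 1)) atTop atTop := by
  refine tendsto_atTop.2 fun b => eventually_atTop.2 ⟨4 ^ (b * b + 1), fun n hn => ?_⟩
  rw [Nat.le_sqrt]
  have := Nat.le_log_of_pow_le (by norm_num) hn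
  omega

theorem eventually_primeDegrees (Λ : ℝ) {η : ℝ} (hη : 0 < η) (R₀ : ℕ) :
    ∀ᶠ n : ℕ in atTop, ∃ R, R₀ ≤ R ∧ Λ ≤ ∑ r ∈ primeDegrees R n, (1 / (2 * r) : ℝ) ∧
      (2 / R) * (1 + Real.log n) ≤ η := by
  have h1 : ∀ᶠ s : ℕ in atTop, 16 * Λ ≤ Real.log (s - 1 : ℝ) :=
    (Real.tendsto_log_atTop.comp (tendsto_atTop_add_const_right _ (-1)
      tendsto_natCast_atTop_atTop)).eventually_ge_atTop _
  have h2 : ∀ᶠ s : ℕ in atTop, 22 * ((s : ℝ) ^ 2 / 4 ^ s) < η := by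
    have := (tendsto_pow_const_div_const_pow_of_one_lt 2 (by norm_num : (1 : ℝ) < 4)).const_mul 22
    rw [mul_zero] at this
    exact this.eventually_lt_const hη
  have h3 := tendsto_sqrt_log_four.eventually
    (h1.and (h2.and ((eventually_ge_atTop 7).and (eventually_ge_atTop R₀))))
  filter_upwards [h3, eventually_ge_atTop 4] with n hn hn4
  set t := Nat.log 4 n - 1 with ht
  set s := Nat.sqrt t with hs
  obtain ⟨c1, c2, c3, c4⟩ := hn
  have hlog : 1 ≤ Nat.log 4 n := Nat.log_pos (by norm_num) hn4
  have hss : s * s ≤ t := Nat.sqrt_le t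
  have hts : t ≤ s * s + s + s := Nat.sqrt_le_add t
  have hst : s ≤ t := Nat.sqrt_le_self t
  have hn1 : 4 ^ (t + 1) ≤ n := by
    rw [ht, Nat.sub_add_cancel hlog]
    exact Nat.pow_log_le_self 4 (by omega)
  have hn2 : n < 4 ^ (t + 2) := by
    have := Nat.lt_pow_succ_log_self (b := 4) (by norm_num) n
    rwa [show t + 2 = (Nat.log 4 n).succ by omega]
  have hs7 : (7 : ℝ) ≤ s := by exact_mod_cast c3
  refine ⟨4 ^ s, c4.trans (Nat.lt_pow_self (by norm_num)).le, ?_, ?_⟩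
  · have h := log_sub_log_le_sum_prime_inv c3 hst
    have hss' : (s : ℝ) * s ≤ t := by exact_mod_cast hss
    have h5 : Real.log (s - 1 : ℝ) ≤ Real.log (t + 1) - Real.log (s + 1) := by
      rw [le_sub_iff_add_le, ← Real.log_mul (by linarith) (by linarith)]
      exact Real.log_le_log (by nlinarith) (by nlinarith)
    have h6 : (1 / 2) * ∑ p ∈ (Finset.Ioc (4 ^ s) (4 ^ t) : Finset ℕ), (if p.Prime then (1 / p : ℝ) else 0) ≤
        ∑ r ∈ primeDegrees (4 ^ s) n, (1 / (2 * r) : ℝ) := by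
      rw [Finset.mul_sum, primeDegrees, Finset.sum_filter]
      refine le_trans (Finset.sum_le_sum fun p _ => ?_) (Finset.sum_le_sum_of_subset_of_nonneg
        (f := fun p : ℕ => if p.Prime then (1 / (2 * p) : ℝ) else 0)
        (s := Finset.Ioc (4 ^ s) (4 ^ t)) ?_ fun p _ _ => ?_)
      · split_ifs
        · rw [one_div_mul_one_div]
        · simp
      · intro p hp
        rw [Finset.mem_Ioc] at hp
        rw [Finset.mem_Icc, Nat.le_div_iff_mul_le (by norm_num)]
        refine ⟨hp.1.le, ?_⟩
        rw [pow_succ] at hn1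
        omega
      · split_ifs <;> positivity
    linarith
  · have hn0 : (0 : ℝ) < n := by exact_mod_cast (by omega : 0 < n)
    have hl : Real.log n ≤ (t + 2) * 2 := by
      have h4 : Real.log 4 ≤ 2 := by
        rw [show (4 : ℝ) = 2 ^ 2 by norm_num, Real.log_pow]
        have := Real.log_two_lt_d9
        push_cast
        linarith
      have : Real.log n ≤ Real.log ((4 : ℝ) ^ (t + 2)) :=
        Real.log_le_log hn0 (by exact_mod_cast hn2.le)
      rw [Real.log_pow] at this
      push_cast at this
      refine this.trans ?_
      gcongr
    have hts' : (t : ℝ) ≤ s * s + s + s := by exact_mod_cast hts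
    refine le_trans ?_ c2.le
    push_cast
    rw [div_mul_eq_mul_div, ← mul_div_assoc]
    refine div_le_div_of_nonneg_right ?_ (by positivity)
    nlinarith

open Polynomial in
theorem eventually_matProb_not_hasIsolatedPrimeFactor_le {ε : ℝ} (hε : 0 < ε) (k₀ : ℕ) :
    ∀ᶠ n : ℕ in atTop, ∀ (F : Type) [Field F] [Fintype F],
      matProb F n (fun M => ¬ HasIsolatedPrimeFactor M.charpoly k₀) ≤ ε := by
  obtain ⟨a, ha⟩ := exists_pow_lt_of_lt_one (by positivity : 0 < ε / 32)
    (by norm_num : (1 / 2 : ℝ) < 1)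
  have ha' : (1 / 2 : ℝ) ^ (a + 1) ≤ ε / 32 :=
    (pow_le_pow_of_le_one (by norm_num) (by norm_num) (Nat.le_succ a)).trans ha.le
  filter_upwards [eventually_primeDegrees (8 / ε) (by positivity : 0 < ε / 8)
    (k₀ + 2 * (a + 1)), eventually_ge_atTop (2 * (a + 1))] with n ⟨R, hR, hΛ, hη⟩ hn
  intro F _ _
  have h1 : matProb F n (fun M => ¬ HasIsolatedPrimeFactor M.charpoly k₀) ≤
      matProb F n (fun M => ¬ HasIsolatedPrimeFactor M.charpoly R) :=
    matProb_mono fun M hM hM' => hM (hM'.mono (by omega))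
  have h2 := matProb_not_hasIsolatedPrimeFactor_le (F := F) (n := n) (J := a + 1) (a := a + 1)
    (R := R) (by omega) (by omega) hn (by omega) (by omega) (by positivity : 0 < 8 / ε) hΛ
  rw [one_div_div] at h2
  linarith

end PrimeSum

section FourierWeights

variable {F : Type*} [Field F] [Fintype F] {ι : Type*} [Fintype ι]

/-- The Fourier transform, along the line through `y`, of the law giving mass `w s` to `c s`. -/
def lawTransform (w : ι → ℝ) (c : ι → F) (y : F) (ψ : AddChar F ℂ) : ℂ :=
  ∑ s, (w s : ℂ) * ψ (c s * y)

/-- The transform of the lazy symmetrisation of the law with masses `w s` at `c s`. -/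
def lazyTransform (w : ι → ℝ) (c : ι → F) (y : F) (ψ : AddChar F ℂ) : ℝ :=
  (1 + ‖lawTransform w c y ψ‖ ^ 2) / 2

/-- The transform of the lazy symmetrised random combination of the entries of `v`. -/
def lazyProd {n : ℕ} (w : ι → ℝ) (c : ι → F) (v : Fin n → F) (ψ : AddChar F ℂ) : ℝ :=
  ∏ i, lazyTransform w c (v i) ψ

/-- The real part of the inverse Fourier transform of `B`. -/
def invTransform (B : AddChar F ℂ → ℝ) (x : F) : ℝ :=
  (∑ ψ : AddChar F ℂ, B ψ * (ψ x).re) / Fintype.card F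

/-- The probability that a lazy symmetrised random combination of the entries of `v` vanishes. -/
def returnProb {n : ℕ} (w : ι → ℝ) (c : ι → F) (v : Fin n → F) : ℝ :=
  invTransform (lazyProd w c v) 0

/-- The probability that a random combination of the entries of `v` equals `a`. -/
def combProb {n : ℕ} (w : ι → ℝ) (c : ι → F) (v : Fin n → F) (a : F) : ℝ :=
  ∑ r : Fin n → ι, if ∑ j, c (r j) * v j = a then ∏ j, w (r j) else 0

theorem card_field_pos_real : (0 : ℝ) < Fintype.card F := by
  exact_mod_cast Fintype.card_pos

theorem addChar_re_le_one (ψ : AddChar F ℂ) (x : F) : (ψ x).re ≤ 1 :=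
  (Complex.re_le_norm _).trans (AddChar.norm_apply ψ x).le

omit [Fintype F] in
theorem addChar_map_sum (ψ : AddChar F ℂ) {α : Type*} (s : Finset α) (f : α → F) :
    ψ (∑ i ∈ s, f i) = ∏ i ∈ s, ψ (f i) :=
  map_prod ψ.toMonoidHom (fun i => Multiplicative.ofAdd (f i)) s

theorem invTransform_le_zero {B : AddChar F ℂ → ℝ} (hB : ∀ ψ, 0 ≤ B ψ) (x : F) :
    invTransform B x ≤ invTransform B 0 := by
  unfold invTransform
  refine div_le_div_of_nonneg_right (Finset.sum_le_sum fun ψ _ => ?_) (Nat.cast_nonneg _)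
  rw [AddChar.map_zero_eq_one]
  exact mul_le_mul_of_nonneg_left (addChar_re_le_one ψ x) (hB ψ)

theorem one_sub_re_mul_le {z w : ℂ} (hz : ‖z‖ = 1) (hw : ‖w‖ = 1) {k a b : ℝ}
    (hk : 1 ≤ k) (hz' : 1 - z.re ≤ k * a) (hw' : 1 - w.re ≤ b) :
    1 - (z * w).re ≤ (k + 1) * (a + b) := by
  have h1 : z.re ^ 2 + z.im ^ 2 = 1 := by
    have := Complex.sq_norm z
    rw [hz, Complex.normSq_apply] at this
    nlinarith
  have h2 : w.re ^ 2 + w.im ^ 2 = 1 := by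
    have := Complex.sq_norm w
    rw [hw, Complex.normSq_apply] at this
    nlinarith
  rw [Complex.mul_re]
  have h3 : z.re ≤ 1 := by nlinarith [sq_nonneg z.im, sq_nonneg (z.re - 1)]
  have h4 : w.re ≤ 1 := by nlinarith [sq_nonneg w.im, sq_nonneg (w.re - 1)]
  have hzl : -1 ≤ z.re := by nlinarith [sq_nonneg z.im, sq_nonneg (z.re + 1)]
  have hwl : -1 ≤ w.re := by nlinarith [sq_nonneg w.im, sq_nonneg (w.re + 1)]
  have hk0 : 0 < k := by linarith
  have key : 1 - (z.re * w.re - z.im * w.im) ≤ (1 + 1 / k) * (1 - z.re) + (1 + k) * (1 - w.re) := by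
    have e : 1 - z.re * w.re ≤ (1 - z.re) + (1 - w.re) - (1 - z.re) * (1 - w.re) := by nlinarith
    have f : 2 * (z.im * w.im) ≤ (1 / k) * z.im ^ 2 + k * w.im ^ 2 := by
      have : (1 / k) * z.im ^ 2 + k * w.im ^ 2 - 2 * (z.im * w.im) = (1 / k) * (z.im - k * w.im) ^ 2 := by
        field_simp
        ring
      have : 0 ≤ (1 / k) * (z.im - k * w.im) ^ 2 := by positivity
      linarith
    have hzi : z.im ^ 2 = (1 - z.re) * (1 + z.re) := by nlinarith
    have hwi : w.im ^ 2 = (1 - w.re) * (1 + w.re) := by nlinarith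
    have g1 : (1 / k) * z.im ^ 2 ≤ (1 / k) * (2 * (1 - z.re)) := by
      gcongr
      nlinarith
    have g2 : k * w.im ^ 2 ≤ k * (2 * (1 - w.re)) := by
      gcongr
      nlinarith
    nlinarith [mul_nonneg (sub_nonneg.2 h3) (sub_nonneg.2 h4)]
  have h5 : (1 + 1 / k) * (1 - z.re) ≤ (k + 1) * a := by
    calc (1 + 1 / k) * (1 - z.re) ≤ (1 + 1 / k) * (k * a) := by gcongr
      _ = (k + 1) * a := by field_simp
  have h6 : (1 + k) * (1 - w.re) ≤ (k + 1) * b := by nlinarith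
  linarith

/-- Subadditivity up to the factor `k` of `1 - Re` on products of `k` unimodular numbers. -/
theorem one_sub_re_prod_le {k : ℕ} (z : Fin k → ℂ) (hz : ∀ i, ‖z i‖ = 1) :
    1 - (∏ i, z i).re ≤ k * ∑ i, (1 - (z i).re) := by
  have hnn : ∀ i, 0 ≤ 1 - (z i).re := fun i => by
    linarith [(Complex.re_le_norm (z i)).trans (hz i).le]
  induction k with
  | zero => simp
  | succ k ih =>
    rcases Nat.eq_zero_or_pos k with rfl | hk
    · simp
    rw [Fin.prod_univ_castSucc, Fin.sum_univ_castSucc]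
    push_cast
    refine one_sub_re_mul_le (by simp [hz]) (hz _) (by exact_mod_cast hk)
      (ih _ (fun i => hz _) fun i => hnn _) le_rfl

theorem invTransform_zero_sub_sum_le {B : AddChar F ℂ → ℝ} (hB : ∀ ψ, 0 ≤ B ψ) {k : ℕ}
    (x : Fin k → F) : invTransform B 0 - invTransform B (∑ i, x i) ≤
      k * ∑ i, (invTransform B 0 - invTransform B (x i)) := by
  have e : ∀ y : F, invTransform B 0 - invTransform B y =
      (∑ ψ : AddChar F ℂ, B ψ * (1 - (ψ y).re)) / Fintype.card F := fun y => by
    unfold invTransform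
    rw [← sub_div, ← Finset.sum_sub_distrib]
    simp [mul_sub]
  simp only [e]
  rw [← Finset.sum_div, Finset.sum_comm, mul_div_assoc', Finset.mul_sum]
  refine div_le_div_of_nonneg_right (Finset.sum_le_sum fun ψ _ => ?_) (Nat.cast_nonneg _)
  rw [← Finset.mul_sum, mul_left_comm]
  refine mul_le_mul_of_nonneg_left ?_ (hB ψ)
  have := one_sub_re_prod_le (fun i => ψ (x i)) fun i => AddChar.norm_apply ψ _
  rwa [← addChar_map_sum] at this

theorem sum_invTransform (B : AddChar F ℂ → ℝ) : ∑ x, invTransform B x = B 0 := by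
  unfold invTransform
  rw [← Finset.sum_div, Finset.sum_comm]
  have : ∀ ψ : AddChar F ℂ, ∑ x, B ψ * (ψ x).re = if ψ = 0 then B ψ * Fintype.card F else 0 :=
    fun ψ => by
    rw [← Finset.mul_sum, ← Complex.re_sum, AddChar.sum_eq_ite]
    split_ifs <;> simp
  rw [Finset.sum_congr rfl fun ψ _ => this ψ, Finset.sum_ite_eq' Finset.univ (0 : AddChar F ℂ)]
  simp [card_field_pos_real.ne']

variable {w : ι → ℝ} {c : ι → F}

omit [Fintype F] in
theorem lazyTransform_nonneg (y : F) (ψ : AddChar F ℂ) : 0 ≤ lazyTransform w c y ψ := by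
  unfold lazyTransform
  positivity

omit [Fintype F] in
theorem lazyProd_nonneg {n : ℕ} (v : Fin n → F) (ψ : AddChar F ℂ) : 0 ≤ lazyProd w c v ψ :=
  Finset.prod_nonneg fun _ _ => lazyTransform_nonneg _ _

theorem norm_lawTransform_le (hw : ∀ s, 0 ≤ w s) (hw1 : ∑ s, w s = 1) (y : F)
    (ψ : AddChar F ℂ) : ‖lawTransform w c y ψ‖ ≤ 1 := by
  rw [← hw1]
  refine norm_sum_le_of_le _ fun s _ => ?_
  rw [norm_mul, AddChar.norm_apply]
  simp [abs_of_nonneg (hw s)]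

theorem lazyTransform_le_one (hw : ∀ s, 0 ≤ w s) (hw1 : ∑ s, w s = 1) (y : F)
    (ψ : AddChar F ℂ) : lazyTransform w c y ψ ≤ 1 := by
  unfold lazyTransform
  have := norm_lawTransform_le (c := c) hw hw1 y ψ
  nlinarith [norm_nonneg (lawTransform w c y ψ)]

omit [Fintype F] in
theorem lazyTransform_zero (hw1 : ∑ s, w s = 1) (y : F) :
    lazyTransform w c y 0 = 1 := by
  unfold lazyTransform lawTransform
  simp only [AddChar.zero_apply, mul_one, ← Complex.ofReal_sum, hw1]
  simp

theorem sq_norm_lawTransform (y : F) (ψ : AddChar F ℂ) :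
    ((‖lawTransform w c y ψ‖ ^ 2 : ℝ) : ℂ) =
      ∑ s, ∑ t, ((w s * w t : ℝ) : ℂ) * ψ ((c s - c t) * y) := by
  rw [Complex.ofReal_pow, ← Complex.mul_conj']
  unfold lawTransform
  rw [map_sum, Finset.sum_mul_sum]
  refine Finset.sum_congr rfl fun s _ => Finset.sum_congr rfl fun t _ => ?_
  rw [map_mul (starRingEnd ℂ), Complex.conj_ofReal, ← AddChar.inv_apply_eq_conj, ← AddChar.map_neg_eq_inv, sub_mul,
    sub_eq_add_neg, AddChar.map_add_eq_mul]
  push_cast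
  ring

theorem invTransform_lazy_mul (B : AddChar F ℂ → ℝ) (x y : F) :
    invTransform (fun ψ => lazyTransform w c y ψ * B ψ) x =
      (invTransform B x +
        ∑ s, ∑ t, w s * w t * invTransform B (x + (c s - c t) * y)) / 2 := by
  unfold invTransform
  have h : ∀ ψ : AddChar F ℂ, ‖lawTransform w c y ψ‖ ^ 2 * (ψ x).re =
      ∑ s, ∑ t, w s * w t * (ψ (x + (c s - c t) * y)).re := fun ψ => by
    have e : ((‖lawTransform w c y ψ‖ ^ 2 : ℝ) : ℂ) * ψ x =
        ∑ s, ∑ t, ((w s * w t : ℝ) : ℂ) * ψ (x + (c s - c t) * y) := by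
      rw [sq_norm_lawTransform, Finset.sum_mul]
      refine Finset.sum_congr rfl fun s _ => ?_
      rw [Finset.sum_mul]
      refine Finset.sum_congr rfl fun t _ => ?_
      rw [AddChar.map_add_eq_mul]
      ring
    have := congrArg Complex.re e
    rw [Complex.re_ofReal_mul, Complex.re_sum] at this
    simp only [Complex.re_sum, Complex.re_ofReal_mul] at this
    exact this
  have h2 : ∀ ψ : AddChar F ℂ, lazyTransform w c y ψ * B ψ * (ψ x).re =
      (B ψ * (ψ x).re + ∑ s, ∑ t, w s * w t * (B ψ * (ψ (x + (c s - c t) * y)).re)) / 2 :=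
    fun ψ => by
    have h3 : ∑ s, ∑ t, w s * w t * (B ψ * (ψ (x + (c s - c t) * y)).re) =
        B ψ * ∑ s, ∑ t, w s * w t * (ψ (x + (c s - c t) * y)).re := by
      simp only [Finset.mul_sum]
      refine Finset.sum_congr rfl fun s _ => Finset.sum_congr rfl fun t _ => by ring
    rw [h3, ← h ψ]
    unfold lazyTransform
    ring
  rw [Finset.sum_congr rfl fun ψ _ => h2 ψ, ← Finset.sum_div, Finset.sum_add_distrib,
    Finset.sum_comm, Finset.sum_congr rfl fun s _ => Finset.sum_comm]
  simp only [← Finset.mul_sum, mul_div_assoc', ← Finset.sum_div]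
  ring

theorem invTransform_one (x : F) :
    invTransform (fun _ => 1) x = if x = 0 then 1 else 0 := by
  unfold invTransform
  simp only [one_mul]
  rw [← Complex.re_sum, AddChar.sum_apply_eq_ite]
  split_ifs <;> simp [card_field_pos_real.ne']

omit [Fintype F] in
theorem lazyProd_cons {n : ℕ} (y : F) (v : Fin n → F) :
    lazyProd w c (Fin.cons y v : Fin (n + 1) → F) =
      fun ψ => lazyTransform w c y ψ * lazyProd w c v ψ := by
  funext ψ
  simp [lazyProd, Fin.prod_univ_succ]

theorem invTransform_lazyProd_nonneg (hw : ∀ s, 0 ≤ w s) {n : ℕ} (v : Fin n → F) (x : F) :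
    0 ≤ invTransform (lazyProd w c v) x := by
  induction n generalizing x with
  | zero =>
    have : lazyProd w c v = fun _ => 1 := by funext ψ; simp [lazyProd]
    rw [this, invTransform_one]
    split_ifs <;> norm_num
  | succ n ih =>
    rw [← Fin.cons_self_tail v, lazyProd_cons, invTransform_lazy_mul]
    have : 0 ≤ ∑ s, ∑ t, w s * w t *
        invTransform (lazyProd w c (Fin.tail v)) (x + (c s - c t) * v 0) :=
      Finset.sum_nonneg fun s _ => Finset.sum_nonneg fun t _ =>
        mul_nonneg (mul_nonneg (hw s) (hw t)) (ih _ _)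
    have := ih (Fin.tail v) x
    linarith

theorem sum_invTransform_lazyProd (hw1 : ∑ s, w s = 1) {n : ℕ} (v : Fin n → F) :
    ∑ x, invTransform (lazyProd w c v) x = 1 := by
  rw [sum_invTransform]
  simp [lazyProd, lazyTransform_zero hw1]

theorem returnProb_cons_le (hw : ∀ s, 0 ≤ w s) (hw1 : ∑ s, w s = 1) {n : ℕ} (y : F)
    (v : Fin n → F) : returnProb w c (Fin.cons y v : Fin (n + 1) → F) ≤ returnProb w c v := by
  unfold returnProb
  rw [lazyProd_cons]
  unfold invTransform
  gcongr with ψ _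
  · simp
  · exact mul_le_of_le_one_left (lazyProd_nonneg _ _) (lazyTransform_le_one hw hw1 _ _)

theorem returnProb_nonneg (hw : ∀ s, 0 ≤ w s) {n : ℕ} (v : Fin n → F) : 0 ≤ returnProb w c v :=
  invTransform_lazyProd_nonneg hw v 0

theorem returnProb_cons_add_le (hw : ∀ s, 0 ≤ w s) (hw1 : ∑ s, w s = 1) {n : ℕ} (y : F)
    (v : Fin n → F) (s₀ t₀ : ι) :
    returnProb w c (Fin.cons y v : Fin (n + 1) → F) +
      w s₀ * w t₀ / 2 * (returnProb w c v -
        invTransform (lazyProd w c v) ((c s₀ - c t₀) * y)) ≤ returnProb w c v := by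
  unfold returnProb
  rw [lazyProd_cons, invTransform_lazy_mul]
  set W := invTransform (lazyProd w c v)
  have h1 : ∑ s, ∑ t, w s * w t * (W 0 - W (0 + (c s - c t) * y)) =
      W 0 - ∑ s, ∑ t, w s * w t * W (0 + (c s - c t) * y) := by
    simp only [mul_sub, Finset.sum_sub_distrib]
    simp only [← Finset.sum_mul, ← Finset.mul_sum, hw1, mul_one, one_mul]
  have h2 : w s₀ * w t₀ * (W 0 - W (0 + (c s₀ - c t₀) * y)) ≤
      ∑ s, ∑ t, w s * w t * (W 0 - W (0 + (c s - c t) * y)) := by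
    have hnn : ∀ s t, 0 ≤ w s * w t * (W 0 - W (0 + (c s - c t) * y)) := fun s t =>
      mul_nonneg (mul_nonneg (hw s) (hw t))
        (sub_nonneg.2 (invTransform_le_zero (lazyProd_nonneg v) _))
    refine le_trans ?_ (Finset.single_le_sum
      (f := fun s => ∑ t, w s * w t * (W 0 - W (0 + (c s - c t) * y)))
      (fun s _ => Finset.sum_nonneg fun t _ => hnn s t) (Finset.mem_univ s₀))
    exact Finset.single_le_sum
      (f := fun t => w s₀ * w t * (W 0 - W (0 + (c s₀ - c t) * y)))
      (fun t _ => hnn s₀ t) (Finset.mem_univ t₀)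
  rw [zero_add] at h2
  linarith

theorem returnProb_le_of_ne_zero (hw : ∀ s, 0 ≤ w s) (hw1 : ∑ s, w s = 1) {s₀ t₀ : ι}
    (hst : c s₀ ≠ c t₀) {n : ℕ} {v : Fin n → F} (hv : v ≠ 0) :
    returnProb w c v ≤ 1 - w s₀ * w t₀ / 2 := by
  obtain ⟨i, hi⟩ := Function.ne_iff.1 hv
  have h0 : returnProb w c (![] : Fin 0 → F) = 1 := by
    have : lazyProd w c (![] : Fin 0 → F) = fun _ => 1 := by funext ψ; simp [lazyProd]
    simp [returnProb, this, invTransform_one]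
  have h1 : returnProb w c v ≤ returnProb w c (Fin.cons (v i) ![] : Fin 1 → F) := by
    unfold returnProb
    rw [lazyProd_cons]
    unfold invTransform
    gcongr with ψ _
    · simp
    · unfold lazyProd
      rw [← Finset.mul_prod_erase _ _ (Finset.mem_univ i)]
      simp only [Finset.univ_eq_empty, Finset.prod_empty]
      gcongr
      · exact lazyTransform_nonneg _ _
      · exact Finset.prod_le_one (fun _ _ => lazyTransform_nonneg _ _)
          fun _ _ => lazyTransform_le_one hw hw1 _ _
  have h2 := returnProb_cons_add_le hw hw1 (v i) (![] : Fin 0 → F) s₀ t₀ (c := c)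
  have h3 : invTransform (lazyProd w c (![] : Fin 0 → F)) ((c s₀ - c t₀) * v i) = 0 := by
    have : lazyProd w c (![] : Fin 0 → F) = fun _ => 1 := by funext ψ; simp [lazyProd]
    rw [this, invTransform_one, if_neg]
    exact mul_ne_zero (sub_ne_zero.2 hst) hi
  rw [h0, h3] at h2
  linarith

theorem combProb_eq {n : ℕ} (v : Fin n → F) (a : F) :
    ((combProb w c v a : ℝ) : ℂ) =
      (∑ ψ : AddChar F ℂ, ψ (-a) * ∏ j, lawTransform w c (v j) ψ) / Fintype.card F := by
  have h : ∀ ψ : AddChar F ℂ, ψ (-a) * ∏ j, lawTransform w c (v j) ψ =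
      ∑ r : Fin n → ι, ((∏ j, w (r j) : ℝ) : ℂ) * ψ (∑ j, c (r j) * v j - a) := fun ψ => by
    unfold lawTransform
    rw [Finset.prod_univ_sum, Fintype.piFinset_univ, Finset.mul_sum]
    refine Finset.sum_congr rfl fun r _ => ?_
    rw [Finset.prod_mul_distrib, sub_eq_add_neg, AddChar.map_add_eq_mul, addChar_map_sum]
    push_cast
    ring
  rw [Finset.sum_congr rfl fun ψ _ => h ψ, Finset.sum_comm]
  simp only [← Finset.mul_sum, AddChar.sum_apply_eq_ite, sub_eq_zero]
  rw [Finset.sum_div]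
  unfold combProb
  rw [Complex.ofReal_sum]
  refine Finset.sum_congr rfl fun r _ => ?_
  have : (Fintype.card F : ℂ) ≠ 0 := by exact_mod_cast Fintype.card_ne_zero
  split_ifs with h
  · field_simp
  · simp

theorem combProb_le {n : ℕ} (v : Fin n → F) (a : F) : combProb w c v a ≤ returnProb w c v := by
  have h1 : combProb w c v a ≤ ‖((combProb w c v a : ℝ) : ℂ)‖ := by
    rw [Complex.norm_real]
    exact le_abs_self _
  refine h1.trans ?_
  rw [combProb_eq, norm_div, Complex.norm_natCast]
  unfold returnProb invTransform
  gcongr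
  refine norm_sum_le_of_le _ fun ψ _ => ?_
  rw [norm_mul, AddChar.norm_apply, one_mul, norm_prod, AddChar.map_zero_eq_one, Complex.one_re,
    mul_one]
  refine Finset.prod_le_prod (fun _ _ => norm_nonneg _) fun j _ => ?_
  unfold lazyTransform
  nlinarith [sq_nonneg (‖lawTransform w c (v j) ψ‖ - 1)]

end FourierWeights

section PopularDifferences

open scoped Pointwise

variable {F : Type*} [Field F] [Fintype F]

omit [Fintype F] in
theorem charP_le_minOrder (ℓ : ℕ) [CharP F ℓ] (hℓ : ℓ.Prime) :
    (ℓ : ℕ∞) ≤ AddMonoid.minOrder F := by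
  rw [AddMonoid.le_minOrder]
  intro a ha _
  have h : addOrderOf a = ℓ := by
    have := Fact.mk hℓ
    refine addOrderOf_eq_prime ?_ ha
    simp [nsmul_eq_mul]
  rw [h]

omit [Fintype F] in
/-- The iterated Cauchy–Davenport inequality. -/
theorem exists_finset_sums_card_ge (ℓ : ℕ) [CharP F ℓ] (hℓ : ℓ.Prime) {S : Finset F}
    (hS : S.Nonempty) (k : ℕ) : ∃ T : Finset F, T.Nonempty ∧
      (ℓ ≤ T.card ∨ k * (S.card - 1) + 1 ≤ T.card) ∧
      ∀ t ∈ T, ∃ x : Fin k → F, (∀ i, x i ∈ S) ∧ ∑ i, x i = t := by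
  induction k with
  | zero => exact ⟨{0}, by simp, by simp, by simp⟩
  | succ k ih =>
    obtain ⟨T, hTne, hT, hTx⟩ := ih
    refine ⟨T + S, hTne.add hS, ?_, ?_⟩
    · have h1 := cauchy_davenport_minOrder_add hTne hS
      have h2 := (min_le_min_right ((T.card + S.card - 1 : ℕ) : ℕ∞)
        (charP_le_minOrder (F := F) ℓ hℓ)).trans h1
      have h3 : min ℓ (T.card + S.card - 1) ≤ (T + S).card :=
        min_le_iff.2 ((min_le_iff.1 h2).imp (fun h => by exact_mod_cast h)
          fun h => by exact_mod_cast h)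
      have h4 := hS.card_pos
      rcases hT with hT | hT
      · left
        omega
      · rcases le_total ℓ (T.card + S.card - 1) with h | h
        · left
          omega
        · right
          rw [min_eq_right h] at h3
          have : (k + 1) * (S.card - 1) = k * (S.card - 1) + (S.card - 1) := by ring
          omega
    · intro t ht
      obtain ⟨a, ha, b, hb, rfl⟩ := Finset.mem_add.1 ht
      obtain ⟨x, hx, rfl⟩ := hTx a ha
      refine ⟨Fin.snoc x b, fun i => ?_, ?_⟩
      · refine Fin.lastCases ?_ (fun j => ?_) i
        · simpa using hb
        · simpa using hx j
      · simp [Fin.sum_univ_castSucc]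

/-- Only few values of a function with nonnegative transform are close to the maximum. -/
theorem mul_card_invTransform_ge_le (ℓ : ℕ) [CharP F ℓ] (hℓ : ℓ.Prime) {B : AddChar F ℂ → ℝ}
    (hB : ∀ ψ, 0 ≤ B ψ) (hW : ∀ x, 0 ≤ invTransform B x) (hW1 : ∑ x, invTransform B x = 1)
    {k : ℕ} {θ : ℝ} (hθ0 : 0 ≤ θ) (hθ : (k : ℝ) ^ 2 * θ ≤ 1 / 2)
    (h0 : 3 / (ℓ : ℝ) ≤ invTransform B 0) :
    (k : ℝ) * (Finset.univ.filter fun x => (1 - θ) * invTransform B 0 ≤ invTransform B x).card ≤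
      k + 2 / invTransform B 0 := by
  set S := Finset.univ.filter fun x => (1 - θ) * invTransform B 0 ≤ invTransform B x
  have hℓ0 : (0 : ℝ) < ℓ := by exact_mod_cast hℓ.pos
  have hW0 : 0 < invTransform B 0 := lt_of_lt_of_le (by positivity) h0
  have hS : S.Nonempty := ⟨0, by simp [S]; nlinarith⟩
  obtain ⟨T, -, hT, hTx⟩ := exists_finset_sums_card_ge ℓ hℓ hS k
  have h1 : ∀ t ∈ T, invTransform B 0 / 2 ≤ invTransform B t := by
    intro t ht
    obtain ⟨x, hx, rfl⟩ := hTx t ht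
    have h2 := invTransform_zero_sub_sum_le hB x
    have h3 : ∑ i, (invTransform B 0 - invTransform B (x i)) ≤
        ∑ _i : Fin k, θ * invTransform B 0 := by
      refine Finset.sum_le_sum fun i _ => ?_
      have := (Finset.mem_filter.1 (hx i)).2
      linarith
    rw [Finset.sum_const, Finset.card_univ, Fintype.card_fin, nsmul_eq_mul] at h3
    have h4 := mul_le_mul_of_nonneg_left h3 (Nat.cast_nonneg (α := ℝ) k)
    have h5 := mul_le_mul_of_nonneg_right hθ hW0.le
    nlinarith
  have h2 : T.card * (invTransform B 0 / 2) ≤ 1 := by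
    rw [← hW1, ← nsmul_eq_mul]
    exact (Finset.card_nsmul_le_sum _ _ _ h1).trans
      (Finset.sum_le_univ_sum_of_nonneg hW)
  have h3 : (T.card : ℝ) ≤ 2 / invTransform B 0 := by
    rw [le_div_iff₀ hW0]
    linarith
  rcases hT with hT | hT
  · exfalso
    have h4 : (ℓ : ℝ) ≤ T.card := by exact_mod_cast hT
    rw [div_le_iff₀ hℓ0] at h0
    nlinarith
  · have h4 : ((k * (S.card - 1) + 1 : ℕ) : ℝ) ≤ T.card := by exact_mod_cast hT
    push_cast [Nat.cast_sub hS.card_pos] at h4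
    nlinarith

variable {ι : Type*} [Fintype ι] {w : ι → ℝ} {c : ι → F}

theorem card_returnProb_cons_ge_le (ℓ : ℕ) [CharP F ℓ] (hℓ : ℓ.Prime) (hw : ∀ s, 0 ≤ w s)
    (hw1 : ∑ s, w s = 1) {s₀ t₀ : ι} (hs₀ : 0 < w s₀) (ht₀ : 0 < w t₀) (hst : c s₀ ≠ c t₀)
    {k : ℕ} (hk : 0 < k) {η : ℝ} (hη0 : 0 ≤ η) (hη : (k : ℝ) ^ 2 * (2 * η / (w s₀ * w t₀)) ≤ 1 / 2)
    {n : ℕ} (v : Fin n → F) (hv : 3 / (ℓ : ℝ) ≤ returnProb w c v) :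
    ((Finset.univ.filter fun y => (1 - η) * returnProb w c v <
      returnProb w c (Fin.cons y v : Fin (n + 1) → F)).card : ℝ) ≤
        1 + 2 / (k * returnProb w c v) := by
  have hd : c s₀ - c t₀ ≠ 0 := sub_ne_zero.2 hst
  have h1 := mul_card_invTransform_ge_le ℓ hℓ (lazyProd_nonneg v)
    (invTransform_lazyProd_nonneg hw v) (sum_invTransform_lazyProd hw1 v)
    (θ := 2 * η / (w s₀ * w t₀)) (by positivity) hη hv
  have h2 : (Finset.univ.filter fun y => (1 - η) * returnProb w c v <
      returnProb w c (Fin.cons y v : Fin (n + 1) → F)).card ≤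
      (Finset.univ.filter fun x => (1 - 2 * η / (w s₀ * w t₀)) *
        invTransform (lazyProd w c v) 0 ≤ invTransform (lazyProd w c v) x).card := by
    refine Finset.card_le_card_of_injOn (fun y => (c s₀ - c t₀) * y) (fun y hy => ?_)
      (fun a _ b _ h => mul_left_cancel₀ hd h)
    have hy := (Finset.mem_filter.1 (Finset.mem_coe.1 hy)).2
    refine Finset.mem_coe.2 (Finset.mem_filter.2 ⟨Finset.mem_univ _, ?_⟩)
    have h3 := returnProb_cons_add_le hw hw1 y v s₀ t₀ (c := c)
    change _ ≤ _
    change (1 - _) * returnProb w c v ≤ _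
    have h4 : w s₀ * w t₀ / 2 * (returnProb w c v -
        invTransform (lazyProd w c v) ((c s₀ - c t₀) * y)) ≤ η * returnProb w c v := by
      linarith
    have h5 : returnProb w c v - invTransform (lazyProd w c v) ((c s₀ - c t₀) * y) ≤
        2 * η / (w s₀ * w t₀) * returnProb w c v := by
      rw [div_mul_eq_mul_div, le_div_iff₀ (by positivity)]
      linarith
    linarith
  have hk' : (0 : ℝ) < k := by exact_mod_cast hk
  have h3 : (k : ℝ) * (Finset.univ.filter fun y => (1 - η) * returnProb w c v <
      returnProb w c (Fin.cons y v : Fin (n + 1) → F)).card ≤ k + 2 / returnProb w c v :=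
    le_trans (by gcongr) h1
  rw [← mul_le_mul_iff_right₀ hk']
  refine h3.trans_eq ?_
  rw [mul_add, mul_one, ← div_div]
  congr 1
  have hω : returnProb w c v ≠ 0 := by
    have : (0 : ℝ) < ℓ := by exact_mod_cast hℓ.pos
    exact (lt_of_lt_of_le (by positivity) hv).ne'
  field_simp

end PopularDifferences

section Potential

variable {F : Type*} [Field F] [Fintype F] {ι : Type*} [Fintype ι]

/-- The weighted count of vectors with return probability at least `T`. -/
def returnPotential (w : ι → ℝ) (c : ι → F) (T c₀ : ℝ) (κ m : ℕ) : ℝ :=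
  ∑ v : Fin m → F, if T ≤ returnProb w c v then
    min (returnProb w c v) c₀ ^ m * returnProb w c v ^ κ else 0

variable {w : ι → ℝ} {c : ι → F}

theorem returnPotential_succ_le (ℓ : ℕ) [CharP F ℓ] (hℓ : ℓ.Prime) (hw : ∀ s, 0 ≤ w s)
    (hw1 : ∑ s, w s = 1) {s₀ t₀ : ι} (hs₀ : 0 < w s₀) (ht₀ : 0 < w t₀) (hst : c s₀ ≠ c t₀)
    {k : ℕ} (hk : 0 < k) {η : ℝ} (hη0 : 0 ≤ η) (hη : (k : ℝ) ^ 2 * (2 * η / (w s₀ * w t₀)) ≤ 1 / 2)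
    (hη1 : η ≤ 1) {c₀ : ℝ} (hc₀ : 0 ≤ c₀) (hc₁ : c₀ ≤ 1) (κ m : ℕ) :
    returnPotential w c (3 / ℓ) c₀ κ (m + 1) ≤
      (c₀ + 2 / k + Fintype.card F * (1 - η) ^ κ) * returnPotential w c (3 / ℓ) c₀ κ m := by
  unfold returnPotential
  rw [← (Fin.consEquiv fun _ : Fin (m + 1) => F).sum_comp, Fintype.sum_prod_type, Finset.sum_comm,
    Finset.mul_sum]
  refine Finset.sum_le_sum fun v _ => ?_
  have hk' : (0 : ℝ) < k := by exact_mod_cast hk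
  have hℓ' : (0 : ℝ) < ℓ := by exact_mod_cast hℓ.pos
  have hcons : ∀ y, (Fin.consEquiv fun _ : Fin (m + 1) => F) (y, v) =
      (Fin.cons y v : Fin (m + 1) → F) := fun y => rfl
  simp only [hcons]
  have hle := fun y => returnProb_cons_le hw hw1 y v (c := c)
  split_ifs with hv
  swap
  · rw [mul_zero]
    refine (Finset.sum_eq_zero fun y _ => if_neg fun h => hv (h.trans (hle y))).le
  set ω := returnProb w c v
  have hω0 : 0 < ω := lt_of_lt_of_le (by positivity) hv
  set A : ℝ := min ω c₀ ^ m * ω ^ κ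
  have hmin0 : 0 ≤ min ω c₀ := le_min hω0.le hc₀
  have hA : 0 ≤ A := by positivity
  have hη1' : 0 ≤ 1 - η := by linarith
  have hterm : ∀ y, (if 3 / (ℓ : ℝ) ≤ returnProb w c (Fin.cons y v : Fin (m + 1) → F) then
      min (returnProb w c (Fin.cons y v : Fin (m + 1) → F)) c₀ ^ (m + 1) *
        returnProb w c (Fin.cons y v : Fin (m + 1) → F) ^ κ else 0) ≤
      (if (1 - η) * ω < returnProb w c (Fin.cons y v : Fin (m + 1) → F) then min ω c₀ * A else 0) +
        (1 - η) ^ κ * A := by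
    intro y
    have hy0 := returnProb_nonneg hw (Fin.cons y v : Fin (m + 1) → F) (c := c)
    have hy := hle y
    set ρ := returnProb w c (Fin.cons y v : Fin (m + 1) → F)
    have hρmin : 0 ≤ min ρ c₀ := le_min hy0 hc₀
    have hmm : min ρ c₀ ≤ min ω c₀ := min_le_min_right _ hy
    have hR : 0 ≤ (1 - η) ^ κ * A := by positivity
    split_ifs with h1 h2 h2
    · have : min ρ c₀ ^ (m + 1) * ρ ^ κ ≤ min ω c₀ ^ (m + 1) * ω ^ κ := by gcongr
      have e : min ω c₀ * A = min ω c₀ ^ (m + 1) * ω ^ κ := by simp only [A]; ring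
      linarith
    · have h3 : ρ ^ κ ≤ ((1 - η) * ω) ^ κ := by
        gcongr
        exact not_lt.1 h2
      have h4 : min ρ c₀ ^ (m + 1) ≤ min ω c₀ ^ m := by
        rw [pow_succ]
        calc min ρ c₀ ^ m * min ρ c₀ ≤ min ω c₀ ^ m * 1 := by
              gcongr
              exact (min_le_right _ _).trans hc₁
          _ = _ := mul_one _
      rw [zero_add]
      calc min ρ c₀ ^ (m + 1) * ρ ^ κ ≤ min ω c₀ ^ m * ((1 - η) * ω) ^ κ := by gcongr
        _ = (1 - η) ^ κ * A := by simp only [A, mul_pow]; ring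
    · positivity
    · positivity
  refine (Finset.sum_le_sum fun y _ => hterm y).trans ?_
  rw [Finset.sum_add_distrib, ← Finset.sum_filter, Finset.sum_const, Finset.sum_const,
    nsmul_eq_mul, nsmul_eq_mul, Finset.card_univ]
  have hgood := card_returnProb_cons_ge_le ℓ hℓ hw hw1 hs₀ ht₀ hst hk hη0 hη v hv
  have h5 : (1 + 2 / (k * ω)) * min ω c₀ ≤ c₀ + 2 / k := by
    have h6 : 2 / (k * ω) * min ω c₀ ≤ 2 / k := by
      calc 2 / (k * ω) * min ω c₀ ≤ 2 / (k * ω) * ω := by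
            gcongr
            exact min_le_left _ _
        _ = 2 / k := by field_simp
    have := min_le_right ω c₀
    linarith
  have h7 := mul_le_mul_of_nonneg_right hgood (mul_nonneg hmin0 hA)
  have h8 := mul_le_mul_of_nonneg_right h5 hA
  linarith

theorem sum_returnProb_pow_le (ℓ : ℕ) [CharP F ℓ] (hℓ : ℓ.Prime) (hw : ∀ s, 0 ≤ w s)
    (hw1 : ∑ s, w s = 1) {s₀ t₀ : ι} (hs₀ : 0 < w s₀) (ht₀ : 0 < w t₀) (hst : c s₀ ≠ c t₀)
    {k : ℕ} (hk : 0 < k) {η : ℝ} (hη0 : 0 ≤ η) (hη : (k : ℝ) ^ 2 * (2 * η / (w s₀ * w t₀)) ≤ 1 / 2)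
    (hη1 : η ≤ 1) (κ n : ℕ) :
    (∑ v : Fin (n + 1) → F, if v ≠ 0 ∧ 3 / (ℓ : ℝ) ≤ returnProb w c v then
      returnProb w c v ^ n else 0) ≤ (ℓ / 3) ^ (κ + 1) *
        (1 - w s₀ * w t₀ / 2 + 2 / k + Fintype.card F * (1 - η) ^ κ) ^ (n + 1) := by
  have hws : ∀ s, w s ≤ 1 := fun s => by
    rw [← hw1]
    exact Finset.single_le_sum (fun s _ => hw s) (Finset.mem_univ s)
  set c₀ : ℝ := 1 - w s₀ * w t₀ / 2 with hc₀
  have hc00 : 0 ≤ c₀ := by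
    have := mul_le_one₀ (hws s₀) (hw t₀) (hws t₀)
    rw [hc₀]
    linarith
  have hc01 : c₀ ≤ 1 := by
    have := mul_nonneg (hw s₀) (hw t₀)
    rw [hc₀]
    linarith
  have hη1' : 0 ≤ 1 - η := by linarith
  set c₁ : ℝ := c₀ + 2 / k + Fintype.card F * (1 - η) ^ κ
  have hc1 : 0 ≤ c₁ := by positivity
  have hpot : ∀ m, returnPotential w c (3 / ℓ) c₀ κ m ≤ c₁ ^ m := by
    intro m
    induction m with
    | zero =>
      have : ∀ v : Fin 0 → F, returnProb w c v = 1 := fun v => by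
        have : lazyProd w c v = fun _ => 1 := by funext ψ; simp [lazyProd]
        simp [returnProb, this, invTransform_one]
      unfold returnPotential
      simp only [this]
      rw [Fintype.sum_unique]
      split_ifs <;> simp
    | succ m ih =>
      rw [pow_succ']
      exact (returnPotential_succ_le ℓ hℓ hw hw1 hs₀ ht₀ hst hk hη0 hη hη1 hc00 hc01 κ m).trans
        (mul_le_mul_of_nonneg_left ih hc1)
  have hℓ' : (0 : ℝ) < ℓ := by exact_mod_cast hℓ.pos
  refine le_trans ?_ (mul_le_mul_of_nonneg_left (hpot (n + 1)) (by positivity))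
  unfold returnPotential
  rw [Finset.mul_sum]
  refine Finset.sum_le_sum fun v _ => ?_
  have hω0 := returnProb_nonneg hw v (c := c)
  have hm : 0 ≤ min (returnProb w c v) c₀ := le_min hω0 hc00
  by_cases hv : v ≠ 0 ∧ 3 / (ℓ : ℝ) ≤ returnProb w c v
  · rw [if_pos hv, if_pos hv.2, min_eq_left (returnProb_le_of_ne_zero hw hw1 hst hv.1)]
    have h1 : 1 ≤ ℓ / 3 * returnProb w c v := by
      have := hv.2
      rw [div_le_iff₀ hℓ'] at this
      linarith
    have h2 := one_le_pow₀ h1 (n := κ + 1)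
    calc returnProb w c v ^ n = returnProb w c v ^ n * 1 := (mul_one _).symm
      _ ≤ returnProb w c v ^ n * (ℓ / 3 * returnProb w c v) ^ (κ + 1) := by gcongr
      _ = _ := by rw [mul_pow]; ring
  · rw [if_neg hv]
    split_ifs
    · positivity
    · simp

end Potential

section SingularProbability

variable {F : Type*} [Field F] {ι : Type*} [Fintype ι]

theorem sum_pi_prod_eq_one {α : Type*} [Fintype α] {w : α → ℝ} (hw1 : ∑ s, w s = 1) (n : ℕ) :
    ∑ r : Fin n → α, ∏ j, w (r j) = 1 := by
  rw [← Fintype.piFinset_univ, ← Finset.prod_univ_sum]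
  simp [hw1]

/-- The probability that independent rows all satisfy their constraints is the product. -/
theorem sum_pi_ite_forall {α : Type*} [Fintype α] {n : ℕ} (W : α → ℝ) (P : Fin n → α → Prop) :
    (∑ r : Fin n → α, if ∀ j, P j (r j) then ∏ j, W (r j) else 0) =
      ∏ j, ∑ s, if P j s then W s else 0 := by
  rw [Finset.prod_univ_sum, Fintype.piFinset_univ]
  refine Finset.sum_congr rfl fun r _ => ?_
  split_ifs with h
  · exact Finset.prod_congr rfl fun j _ => (if_pos (h j)).symm
  · push Not at h
    obtain ⟨j, hj⟩ := h
    exact (Finset.prod_eq_zero (Finset.mem_univ j) (if_neg hj)).symm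

theorem exists_ne_zero_orthogonal {n : ℕ} (A : Fin n → Fin (n + 1) → F) :
    ∃ v : Fin (n + 1) → F, v ≠ 0 ∧ ∀ j, ∑ l, A j l * v l = 0 := by
  have h := LinearMap.ker_ne_bot_of_finrank_lt (f := Matrix.toLin' (Matrix.of A)) (by simp)
  obtain ⟨v, hv, hv0⟩ := Submodule.exists_mem_ne_zero_of_ne_bot h
  refine ⟨v, hv0, fun j => ?_⟩
  have := congrFun (LinearMap.mem_ker.1 hv) j
  simpa [Matrix.mulVec, dotProduct] using this

theorem exists_row_orthogonal_of_det_eq_zero {n : ℕ} (A : Matrix (Fin (n + 1)) (Fin (n + 1)) F)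
    (hA : A.det = 0) : ∃ i, ∀ v : Fin (n + 1) → F,
      (∀ j, ∑ l, A (i.succAbove j) l * v l = 0) → ∑ l, A i l * v l = 0 := by
  obtain ⟨x, hx0, hx⟩ := Matrix.exists_vecMul_eq_zero_iff.2 hA
  obtain ⟨i, hi⟩ := Function.ne_iff.1 hx0
  refine ⟨i, fun v hv => ?_⟩
  have h1 : ∑ m, x m * ∑ l, A m l * v l = 0 := by
    have h2 : ∀ l, ∑ m, x m * A m l = 0 := fun l => by
      have := congrFun hx l
      simpa [Matrix.vecMul, dotProduct] using this
    simp only [Finset.mul_sum]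
    rw [Finset.sum_comm]
    simp only [← mul_assoc, ← Finset.sum_mul, h2, zero_mul, Finset.sum_const_zero]
  rw [Fin.sum_univ_succAbove _ i] at h1
  simp only [hv, mul_zero, Finset.sum_const_zero, add_zero] at h1
  exact (mul_eq_zero.1 h1).resolve_left hi

variable [Fintype F] {w : ι → ℝ} {c : ι → F}

omit [Fintype F] in
theorem combProb_nonneg (hw : ∀ s, 0 ≤ w s) {n : ℕ} (v : Fin n → F) (a : F) :
    0 ≤ combProb w c v a :=
  Finset.sum_nonneg fun r _ => by
    split_ifs
    · exact Finset.prod_nonneg fun _ _ => hw _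
    · exact le_rfl

omit [Fintype F] in
theorem combProb_le_one (hw : ∀ s, 0 ≤ w s) (hw1 : ∑ s, w s = 1) {n : ℕ} (v : Fin n → F) (a : F) :
    combProb w c v a ≤ 1 := by
  rw [← sum_pi_prod_eq_one hw1 n]
  refine Finset.sum_le_sum fun r _ => ?_
  split_ifs
  · exact le_rfl
  · exact Finset.prod_nonneg fun _ _ => hw _

theorem sum_singular_le (ℓ : ℕ) [CharP F ℓ] (hℓ : ℓ.Prime) (hw : ∀ s, 0 ≤ w s)
    (hw1 : ∑ s, w s = 1) {s₀ t₀ : ι} (hs₀ : 0 < w s₀) (ht₀ : 0 < w t₀) (hst : c s₀ ≠ c t₀)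
    {k : ℕ} (hk : 0 < k) {η : ℝ} (hη0 : 0 ≤ η) (hη : (k : ℝ) ^ 2 * (2 * η / (w s₀ * w t₀)) ≤ 1 / 2)
    (hη1 : η ≤ 1) (κ n : ℕ) (a : Fin (n + 1) → Fin (n + 1) → F) :
    (∑ M : Fin (n + 1) → Fin (n + 1) → ι,
      if (Matrix.of fun i j => c (M i j) - a i j).det = 0 then ∏ i, ∏ j, w (M i j) else 0) ≤
      (n + 1) * (3 / ℓ + (ℓ / 3) ^ (κ + 1) *
        (1 - w s₀ * w t₀ / 2 + 2 / k + Fintype.card F * (1 - η) ^ κ) ^ (n + 1)) := by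
  set E : ℝ := (ℓ / 3) ^ (κ + 1) *
        (1 - w s₀ * w t₀ / 2 + 2 / k + Fintype.card F * (1 - η) ^ κ) ^ (n + 1) with hE
  have hℓ' : (0 : ℝ) < ℓ := by exact_mod_cast hℓ.pos
  let R := Fin (n + 1) → ι
  let W : R → ℝ := fun r => ∏ j, w (r j)
  have hW : ∀ r, 0 ≤ W r := fun r => Finset.prod_nonneg fun _ _ => hw _
  have hW1 : ∑ r, W r = 1 := sum_pi_prod_eq_one hw1 _
  have hWP : ∀ {m : ℕ} (M : Fin m → R), 0 ≤ ∏ i, W (M i) :=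
    fun M => Finset.prod_nonneg fun _ _ => hW _
  choose u hu0 hu using fun (i : Fin (n + 1)) (M' : Fin n → R) =>
    exists_ne_zero_orthogonal fun j l => c (M' j l) - a (i.succAbove j) l
  have hdot : ∀ (i : Fin (n + 1)) (r : R) (v : Fin (n + 1) → F),
      (∑ l, (c (r l) - a i l) * v l = 0 ↔ ∑ l, c (r l) * v l = ∑ l, a i l * v l) := by
    intro i r v
    simp only [sub_mul, Finset.sum_sub_distrib, sub_eq_zero]
  have h1 : ∀ M : Fin (n + 1) → R,
      (if (Matrix.of fun i j => c (M i j) - a i j).det = 0 then ∏ i, W (M i) else 0) ≤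
      ∑ i : Fin (n + 1), if ∑ l, (c (M i l) - a i l) *
        u i (fun j => M (i.succAbove j)) l = 0 then ∏ i, W (M i) else 0 := by
    intro M
    have hnn : ∀ i : Fin (n + 1), 0 ≤ if ∑ l, (c (M i l) - a i l) *
        u i (fun j => M (i.succAbove j)) l = 0 then ∏ i, W (M i) else 0 := fun i => by
      split_ifs
      · exact hWP M
      · exact le_rfl
    split_ifs with h
    · obtain ⟨i, hi⟩ := exists_row_orthogonal_of_det_eq_zero _ h
      refine le_trans (le_of_eq ?_) (Finset.single_le_sum (fun i _ => hnn i) (Finset.mem_univ i))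
      rw [if_pos]
      exact hi _ (hu i fun j => M (i.succAbove j))
    · exact Finset.sum_nonneg fun i _ => hnn i
  refine (Finset.sum_le_sum fun M _ => h1 M).trans ?_
  rw [Finset.sum_comm]
  have h2 : ∀ i : Fin (n + 1), (∑ M : Fin (n + 1) → R, if ∑ l, (c (M i l) - a i l) *
        u i (fun j => M (i.succAbove j)) l = 0 then ∏ i, W (M i) else 0) ≤ 3 / ℓ + E := by
    intro i
    rw [← (Fin.insertNthEquiv (fun _ => R) i).sum_comp, Fintype.sum_prod_type, Finset.sum_comm]
    have h3 : ∀ M' : Fin n → R, (∑ r : R, if ∑ l, (c ((Fin.insertNthEquiv (fun _ => R) i) (r, M') i l)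
          - a i l) * u i (fun j => (Fin.insertNthEquiv (fun _ => R) i) (r, M') (i.succAbove j)) l = 0
          then ∏ m, W ((Fin.insertNthEquiv (fun _ => R) i) (r, M') m) else 0) =
        (∏ j, W (M' j)) * combProb w c (u i M') (∑ l, a i l * u i M' l) := by
      intro M'
      unfold combProb
      rw [Finset.mul_sum]
      refine Finset.sum_congr rfl fun r _ => ?_
      have e1 : (fun j => (Fin.insertNthEquiv (fun _ => R) i) (r, M') (i.succAbove j)) = M' := by
        funext j
        simp [Fin.insertNthEquiv]
      have e2 : (Fin.insertNthEquiv (fun _ => R) i) (r, M') i = r := by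
        simp [Fin.insertNthEquiv]
      have e3 : ∏ m, W ((Fin.insertNthEquiv (fun _ => R) i) (r, M') m) =
          W r * ∏ j, W (M' j) := by
        rw [Fin.prod_univ_succAbove _ i, e2]
        simp only [congrFun e1]
      rw [e1, e2, e3]
      simp only [hdot]
      split_ifs
      · exact mul_comm _ _
      · simp
    rw [Finset.sum_congr rfl fun M' _ => h3 M']
    have h4 : ∀ M' : Fin n → R,
        (∏ j, W (M' j)) * combProb w c (u i M') (∑ l, a i l * u i M' l) ≤
        (∏ j, W (M' j)) * (3 / ℓ) + ∑ v : Fin (n + 1) → F,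
          if v ≠ 0 ∧ 3 / (ℓ : ℝ) ≤ returnProb w c v then
            (if ∀ j, ∑ l, c (M' j l) * v l = ∑ l, a (i.succAbove j) l * v l then
              ∏ j, W (M' j) else 0) else 0 := by
      intro M'
      have hnn : ∀ v : Fin (n + 1) → F, 0 ≤ if v ≠ 0 ∧ 3 / (ℓ : ℝ) ≤ returnProb w c v then
            (if ∀ j, ∑ l, c (M' j l) * v l = ∑ l, a (i.succAbove j) l * v l then
              ∏ j, W (M' j) else 0) else 0 := fun v => by
        split_ifs
        · exact hWP M'
        · exact le_rfl
        · exact le_rfl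
      rcases lt_or_ge (returnProb w c (u i M')) (3 / ℓ) with h | h
      · have h5 := (combProb_le (u i M') (∑ l, a i l * u i M' l)).trans h.le
        have h6 := mul_le_mul_of_nonneg_left h5 (hWP M')
        have h7 := Finset.sum_nonneg fun v (_ : v ∈ Finset.univ) => hnn v
        linarith
      · have h5 := Finset.single_le_sum (fun v _ => hnn v) (Finset.mem_univ (u i M'))
        rw [if_pos ⟨hu0 i M', h⟩, if_pos fun j => (hdot _ _ _).1 (hu i M' j)] at h5
        have h6 := mul_le_mul_of_nonneg_left (combProb_le_one hw hw1 (u i M')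
          (∑ l, a i l * u i M' l) (c := c)) (hWP M')
        have h7 : 0 ≤ (∏ j, W (M' j)) * (3 / (ℓ : ℝ)) := mul_nonneg (hWP M') (by positivity)
        linarith
    refine (Finset.sum_le_sum fun M' _ => h4 M').trans ?_
    rw [Finset.sum_add_distrib, ← Finset.sum_mul, sum_pi_prod_eq_one hW1, one_mul, Finset.sum_comm]
    gcongr
    refine le_trans (Finset.sum_le_sum fun v _ => ?_)
      (sum_returnProb_pow_le ℓ hℓ hw hw1 hs₀ ht₀ hst hk hη0 hη hη1 κ n)
    split_ifs
    · rw [sum_pi_ite_forall W fun j (r : R) =>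
        ∑ l, c (r l) * v l = ∑ l, a (i.succAbove j) l * v l]
      refine (Finset.prod_le_prod (fun j _ => ?_) (fun j _ => combProb_le v
        (∑ l, a (i.succAbove j) l * v l))).trans ?_
      · exact combProb_nonneg hw v _
      · simp
    · simp
  refine (Finset.sum_le_sum fun i _ => h2 i).trans (le_of_eq ?_)
  rw [Finset.sum_const, Finset.card_univ, Fintype.card_fin, nsmul_eq_mul]
  push_cast
  rfl

end SingularProbability

section IntegerFactors

open Polynomial

/-- A nonconstant monic integer polynomial has a root in a small field of given characteristic. -/
theorem exists_finite_field_root (ℓ : ℕ) (hℓ : ℓ.Prime) (g : ℤ[X]) (hg : g.Monic)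
    (hd : 1 ≤ g.natDegree) : ∃ (F : Type) (_ : Field F) (_ : Fintype F) (_ : CharP F ℓ) (x : F),
      Fintype.card F ≤ ℓ ^ g.natDegree ∧ (g.map (Int.castRingHom F)).eval x = 0 := by
  have := Fact.mk hℓ
  set f := g.map (Int.castRingHom (ZMod ℓ)) with hf
  have hfd : f.natDegree = g.natDegree := hg.natDegree_map _
  obtain ⟨p, hp, hpf⟩ := exists_irreducible_of_natDegree_pos (f := f) (by omega)
  have := Fact.mk hp
  have hfin : Module.Finite (ZMod ℓ) (AdjoinRoot p) := (AdjoinRoot.powerBasis hp.ne_zero).finite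
  have : Finite (AdjoinRoot p) := Module.finite_of_finite (ZMod ℓ)
  have hft : Fintype (AdjoinRoot p) := Fintype.ofFinite _
  have hchar : CharP (AdjoinRoot p) ℓ :=
    charP_of_injective_algebraMap (algebraMap (ZMod ℓ) (AdjoinRoot p)).injective ℓ
  refine ⟨AdjoinRoot p, inferInstance, hft, hchar, AdjoinRoot.root p, ?_, ?_⟩
  · rw [Module.card_eq_pow_finrank (K := ZMod ℓ), ZMod.card, (AdjoinRoot.powerBasis hp.ne_zero).finrank,
      AdjoinRoot.powerBasis_dim, ← hfd]
    refine Nat.pow_le_pow_right hℓ.pos (natDegree_le_of_dvd hpf ?_)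
    exact (hg.map _).ne_zero
  · have e : Int.castRingHom (AdjoinRoot p) =
        (algebraMap (ZMod ℓ) (AdjoinRoot p)).comp (Int.castRingHom (ZMod ℓ)) :=
      RingHom.ext_int _ _
    rw [e, ← Polynomial.map_map, eval_map, ← hf]
    obtain ⟨h, hh⟩ := hpf
    rw [hh, eval₂_mul]
    have : eval₂ (algebraMap (ZMod ℓ) (AdjoinRoot p)) (AdjoinRoot.root p) p = 0 :=
      AdjoinRoot.eval₂_root p
    rw [this, zero_mul]

variable {ι : Type*} [Fintype ι] {w : ι → ℝ} {val : ι → ℤ}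

theorem sum_dvd_charpoly_le {ℓ B : ℕ} (hℓ : ℓ.Prime) (hℓB : 2 * B < ℓ)
    (hB : ∀ s, |val s| ≤ B) (hw : ∀ s, 0 ≤ w s)
    (hw1 : ∑ s, w s = 1) {s₀ t₀ : ι} (hs₀ : 0 < w s₀) (ht₀ : 0 < w t₀) (hst : val s₀ ≠ val t₀)
    {k : ℕ} (hk : 0 < k) {η : ℝ} (hη0 : 0 ≤ η) (hη : (k : ℝ) ^ 2 * (2 * η / (w s₀ * w t₀)) ≤ 1 / 2)
    (hη1 : η ≤ 1) (κ n d : ℕ) {g : ℤ[X]} (hg : g.Monic) (hg1 : 1 ≤ g.natDegree)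
    (hgd : g.natDegree ≤ d) :
    (∑ M : Fin (n + 1) → Fin (n + 1) → ι,
      if g ∣ (Matrix.of fun i j => val (M i j)).charpoly then ∏ i, ∏ j, w (M i j) else 0) ≤
      (n + 1) * (3 / ℓ + (ℓ / 3) ^ (κ + 1) *
        (1 - w s₀ * w t₀ / 2 + 2 / k + (ℓ : ℝ) ^ d * (1 - η) ^ κ) ^ (n + 1)) := by
  obtain ⟨F, _, _, _, x, hcard, hx⟩ := exists_finite_field_root ℓ hℓ g hg hg1
  have hc : ((val s₀ : ℤ) : F) ≠ ((val t₀ : ℤ) : F) := by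
    intro h
    have h1 : (((val s₀ - val t₀ : ℤ)) : F) = 0 := by push_cast; rw [h, sub_self]
    rw [CharP.intCast_eq_zero_iff F ℓ] at h1
    have h2 := Int.le_of_dvd (abs_pos.2 (sub_ne_zero.2 hst)) ((dvd_abs _ _).2 h1)
    have h3 := abs_sub (val s₀) (val t₀)
    have h4 := hB s₀
    have h5 := hB t₀
    omega
  have h := sum_singular_le ℓ hℓ hw hw1 (c := fun s => (val s : F)) hs₀ ht₀ hc hk hη0 hη hη1 κ n
    (fun i j => if i = j then x else 0)
  refine le_trans (Finset.sum_le_sum fun M _ => ?_) (h.trans ?_)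
  · have hnn : 0 ≤ ∏ i, ∏ j, w (M i j) :=
      Finset.prod_nonneg fun _ _ => Finset.prod_nonneg fun _ _ => hw _
    by_cases hd : g ∣ (Matrix.of fun i j => val (M i j)).charpoly
    · rw [if_pos hd, if_pos]
      set A : Matrix (Fin (n + 1)) (Fin (n + 1)) ℤ := Matrix.of fun i j => val (M i j) with hA
      have h1 : ((A.map (Int.castRingHom F)).charpoly).eval x = 0 := by
        rw [Matrix.charpoly_map]
        obtain ⟨q, hq⟩ := hd
        rw [hq, Polynomial.map_mul, eval_mul, hx, zero_mul]
      rw [Matrix.eval_charpoly] at h1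
      have h2 : (Matrix.of fun i j => ((val (M i j) : ℤ) : F) - if i = j then x else 0) =
          -(Matrix.scalar (Fin (n + 1)) x - A.map (Int.castRingHom F)) := by
        ext i j
        simp [hA, Matrix.diagonal_apply]
      rw [h2, Matrix.det_neg, h1, mul_zero]
    · rw [if_neg hd]
      split_ifs
      · exact hnn
      · exact le_rfl
  · have hℓ1 : (1 : ℝ) ≤ ℓ := by exact_mod_cast hℓ.one_le
    have hws : ∀ s, w s ≤ 1 := fun s => by
      rw [← hw1]
      exact Finset.single_le_sum (fun s _ => hw s) (Finset.mem_univ s)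
    have h0 : 0 ≤ 1 - w s₀ * w t₀ / 2 := by
      have := mul_le_one₀ (hws s₀) (hw t₀) (hws t₀)
      linarith
    have h1 : (Fintype.card F : ℝ) ≤ (ℓ : ℝ) ^ d := by
      calc (Fintype.card F : ℝ) ≤ (ℓ : ℝ) ^ g.natDegree := by exact_mod_cast hcard
        _ ≤ (ℓ : ℝ) ^ d := pow_le_pow_right₀ hℓ1 hgd
    have hη2 : 0 ≤ 1 - η := by linarith
    gcongr

theorem norm_root_le_of_dvd_charpoly {n B : ℕ} (A : Matrix (Fin n) (Fin n) ℤ)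
    (hA : ∀ i j, |A i j| ≤ B) {z : ℂ}
    (hz : ((A.map (Int.castRingHom ℂ)).charpoly).eval z = 0) : ‖z‖ ≤ B * n := by
  by_contra! hlt
  rw [Matrix.eval_charpoly] at hz
  refine det_ne_zero_of_sum_row_lt_diag (fun k => ?_) hz
  have hA' : ∀ i j, ‖((A i j : ℤ) : ℂ)‖ ≤ B := fun i j => by
    rw [Complex.norm_intCast]
    exact_mod_cast hA i j
  have h1 : ∑ j ∈ Finset.univ.erase k,
      ‖(Matrix.scalar (Fin n) z - A.map (Int.castRingHom ℂ)) k j‖ ≤ (n - 1) * B := by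
    have h2 : ∀ j ∈ Finset.univ.erase k,
        ‖(Matrix.scalar (Fin n) z - A.map (Int.castRingHom ℂ)) k j‖ ≤ B := fun j hj => by
      have hkj : k ≠ j := (Finset.ne_of_mem_erase hj).symm
      simpa [Matrix.diagonal_apply, hkj] using hA' k j
    refine (Finset.sum_le_card_nsmul _ _ _ h2).trans ?_
    rw [Finset.card_erase_of_mem (Finset.mem_univ _), Finset.card_univ, Fintype.card_fin,
      nsmul_eq_mul, Nat.cast_sub (by have := k.isLt; omega)]
    simp
  have h3 : ‖z‖ - B ≤ ‖(Matrix.scalar (Fin n) z - A.map (Int.castRingHom ℂ)) k k‖ := by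
    have := norm_sub_norm_le z ((A k k : ℤ) : ℂ)
    have := hA' k k
    simp
    linarith
  linarith

theorem abs_coeff_le_of_dvd_charpoly {n B d : ℕ} (A : Matrix (Fin n) (Fin n) ℤ)
    (hA : ∀ i j, |A i j| ≤ B) {g : ℤ[X]} (hg : g.Monic) (hd : g.natDegree ≤ d)
    (hdvd : g ∣ A.charpoly) (i : ℕ) : |g.coeff i| ≤ ((2 * (B * n + 1)) ^ d : ℕ) := by
  set f := g.map (Int.castRingHom ℂ)
  have hfd : f.natDegree = g.natDegree := hg.natDegree_map _
  have h1 := coeff_le_of_roots_le (p := f) (f := RingHom.id ℂ) (B := (B * n : ℝ)) i (hg.map _)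
    (by simpa using IsAlgClosed.splits f) fun z hz => by
      rw [Polynomial.map_id] at hz
      refine norm_root_le_of_dvd_charpoly A hA ?_
      have hz0 := (mem_roots'.1 hz).2
      rw [Matrix.charpoly_map]
      obtain ⟨q, hq⟩ := hdvd
      rw [hq, Polynomial.map_mul, eval_mul, hz0.eq_zero, zero_mul]
  rw [Polynomial.map_id, hfd, coeff_map, eq_intCast, Complex.norm_intCast] at h1
  have h2 : (B * n : ℝ) ^ (g.natDegree - i) * (g.natDegree.choose i : ℝ) ≤
      ((2 * (B * n + 1)) ^ d : ℕ) := by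
    have h3 : ((g.natDegree.choose i : ℕ) : ℝ) ≤ 2 ^ d := by
      exact_mod_cast (Nat.choose_le_two_pow _ _).trans (Nat.pow_le_pow_right (by norm_num) hd)
    have h4 : (B * n : ℝ) ^ (g.natDegree - i) ≤ (B * n + 1 : ℝ) ^ d := by
      have h5 : (0 : ℝ) ≤ B * n := by positivity
      calc (B * n : ℝ) ^ (g.natDegree - i) ≤ (B * n + 1 : ℝ) ^ (g.natDegree - i) := by
            gcongr
            linarith
        _ ≤ _ := pow_le_pow_right₀ (by linarith) (by omega)
    calc (B * n : ℝ) ^ (g.natDegree - i) * (g.natDegree.choose i : ℝ)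
        ≤ (B * n + 1 : ℝ) ^ d * 2 ^ d := mul_le_mul h4 h3 (by positivity) (by positivity)
      _ = _ := by
        push_cast
        rw [mul_pow 2, mul_comm]
  have h3 := h1.trans h2
  exact_mod_cast h3

/-- The monic integer polynomials of bounded degree and height. -/
def boundedMonics (d H : ℕ) : Finset ℤ[X] :=
  ((Finset.univ : Finset (Fin (d + 1) → Finset.Icc (-(H : ℤ)) H)).image fun f =>
    ∑ i : Fin (d + 1), monomial (i : ℕ) ((f i : ℤ))).filter fun g =>
      g.Monic ∧ 1 ≤ g.natDegree ∧ g.natDegree ≤ d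

theorem card_boundedMonics_le (d H : ℕ) : (boundedMonics d H).card ≤ (2 * H + 1) ^ (d + 1) := by
  refine (Finset.card_filter_le _ _).trans (Finset.card_image_le.trans ?_)
  rw [Finset.card_univ]
  simp only [Fintype.card_pi, Finset.prod_const, Finset.card_univ, Fintype.card_fin,
    Fintype.card_coe, Int.card_Icc]
  gcongr
  omega

theorem mem_boundedMonics {d H : ℕ} {g : ℤ[X]} (hg : g.Monic) (h1 : 1 ≤ g.natDegree)
    (hd : g.natDegree ≤ d) (hH : ∀ i, |g.coeff i| ≤ H) : g ∈ boundedMonics d H := by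
  refine Finset.mem_filter.2 ⟨Finset.mem_image.2 ⟨fun i => ⟨g.coeff i, ?_⟩, Finset.mem_univ _, ?_⟩,
    hg, h1, hd⟩
  · exact Finset.mem_Icc.2 (abs_le.1 (hH i))
  · exact (Finset.sum_range fun i => monomial i (g.coeff i)).symm.trans
      (g.as_sum_range' (d + 1) (by omega)).symm

end IntegerFactors

section LowDegreeFactors

open Polynomial Filter

theorem tendsto_nat_sqrt_atTop : Tendsto Nat.sqrt atTop atTop :=
  tendsto_atTop_atTop.2 fun b => ⟨b * b, fun _ ha => Nat.le_sqrt.2 ha⟩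

theorem natCast_le_sqrt_succ_sq (n : ℕ) : (n : ℝ) ≤ ((Nat.sqrt n : ℝ) + 1) ^ 2 := by
  have := (Nat.lt_succ_sqrt n).le
  rw [← pow_two] at this
  exact_mod_cast this

theorem tendsto_succ_pow_mul_pow (E : ℕ) {ρ : ℝ} (h0 : 0 < ρ) (h1 : ρ < 1) :
    Tendsto (fun s : ℕ => ((s : ℝ) + 1) ^ E * ρ ^ s) atTop (nhds 0) := by
  have h := (tendsto_pow_const_mul_const_pow_of_abs_lt_one E
    (by rwa [abs_of_pos h0])).comp (tendsto_add_atTop_nat 1)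
  have h2 := h.const_mul ρ⁻¹
  rw [mul_zero] at h2
  refine h2.congr fun s => ?_
  simp only [Function.comp]
  push_cast
  rw [pow_succ ρ]
  field_simp

theorem tendsto_pow_mul_pow_sqrt (E : ℕ) {ρ : ℝ} (h0 : 0 < ρ) (h1 : ρ < 1) :
    Tendsto (fun n : ℕ => (n : ℝ) ^ E * ρ ^ Nat.sqrt n) atTop (nhds 0) := by
  refine squeeze_zero (fun n => by positivity) (fun n => ?_)
    ((tendsto_succ_pow_mul_pow (2 * E) h0 h1).comp tendsto_nat_sqrt_atTop)
  simp only [Function.comp]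
  rw [pow_mul]
  gcongr
  exact natCast_le_sqrt_succ_sq n

theorem tendsto_pow_sqrt_mul_pow (E : ℕ) {γ : ℝ} (h0 : 0 < γ) (h1 : γ < 1) :
    Tendsto (fun n : ℕ => (n : ℝ) ^ (E * (Nat.sqrt n + 1)) * γ ^ n) atTop (nhds 0) := by
  have hb : Tendsto (fun s : ℕ => γ⁻¹ * (((s : ℝ) + 1) ^ (2 * E) * γ ^ s)) atTop (nhds 0) := by
    simpa using (tendsto_succ_pow_mul_pow (2 * E) h0 h1).const_mul γ⁻¹
  refine squeeze_zero' (Eventually.of_forall fun n => by positivity) ?_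
    (hb.comp tendsto_nat_sqrt_atTop)
  filter_upwards [tendsto_nat_sqrt_atTop.eventually (hb.eventually (ge_mem_nhds one_pos))] with n hn
  simp only [Function.comp]
  set s := Nat.sqrt n with hs
  have hsn : s ^ 2 ≤ n := by
    rw [pow_two]
    exact Nat.sqrt_le n
  have h2 : γ ^ n ≤ (γ⁻¹ * γ ^ s) ^ (s + 1) := by
    have e : (γ⁻¹ * γ ^ s) ^ (s + 1) * γ = γ ^ (s ^ 2) := by
      have : γ ^ (s ^ 2) * γ ^ (s + 1) = γ ^ (s * (s + 1)) * γ := by ring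
      rw [mul_pow, inv_pow, ← pow_mul]
      field_simp
      linarith
    have h3 : γ ^ (s ^ 2) ≤ (γ⁻¹ * γ ^ s) ^ (s + 1) := by
      rw [← e]
      exact mul_le_of_le_one_right (by positivity) h1.le
    exact (pow_le_pow_of_le_one h0.le h1.le hsn).trans h3
  calc (n : ℝ) ^ (E * (s + 1)) * γ ^ n
      ≤ (((s : ℝ) + 1) ^ 2) ^ (E * (s + 1)) * (γ⁻¹ * γ ^ s) ^ (s + 1) := by
        gcongr
        exact natCast_le_sqrt_succ_sq n
    _ = (γ⁻¹ * (((s : ℝ) + 1) ^ (2 * E) * γ ^ s)) ^ (s + 1) := by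
        rw [← pow_mul, ← mul_assoc 2, pow_mul _ (2 * E), ← mul_pow]
        congr 1
        ring
    _ ≤ γ⁻¹ * (((s : ℝ) + 1) ^ (2 * E) * γ ^ s) :=
        pow_le_of_le_one (by positivity) hn (by omega)

variable {ι : Type*} [Fintype ι] {w : ι → ℝ} {val : ι → ℤ}

theorem sum_exists_factor_le {B : ℕ} (hB : ∀ s, |val s| ≤ B) (hw : ∀ s, 0 ≤ w s) {n d : ℕ}
    {b : ℝ} (hb0 : 0 ≤ b) (hb : ∀ g : ℤ[X], g.Monic → 1 ≤ g.natDegree → g.natDegree ≤ d →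
      (∑ M : Fin n → Fin n → ι, if g ∣ (Matrix.of fun i j => val (M i j)).charpoly then
        ∏ i, ∏ j, w (M i j) else 0) ≤ b) :
    (∑ M : Fin n → Fin n → ι, if ∃ g : ℤ[X], g.Monic ∧ 1 ≤ g.natDegree ∧ g.natDegree ≤ d ∧
      g ∣ (Matrix.of fun i j => val (M i j)).charpoly then ∏ i, ∏ j, w (M i j) else 0) ≤
      ((2 * (2 * (B * n + 1)) ^ d + 1) ^ (d + 1) : ℕ) * b := by
  set H := (2 * (B * n + 1)) ^ d with hH
  have hnn : ∀ M : Fin n → Fin n → ι, 0 ≤ ∏ i, ∏ j, w (M i j) := fun M =>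
    Finset.prod_nonneg fun _ _ => Finset.prod_nonneg fun _ _ => hw _
  have hnn' : ∀ (M : Fin n → Fin n → ι) (g : ℤ[X]), 0 ≤
      if g ∣ (Matrix.of fun i j => val (M i j)).charpoly then ∏ i, ∏ j, w (M i j) else 0 :=
    fun M g => by
    split_ifs
    · exact hnn M
    · exact le_rfl
  have h1 : ∀ M : Fin n → Fin n → ι,
      (if ∃ g : ℤ[X], g.Monic ∧ 1 ≤ g.natDegree ∧ g.natDegree ≤ d ∧
        g ∣ (Matrix.of fun i j => val (M i j)).charpoly then ∏ i, ∏ j, w (M i j) else 0) ≤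
      ∑ g ∈ boundedMonics d H, if g ∣ (Matrix.of fun i j => val (M i j)).charpoly then
        ∏ i, ∏ j, w (M i j) else 0 := by
    intro M
    split_ifs with h
    · obtain ⟨g, hg, hg1, hgd, hdvd⟩ := h
      have hmem : g ∈ boundedMonics d H := mem_boundedMonics hg hg1 hgd fun i =>
        abs_coeff_le_of_dvd_charpoly _ (fun i j => hB (M i j)) hg hgd hdvd i
      have h2 := Finset.single_le_sum (fun g _ => hnn' M g) hmem
      rwa [if_pos hdvd] at h2
    · exact Finset.sum_nonneg fun g _ => hnn' M g
  refine (Finset.sum_le_sum fun M _ => h1 M).trans ?_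
  rw [Finset.sum_comm]
  refine (Finset.sum_le_card_nsmul _ _ b fun g hg => ?_).trans ?_
  · obtain ⟨-, hg, hg1, hgd⟩ := Finset.mem_filter.1 hg
    exact hb g hg hg1 hgd
  · rw [nsmul_eq_mul]
    gcongr
    exact card_boundedMonics_le d H

/-- The characteristic polynomial of a random integer matrix rarely has a factor of bounded
degree. -/
theorem tendsto_sum_exists_factor {B : ℕ} (hB : ∀ s, |val s| ≤ B) (hw : ∀ s, 0 ≤ w s)
    (hw1 : ∑ s, w s = 1) {s₀ t₀ : ι} (hs₀ : 0 < w s₀) (ht₀ : 0 < w t₀) (hst : val s₀ ≠ val t₀)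
    (d : ℕ) : Tendsto (fun n : ℕ => ∑ M : Fin n → Fin n → ι,
      if ∃ g : ℤ[X], g.Monic ∧ 1 ≤ g.natDegree ∧ g.natDegree ≤ d ∧
      g ∣ (Matrix.of fun i j => val (M i j)).charpoly then ∏ i, ∏ j, w (M i j) else 0)
      atTop (nhds 0) := by
  have hws : ∀ s, w s ≤ 1 := fun s => by
    rw [← hw1]
    exact Finset.single_le_sum (fun s _ => hw s) (Finset.mem_univ s)
  set β : ℝ := w s₀ * w t₀ / 2 with hβ
  have hβ0 : 0 < β := by positivity
  have hβ1 : β ≤ 1 / 2 := by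
    have := mul_le_one₀ (hws s₀) (hw t₀) (hws t₀)
    rw [hβ]
    linarith
  obtain ⟨k, hk⟩ := exists_nat_gt (8 / β)
  have hk0 : (0 : ℝ) < k := lt_trans (by positivity) hk
  have hk1 : 1 ≤ k := by exact_mod_cast hk0
  have hk1' : (1 : ℝ) ≤ k := by exact_mod_cast hk1
  have hkβ : 2 / (k : ℝ) ≤ β / 4 := by
    rw [div_lt_iff₀ hβ0] at hk
    rw [div_le_iff₀ hk0]
    linarith
  set η : ℝ := β / (2 * k ^ 2) with hη
  have hη0 : 0 < η := by positivity
  have hη1 : η < 1 := by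
    rw [hη, div_lt_one (by positivity)]
    nlinarith
  have hηk : (k : ℝ) ^ 2 * (2 * η / (w s₀ * w t₀)) ≤ 1 / 2 := by
    have : w s₀ * w t₀ = 2 * β := by rw [hβ]; ring
    rw [this, hη]
    field_simp
    norm_num
  set C : ℕ := d * (d + 1)
  set D : ℝ := (3 * (2 * (B + 1) : ℝ) ^ d) ^ (d + 1) with hD
  have hD0 : 0 ≤ D := by positivity
  have hγ0 : 0 < 1 - β / 2 := by linarith
  have hγ1 : 1 - β / 2 < 1 := by linarith
  have hlim : Tendsto (fun n : ℕ => 3 * D * (1 / (n : ℝ)) +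
      D * ((n : ℝ) ^ ((2 * C + 4) * (Nat.sqrt n + 1)) * (1 - β / 2) ^ n)) atTop (nhds 0) := by
    simpa using (tendsto_one_div_atTop_nhds_zero_nat.const_mul (3 * D)).add
      ((tendsto_pow_sqrt_mul_pow (2 * C + 4) hγ0 hγ1).const_mul D)
  refine squeeze_zero' (Eventually.of_forall fun n => Finset.sum_nonneg fun M _ => ?_) ?_ hlim
  · split_ifs
    · exact Finset.prod_nonneg fun _ _ => Finset.prod_nonneg fun _ _ => hw _
    · exact le_rfl
  have hsmall := (tendsto_pow_mul_pow_sqrt ((C + 3) * d) (sub_pos.2 hη1)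
    (by linarith)).eventually (ge_mem_nhds (show (0 : ℝ) < β / 4 by positivity))
  filter_upwards [hsmall, eventually_ge_atTop (2 * B + 2)] with n hn hnB
  obtain ⟨ℓ, hℓ, hℓ1, hℓ2⟩ := Nat.exists_prime_lt_and_le_two_mul (n ^ (C + 2))
    (pow_ne_zero _ (by omega))
  have hnℓ : n ≤ n ^ (C + 2) := Nat.le_self_pow (by omega) n
  have hℓ3 : ℓ ≤ n ^ (C + 3) := by
    refine hℓ2.trans ?_
    rw [pow_succ n (C + 2), mul_comm]
    gcongr
    omega
  have hn0 : (1 : ℝ) ≤ n := by exact_mod_cast (show 1 ≤ n by omega)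
  have hℓ3' : (ℓ : ℝ) ≤ (n : ℝ) ^ (C + 3) := by exact_mod_cast hℓ3
  have hℓ1' : (n : ℝ) ^ (C + 2) ≤ ℓ := by exact_mod_cast hℓ1.le
  have hℓ0 : (0 : ℝ) < ℓ := by exact_mod_cast hℓ.pos
  set κ := Nat.sqrt n
  set b : ℝ := n * (3 / ℓ + (ℓ / 3) ^ (κ + 1) * (1 - β / 2) ^ n) with hb
  have hb0 : 0 ≤ b := by positivity
  have h1 := sum_exists_factor_le hB hw (n := n) (d := d) hb0 (fun g hg hg1 hgd => by
    obtain ⟨m, rfl⟩ : ∃ m, n = m + 1 := ⟨n - 1, by omega⟩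
    have h2 := sum_dvd_charpoly_le hℓ (by omega) hB hw hw1 hs₀ ht₀ hst hk1 hη0.le hηk hη1.le κ m d
      hg hg1 hgd
    refine h2.trans ?_
    rw [hb]
    push_cast
    rw [← hβ]
    have h3 : (ℓ : ℝ) ^ d * (1 - η) ^ κ ≤ β / 4 := by
      refine le_trans ?_ hn
      rw [pow_mul]
      have : 0 ≤ 1 - η := by linarith
      gcongr
    have h4 : 0 ≤ (ℓ : ℝ) ^ d * (1 - η) ^ κ := by
      have : 0 ≤ 1 - η := by linarith
      positivity
    gcongr
    · have : 0 ≤ 2 / (k : ℝ) := by positivity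
      linarith
    · linarith)
  refine h1.trans ?_
  have h2 : (((2 * (2 * (B * n + 1)) ^ d + 1) ^ (d + 1) : ℕ) : ℝ) ≤ D * (n : ℝ) ^ C := by
    have e : D * (n : ℝ) ^ C = (3 * (2 * ((B + 1) * n)) ^ d) ^ (d + 1) := by
      rw [hD, pow_mul, ← mul_pow]
      congr 1
      rw [mul_assoc, ← mul_pow]
      congr 2
      ring
    rw [e]
    push_cast
    have h3 : (2 * (B * n + 1 : ℝ)) ≤ 2 * ((B + 1) * n) := by nlinarith
    have h4 : (1 : ℝ) ≤ (2 * ((B + 1) * n : ℝ)) ^ d := by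
      refine one_le_pow₀ ?_
      have : (0 : ℝ) ≤ B * n := by positivity
      nlinarith
    refine pow_le_pow_left₀ (by positivity) ?_ _
    have h5 : (2 * (B * n + 1 : ℝ)) ^ d ≤ (2 * ((B + 1) * n)) ^ d := by gcongr
    linarith
  refine (mul_le_mul_of_nonneg_right h2 hb0).trans ?_
  rw [hb]
  have h3 : (n : ℝ) ^ C * n * (3 / ℓ) ≤ 3 * (1 / n) := by
    rw [mul_div_assoc', div_le_iff₀ hℓ0]
    have : (n : ℝ) ^ C * n * 3 = 3 * (1 / n) * (n : ℝ) ^ (C + 2) := by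
      field_simp
      ring
    rw [this]
    gcongr
  have h4 : (n : ℝ) ^ C * n * (ℓ / 3) ^ (κ + 1) ≤ (n : ℝ) ^ ((2 * C + 4) * (κ + 1)) := by
    have h5 : (n : ℝ) ^ C * n ≤ (n : ℝ) ^ ((C + 1) * (κ + 1)) := by
      rw [← pow_succ]
      exact pow_le_pow_right₀ hn0 (Nat.le_mul_of_pos_right _ (by omega))
    have h6 : (ℓ / 3 : ℝ) ^ (κ + 1) ≤ (n : ℝ) ^ ((C + 3) * (κ + 1)) := by
      rw [pow_mul]
      gcongr
      linarith
    calc (n : ℝ) ^ C * n * (ℓ / 3) ^ (κ + 1) ≤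
        (n : ℝ) ^ ((C + 1) * (κ + 1)) * (n : ℝ) ^ ((C + 3) * (κ + 1)) := by gcongr
      _ = _ := by
        rw [← pow_add]
        congr 1
        ring
  have h7 := mul_le_mul_of_nonneg_left h3 hD0
  have h8 := mul_le_mul_of_nonneg_left (mul_le_mul_of_nonneg_right h4
    (pow_nonneg hγ0.le n)) hD0
  calc D * (n : ℝ) ^ C * (n * (3 / ℓ + (ℓ / 3) ^ (κ + 1) * (1 - β / 2) ^ n)) =
      D * ((n : ℝ) ^ C * n * (3 / ℓ)) +
        D * ((n : ℝ) ^ C * n * (ℓ / 3) ^ (κ + 1) * (1 - β / 2) ^ n) := by ring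
    _ ≤ D * (3 * (1 / n)) + D * ((n : ℝ) ^ ((2 * C + 4) * (κ + 1)) * (1 - β / 2) ^ n) :=
        add_le_add h7 h8
    _ = _ := by ring

end LowDegreeFactors

section EntryProbability

variable {ι : Type*} [Fintype ι] {w : ι → ℝ} {val : ι → ℤ}

/-- The probability of `E` for a matrix with independent entries taking the value `val s` with
probability `w s`. -/
def entryProb (w : ι → ℝ) (val : ι → ℤ) (n : ℕ) (E : Matrix (Fin n) (Fin n) ℤ → Prop) : ℝ :=
  ∑ M : Fin n → Fin n → ι,
    if E (Matrix.of fun i j => val (M i j)) then ∏ i, ∏ j, w (M i j) else 0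

omit [Fintype ι] in
theorem prod_prod_nonneg_of_nonneg (hw : ∀ s, 0 ≤ w s) {n : ℕ} (M : Fin n → Fin n → ι) :
    0 ≤ ∏ i, ∏ j, w (M i j) :=
  Finset.prod_nonneg fun _ _ => Finset.prod_nonneg fun _ _ => hw _

theorem entryProb_nonneg (hw : ∀ s, 0 ≤ w s) (n : ℕ) (E : Matrix (Fin n) (Fin n) ℤ → Prop) :
    0 ≤ entryProb w val n E :=
  Finset.sum_nonneg fun M _ => by
    split_ifs
    · exact prod_prod_nonneg_of_nonneg hw M
    · exact le_rfl

theorem entryProb_mono (hw : ∀ s, 0 ≤ w s) {n : ℕ} {E E' : Matrix (Fin n) (Fin n) ℤ → Prop}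
    (h : ∀ M, E M → E' M) : entryProb w val n E ≤ entryProb w val n E' := by
  refine Finset.sum_le_sum fun M _ => ?_
  have := prod_prod_nonneg_of_nonneg hw M
  by_cases hE : E (Matrix.of fun i j => val (M i j))
  · rw [if_pos hE, if_pos (h _ hE)]
  · rw [if_neg hE]
    split_ifs
    · exact this
    · exact le_rfl

theorem entryProb_or_le (hw : ∀ s, 0 ≤ w s) {n : ℕ} (E E' : Matrix (Fin n) (Fin n) ℤ → Prop) :
    entryProb w val n (fun M => E M ∨ E' M) ≤ entryProb w val n E + entryProb w val n E' := by
  unfold entryProb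
  rw [← Finset.sum_add_distrib]
  refine Finset.sum_le_sum fun M _ => ?_
  have := prod_prod_nonneg_of_nonneg hw M
  by_cases h1 : E (Matrix.of fun i j => val (M i j)) <;>
    by_cases h2 : E' (Matrix.of fun i j => val (M i j)) <;> simp [h1, h2, this]

theorem entryProb_exists_le (hw : ∀ s, 0 ≤ w s) {n : ℕ} {α : Type*} (t : Finset α)
    (E : α → Matrix (Fin n) (Fin n) ℤ → Prop) :
    entryProb w val n (fun M => ∃ a ∈ t, E a M) ≤ ∑ a ∈ t, entryProb w val n (E a) := by
  induction t using Finset.induction_on with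
  | empty => simp [entryProb]
  | insert a t ha ih =>
    rw [Finset.sum_insert ha]
    refine (entryProb_mono hw (E' := fun M => E a M ∨ ∃ b ∈ t, E b M) fun M hM => ?_).trans
      ((entryProb_or_le hw _ _).trans (by gcongr))
    obtain ⟨b, hb, hbM⟩ := hM
    rcases Finset.mem_insert.1 hb with rfl | hb
    · exact Or.inl hbM
    · exact Or.inr ⟨b, hb, hbM⟩

theorem entryProb_add_entryProb_not (hw1 : ∑ s, w s = 1) {n : ℕ}
    (E : Matrix (Fin n) (Fin n) ℤ → Prop) :
    entryProb w val n E + entryProb w val n (fun M => ¬ E M) = 1 := by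
  unfold entryProb
  rw [← Finset.sum_add_distrib,
    ← sum_pi_prod_eq_one (w := fun r : Fin n → ι => ∏ j, w (r j)) (sum_pi_prod_eq_one hw1 n) n]
  refine Finset.sum_congr rfl fun M _ => ?_
  by_cases h : E (Matrix.of fun i j => val (M i j)) <;> simp [h]

variable {κ : Type*} [Fintype κ]

theorem sum_residues_le {p : κ → ℕ} (hcop : Pairwise (Function.onFun Nat.Coprime p))
    (hw : ∀ s, 0 ≤ w s) {u : ℝ} (hu0 : 0 ≤ u)
    (hu : ∀ z : ℤ, (∑ s, if ((∏ i, p i : ℕ) : ℤ) ∣ val s - z then w s else 0) ≤ u)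
    (a : ∀ i, ZMod (p i)) : (∑ s, if ∀ i, ((val s : ℤ) : ZMod (p i)) = a i then w s else 0) ≤ u := by
  by_cases h : ∃ s, ∀ i, ((val s : ℤ) : ZMod (p i)) = a i
  · obtain ⟨s₁, hs₁⟩ := h
    refine le_trans (Finset.sum_le_sum fun s _ => ?_) (hu (val s₁))
    by_cases hs : ∀ i, ((val s : ℤ) : ZMod (p i)) = a i
    · rw [if_pos hs, if_pos]
      push_cast
      refine Finset.prod_dvd_of_coprime (fun i _ j _ hij => ?_) fun i _ => ?_
      · exact Nat.isCoprime_iff_coprime.2 (hcop hij)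
      · rw [← ZMod.intCast_zmod_eq_zero_iff_dvd]
        push_cast
        rw [hs, hs₁, sub_self]
    · rw [if_neg hs]
      split_ifs
      · exact hw s
      · exact le_rfl
  · push Not at h
    refine le_of_eq_of_le (Finset.sum_eq_zero fun s _ => if_neg fun hs => ?_) hu0
    obtain ⟨i, hi⟩ := h s
    exact hi (hs i)

theorem matProb_true {F : Type*} [Field F] [Fintype F] (n : ℕ) :
    matProb F n (fun _ => True) = 1 := by
  unfold matProb
  rw [Finset.filter_true, Finset.card_univ]
  have : (Fintype.card F : ℝ) ≠ 0 := by exact_mod_cast Fintype.card_ne_zero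
  have h : Fintype.card (Matrix (Fin n) (Fin n) F) = Fintype.card F ^ (n * n) := by
    rw [show Fintype.card (Matrix (Fin n) (Fin n) F) = Fintype.card (Fin n → Fin n → F) from
      Fintype.card_congr (Equiv.refl _)]
    simp [pow_mul]
  rw [h]
  push_cast
  exact div_self (pow_ne_zero _ this)

/-- Reductions modulo distinct primes are at most as likely as for independent uniform matrices. -/
theorem entryProb_forall_reduction_le {p : κ → ℕ} [hp : ∀ i, Fact (p i).Prime]
    (hcop : Pairwise (Function.onFun Nat.Coprime p)) (hw : ∀ s, 0 ≤ w s)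
    (hu : ∀ z : ℤ, (∑ s, if ((∏ i, p i : ℕ) : ℤ) ∣ val s - z then w s else 0) ≤
      1 / ((∏ i, p i : ℕ) : ℝ))
    {n : ℕ} (E : ∀ i, Matrix (Fin n) (Fin n) (ZMod (p i)) → Prop) :
    entryProb w val n (fun M => ∀ i, E i (M.map (Int.castRingHom (ZMod (p i))))) ≤
      ∏ i, matProb (ZMod (p i)) n (E i) := by
  set N : ℕ := ∏ i, p i with hN
  have hN0 : (0 : ℝ) < N := by
    exact_mod_cast Finset.prod_pos fun i _ => (hp i).out.pos
  have h1 : entryProb w val n (fun M => ∀ i, E i (M.map (Int.castRingHom (ZMod (p i))))) ≤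
      ∑ M : Fin n → Fin n → ι, ∑ A : ∀ i, Matrix (Fin n) (Fin n) (ZMod (p i)),
        if ∀ i, E i (A i) then
          (if ∀ j l, ∀ i, ((val (M j l) : ℤ) : ZMod (p i)) = A i j l then
            ∏ j, ∏ l, w (M j l) else 0) else 0 := by
    refine Finset.sum_le_sum fun M _ => ?_
    have hnn : ∀ A : ∀ i, Matrix (Fin n) (Fin n) (ZMod (p i)), 0 ≤ if ∀ i, E i (A i) then
          (if ∀ j l, ∀ i, ((val (M j l) : ℤ) : ZMod (p i)) = A i j l then
            ∏ j, ∏ l, w (M j l) else 0) else 0 := fun A => by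
      have := prod_prod_nonneg_of_nonneg hw M
      split_ifs
      · exact this
      · exact le_rfl
      · exact le_rfl
    by_cases h : ∀ i, E i ((Matrix.of fun i j => val (M i j)).map (Int.castRingHom (ZMod (p i))))
    · rw [if_pos h]
      refine le_trans (le_of_eq ?_) (Finset.single_le_sum (fun A _ => hnn A) (Finset.mem_univ
        fun i => (Matrix.of fun i j => val (M i j)).map (Int.castRingHom (ZMod (p i)))))
      rw [if_pos h, if_pos]
      intro j l i
      simp
    · rw [if_neg h]
      exact Finset.sum_nonneg fun A _ => hnn A
  refine h1.trans ?_
  rw [Finset.sum_comm]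
  have h2 : ∀ A : ∀ i, Matrix (Fin n) (Fin n) (ZMod (p i)),
      (∑ M : Fin n → Fin n → ι, if ∀ i, E i (A i) then
        (if ∀ j l, ∀ i, ((val (M j l) : ℤ) : ZMod (p i)) = A i j l then
          ∏ j, ∏ l, w (M j l) else 0) else 0) ≤
      if ∀ i, E i (A i) then (1 / (N : ℝ)) ^ (n * n) else 0 := by
    intro A
    split_ifs with hA
    · obtain ⟨Q, hQ⟩ : ∃ Q : Fin n → Fin n → ι → Prop, ∀ j l s, Q j l s ↔
          ∀ i, ((val s : ℤ) : ZMod (p i)) = A i j l := ⟨_, fun _ _ _ => Iff.rfl⟩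
      obtain ⟨P, hP⟩ : ∃ P : Fin n → (Fin n → ι) → Prop, ∀ j r, P j r ↔ ∀ l, Q j l (r l) :=
        ⟨_, fun _ _ => Iff.rfl⟩
      have e0 : ∀ M : Fin n → Fin n → ι,
          (if ∀ j l, ∀ i, ((val (M j l) : ℤ) : ZMod (p i)) = A i j l then
            ∏ j, ∏ l, w (M j l) else 0) = if ∀ j, P j (M j) then ∏ j, ∏ l, w (M j l) else 0 :=
        fun M => if_congr (by simp only [hP, hQ]) rfl rfl
      have e1 : ∀ (j : Fin n) (r : Fin n → ι), (if P j r then ∏ l, w (r l) else 0) =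
          if ∀ l, Q j l (r l) then ∏ l, w (r l) else 0 := fun j r => if_congr (hP j r) rfl rfl
      have e2 : ∀ j l, (∑ s, if Q j l s then w s else 0) =
          ∑ s, if ∀ i, ((val s : ℤ) : ZMod (p i)) = A i j l then w s else 0 := fun j l =>
        Finset.sum_congr rfl fun s _ => if_congr (hQ j l s) rfl rfl
      rw [Finset.sum_congr rfl fun M _ => e0 M,
        sum_pi_ite_forall (fun r : Fin n → ι => ∏ l, w (r l)) P]
      simp only [e1, sum_pi_ite_forall w, e2]
      have h3 : ∀ j l, 0 ≤ ∑ s, if ∀ i, ((val s : ℤ) : ZMod (p i)) = A i j l then w s else 0 :=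
        fun j l => Finset.sum_nonneg fun s _ => by
          split_ifs
          · exact hw s
          · exact le_rfl
      calc (∏ j, ∏ l, ∑ s, if ∀ i, ((val s : ℤ) : ZMod (p i)) = A i j l then w s else 0)
          ≤ ∏ _j : Fin n, ∏ _l : Fin n, 1 / (N : ℝ) :=
            Finset.prod_le_prod (fun j _ => Finset.prod_nonneg fun l _ => h3 j l) fun j _ =>
              Finset.prod_le_prod (fun l _ => h3 j l) fun l _ =>
                sum_residues_le hcop hw (by positivity) hu fun i => A i j l
        _ = _ := by simp [pow_mul]
    · simp
  refine (Finset.sum_le_sum fun A _ => h2 A).trans ?_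
  rw [← Finset.sum_filter, Finset.sum_const, nsmul_eq_mul]
  have h4 : (Finset.univ.filter fun A : ∀ i, Matrix (Fin n) (Fin n) (ZMod (p i)) =>
      ∀ i, E i (A i)) = Fintype.piFinset fun i => Finset.univ.filter (E i) := by
    ext A
    simp [Fintype.mem_piFinset]
  rw [h4, Fintype.card_piFinset]
  unfold matProb
  rw [Finset.prod_div_distrib, Finset.prod_pow]
  simp only [ZMod.card]
  rw [hN]
  push_cast
  rw [one_div, inv_pow, div_eq_mul_inv]

theorem entryProb_reduction_le {p : κ → ℕ} [hp : ∀ i, Fact (p i).Prime]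
    (hcop : Pairwise (Function.onFun Nat.Coprime p)) (hw : ∀ s, 0 ≤ w s)
    (hu : ∀ z : ℤ, (∑ s, if ((∏ i, p i : ℕ) : ℤ) ∣ val s - z then w s else 0) ≤
      1 / ((∏ i, p i : ℕ) : ℝ))
    {n : ℕ} (i : κ) (E : Matrix (Fin n) (Fin n) (ZMod (p i)) → Prop) :
    entryProb w val n (fun M => E (M.map (Int.castRingHom (ZMod (p i))))) ≤
      matProb (ZMod (p i)) n E := by
  let E' : ∀ j, Matrix (Fin n) (Fin n) (ZMod (p j)) → Prop :=
    Function.update (fun _ _ => True) i E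
  have hi : E' i = E := Function.update_self ..
  have hne : ∀ j, j ≠ i → E' j = fun _ => True := fun j hj => Function.update_of_ne hj ..
  have h1 : entryProb w val n (fun M => E (M.map (Int.castRingHom (ZMod (p i))))) ≤
      entryProb w val n (fun M => ∀ j, E' j (M.map (Int.castRingHom (ZMod (p j))))) :=
    entryProb_mono hw fun M hM j => by
      by_cases hj : j = i
      · subst hj
        rw [hi]
        exact hM
      · rw [hne j hj]
        trivial
  refine (h1.trans (entryProb_forall_reduction_le hcop hw hu E')).trans (le_of_eq ?_)
  rw [Finset.prod_eq_single i (fun j _ hj => by rw [hne j hj, matProb_true]) (by simp), hi]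

end EntryProbability

section Assembly

open Polynomial Filter

theorem exists_sum_Icc_rpow_le {ε : ℝ} (hε : 0 < ε) : ∃ k₁ : ℕ, ∀ k₀, k₁ ≤ k₀ → ∀ n : ℕ,
    ∑ k ∈ (Finset.Icc k₀ n : Finset ℕ), ((k : ℝ) ^ (-(0.27 : ℝ))) ^ 4 ≤ ε := by
  have hs : Summable fun k : ℕ => ((k : ℝ) ^ (-(0.27 : ℝ))) ^ 4 := by
    have h : Summable fun k : ℕ => (k : ℝ) ^ (-(1.08 : ℝ)) :=
      Real.summable_nat_rpow.2 (by norm_num)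
    refine h.congr fun k => ?_
    rw [← Real.rpow_natCast, ← Real.rpow_mul (Nat.cast_nonneg k)]
    norm_num
  obtain ⟨s, hs'⟩ := summable_iff_vanishing_norm.1 hs ε hε
  refine ⟨s.sup id + 1, fun k₀ hk₀ n => ?_⟩
  refine (le_abs_self _).trans (hs' _ (Finset.disjoint_left.2 fun k hk hks => ?_)).le
  have h1 := (Finset.mem_Icc.1 hk).1
  have h2 : k ≤ s.sup id := Finset.le_sup (f := id) hks
  omega

variable {ι : Type*} [Fintype ι] {w : ι → ℝ} {val : ι → ℤ}

theorem entryProb_medium_le {p : Fin 4 → ℕ} [hp : ∀ i, Fact (p i).Prime]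
    (hcop : Pairwise (Function.onFun Nat.Coprime p)) (hw : ∀ s, 0 ≤ w s)
    (hu : ∀ z : ℤ, (∑ s, if ((∏ i, p i : ℕ) : ℤ) ∣ val s - z then w s else 0) ≤
      1 / ((∏ i, p i : ℕ) : ℝ)) {n K J k₀ : ℕ} (hJ : 1 ≤ J) (hk₀ : 2 * J ≤ k₀) :
    entryProb w val n (fun M => ∃ k, k₀ ≤ k ∧ 2 * k ≤ n ∧ ∀ i,
      IsKrylovTypical K J (M.map (Int.castRingHom (ZMod (p i)))) ∧
      ∃ u : (ZMod (p i))[X], u.Monic ∧ u.natDegree = k ∧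
        u ∣ (M.map (Int.castRingHom (ZMod (p i)))).charpoly) ≤
      mediumConst K J ^ 4 *
        ∑ k ∈ (Finset.Icc k₀ n : Finset ℕ), ((k : ℝ) ^ (-(0.27 : ℝ))) ^ 4 := by
  let P : ℕ → ∀ i, Matrix (Fin n) (Fin n) (ZMod (p i)) → Prop := fun k i A =>
    IsKrylovTypical K J A ∧ ∃ u : (ZMod (p i))[X], u.Monic ∧ u.natDegree = k ∧ u ∣ A.charpoly
  let t := (Finset.Icc k₀ n).filter fun k => 2 * k ≤ n
  have h1 : entryProb w val n (fun M => ∃ k, k₀ ≤ k ∧ 2 * k ≤ n ∧ ∀ i,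
      P k i (M.map (Int.castRingHom (ZMod (p i))))) ≤
      entryProb w val n (fun M => ∃ k ∈ t, ∀ i,
        P k i (M.map (Int.castRingHom (ZMod (p i))))) :=
    entryProb_mono hw fun M ⟨k, hk, hkn, h⟩ =>
      ⟨k, Finset.mem_filter.2 ⟨Finset.mem_Icc.2 ⟨hk, by omega⟩, hkn⟩, h⟩
  refine h1.trans ((entryProb_exists_le hw t _).trans ?_)
  have hC : 0 ≤ mediumConst K J := by unfold mediumConst; positivity
  have h2 : ∀ k ∈ t, entryProb w val n (fun M => ∀ i,
      P k i (M.map (Int.castRingHom (ZMod (p i))))) ≤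
      mediumConst K J ^ 4 * ((k : ℝ) ^ (-(0.27 : ℝ))) ^ 4 := by
    intro k hk
    obtain ⟨hk, hkn⟩ := Finset.mem_filter.1 hk
    have hk := (Finset.mem_Icc.1 hk).1
    refine (entryProb_forall_reduction_le hcop hw hu (P k)).trans ?_
    have h3 : ∀ i, matProb (ZMod (p i)) n (P k i) ≤ mediumConst K J * (k : ℝ) ^ (-(0.27 : ℝ)) :=
      fun i => matProb_isKrylovTypical_dvd_le hJ (hk₀.trans hk) hkn
    calc ∏ i, matProb (ZMod (p i)) n (P k i)
        ≤ ∏ _i : Fin 4, mediumConst K J * (k : ℝ) ^ (-(0.27 : ℝ)) :=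
          Finset.prod_le_prod (fun i _ => matProb_nonneg _) fun i _ => h3 i
      _ = _ := by simp [mul_pow]
  refine (Finset.sum_le_sum h2).trans ?_
  rw [← Finset.mul_sum]
  gcongr
  exact Finset.filter_subset _ _

theorem irreducible_and_galGeAlt_of_typical {p : Fin 4 → ℕ} [hp : ∀ i, Fact (p i).Prime]
    {n k₀ K J : ℕ} (M : Matrix (Fin n) (Fin n) ℤ)
    (hlow : ¬ ∃ g : ℤ[X], g.Monic ∧ 1 ≤ g.natDegree ∧ g.natDegree ≤ k₀ ∧ g ∣ M.charpoly)
    (hprime : ¬ ∃ i, ¬ HasIsolatedPrimeFactor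
      (M.map (Int.castRingHom (ZMod (p i)))).charpoly k₀)
    (htyp : ¬ ∃ i, ¬ IsKrylovTypical K J (M.map (Int.castRingHom (ZMod (p i)))))
    (hmed : ¬ ∃ k, k₀ ≤ k ∧ 2 * k ≤ n ∧ ∀ i,
      IsKrylovTypical K J (M.map (Int.castRingHom (ZMod (p i)))) ∧
      ∃ u : (ZMod (p i))[X], u.Monic ∧ u.natDegree = k ∧
        u ∣ (M.map (Int.castRingHom (ZMod (p i)))).charpoly) :
    Irreducible (charQ M) ∧ GalGeAlt n (charQ M) := by
  refine irreducible_and_galGeAlt_of_reductions M p (fun i => (hp i).out) k₀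
    (fun g hg h1 hk hdvd => hlow ⟨g, hg, h1, hk.le, hdvd⟩) (fun k hk hkn => ?_) fun i => ?_
  · by_contra! h
    refine hmed ⟨k, hk, hkn, fun i => ⟨?_, ?_⟩⟩
    · by_contra hi
      exact htyp ⟨i, hi⟩
    · obtain ⟨u, hu, huk, hdvd⟩ := h i
      refine ⟨u, hu, huk, ?_⟩
      rw [Matrix.charpoly_map]
      exact hdvd
  · by_contra hi
    refine hprime ⟨i, fun h => hi ?_⟩
    rwa [Matrix.charpoly_map] at h

/-- The main estimate, for independent entries with finitely many possible values. -/
theorem tendsto_entryProb_irreducible_and_galGeAlt {p : Fin 4 → ℕ} [hp : ∀ i, Fact (p i).Prime]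
    (hcop : Pairwise (Function.onFun Nat.Coprime p)) (hw : ∀ s, 0 ≤ w s) (hw1 : ∑ s, w s = 1)
    (hu : ∀ z : ℤ, (∑ s, if ((∏ i, p i : ℕ) : ℤ) ∣ val s - z then w s else 0) ≤
      1 / ((∏ i, p i : ℕ) : ℝ)) {s₀ t₀ : ι} (hs₀ : 0 < w s₀) (ht₀ : 0 < w t₀)
    (hst : val s₀ ≠ val t₀) :
    Tendsto (fun n : ℕ => entryProb w val n fun M =>
      Irreducible (charQ M) ∧ GalGeAlt n (charQ M)) atTop (nhds 1) := by
  suffices h : ∀ ε : ℝ, 0 < ε → ∀ᶠ n : ℕ in atTop, entryProb w val n (fun M =>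
      ¬ (Irreducible (charQ M) ∧ GalGeAlt n (charQ M))) ≤ ε by
    refine Metric.tendsto_atTop'.2 fun ε hε => ?_
    obtain ⟨n₀, hn₀⟩ := eventually_atTop.1 (h (ε / 2) (by positivity))
    refine ⟨n₀, fun n hn => ?_⟩
    have h1 := hn₀ n hn.le
    have h2 := entryProb_add_entryProb_not (val := val) hw1 (n := n) fun M =>
      Irreducible (charQ M) ∧ GalGeAlt n (charQ M)
    have h3 := entryProb_nonneg (val := val) hw n fun M =>
      ¬ (Irreducible (charQ M) ∧ GalGeAlt n (charQ M))
    rw [Real.dist_eq, abs_lt]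
    constructor <;> linarith
  intro ε hε
  obtain ⟨J, hJ⟩ := exists_pow_lt_of_lt_one (show (0 : ℝ) < ε / 40 by positivity)
    (show (1 / 2 : ℝ) < 1 by norm_num)
  have hJ1 : 1 ≤ J + 1 := by omega
  have hJ' : (1 / 2 : ℝ) ^ (J + 1) ≤ ε / 40 :=
    (pow_le_pow_of_le_one (by norm_num) (by norm_num) (Nat.le_succ J)).trans hJ.le
  obtain ⟨K, hK, hK1⟩ := ((tendsto_atypicalBound.eventually
    (ge_mem_nhds (show (0 : ℝ) < ε / 40 by positivity))).and (eventually_ge_atTop 1)).exists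
  set C := mediumConst K (J + 1) ^ 4 with hC
  have hC0 : 0 ≤ C := by positivity
  obtain ⟨k₁, hk₁⟩ := exists_sum_Icc_rpow_le (show (0 : ℝ) < ε / (5 * (C + 1)) by positivity)
  set k₀ := max k₁ (2 * (J + 1))
  obtain ⟨B, hB⟩ : ∃ B : ℕ, ∀ s, |val s| ≤ B := by
    refine ⟨∑ s, (val s).natAbs, fun s => ?_⟩
    rw [Int.abs_eq_natAbs]
    exact_mod_cast Finset.single_le_sum (f := fun s => (val s).natAbs)
      (fun _ _ => Nat.zero_le _) (Finset.mem_univ s)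
  have hlow := (tendsto_sum_exists_factor hB hw hw1 hs₀ ht₀ hst k₀).eventually
    (ge_mem_nhds (show (0 : ℝ) < ε / 5 by positivity))
  have hprime := eventually_matProb_not_hasIsolatedPrimeFactor_le
    (show (0 : ℝ) < ε / 20 by positivity) k₀
  filter_upwards [hlow, hprime, eventually_ge_atTop 1] with n hlow hprime hn
  let E₁ : Matrix (Fin n) (Fin n) ℤ → Prop := fun M =>
    ∃ g : ℤ[X], g.Monic ∧ 1 ≤ g.natDegree ∧ g.natDegree ≤ k₀ ∧ g ∣ M.charpoly
  let E₂ : Matrix (Fin n) (Fin n) ℤ → Prop := fun M => ∃ i ∈ (Finset.univ : Finset (Fin 4)),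
    ¬ HasIsolatedPrimeFactor (M.map (Int.castRingHom (ZMod (p i)))).charpoly k₀
  let E₃ : Matrix (Fin n) (Fin n) ℤ → Prop := fun M => ∃ i ∈ (Finset.univ : Finset (Fin 4)),
    ¬ IsKrylovTypical K (J + 1) (M.map (Int.castRingHom (ZMod (p i))))
  let E₄ : Matrix (Fin n) (Fin n) ℤ → Prop := fun M => ∃ k, k₀ ≤ k ∧ 2 * k ≤ n ∧ ∀ i,
      IsKrylovTypical K (J + 1) (M.map (Int.castRingHom (ZMod (p i)))) ∧
      ∃ u : (ZMod (p i))[X], u.Monic ∧ u.natDegree = k ∧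
        u ∣ (M.map (Int.castRingHom (ZMod (p i)))).charpoly
  have h1 : entryProb w val n E₁ ≤ ε / 5 := hlow
  have h2 : entryProb w val n E₂ ≤ ε / 5 := by
    refine (entryProb_exists_le hw _ _).trans ((Finset.sum_le_card_nsmul _ _ (ε / 20)
      fun i _ => ?_).trans (le_of_eq ?_))
    · exact (entryProb_reduction_le hcop hw hu i fun A =>
        ¬ HasIsolatedPrimeFactor A.charpoly k₀).trans (hprime _)
    · rw [Finset.card_univ, Fintype.card_fin, nsmul_eq_mul]
      push_cast
      ring
  have h3 : entryProb w val n E₃ ≤ 2 * (ε / 5) := by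
    refine (entryProb_exists_le hw _ _).trans ((Finset.sum_le_card_nsmul _ _ (ε / 10)
      fun i _ => ?_).trans (le_of_eq ?_))
    · refine (entryProb_reduction_le hcop hw hu i fun A =>
        ¬ IsKrylovTypical K (J + 1) A).trans ((matProb_not_isKrylovTypical_le hn hK1 _).trans ?_)
      linarith
    · rw [Finset.card_univ, Fintype.card_fin, nsmul_eq_mul]
      push_cast
      ring
  have h4 : entryProb w val n E₄ ≤ ε / 5 := by
    refine (entryProb_medium_le hcop hw hu hJ1 (le_max_right _ _)).trans ?_
    refine (mul_le_mul_of_nonneg_left (hk₁ k₀ (le_max_left _ _) n) hC0).trans ?_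
    rw [mul_div_assoc', div_le_div_iff₀ (by positivity) (by norm_num)]
    nlinarith
  have h5 : entryProb w val n (fun M => ¬ (Irreducible (charQ M) ∧ GalGeAlt n (charQ M))) ≤
      entryProb w val n (fun M => E₁ M ∨ E₂ M ∨ E₃ M ∨ E₄ M) := by
    refine entryProb_mono hw fun M hM => ?_
    by_contra! h
    obtain ⟨g1, g2, g3, g4⟩ := h
    exact hM (irreducible_and_galGeAlt_of_typical M g1
      (fun ⟨i, hi⟩ => g2 ⟨i, Finset.mem_univ i, hi⟩)
      (fun ⟨i, hi⟩ => g3 ⟨i, Finset.mem_univ i, hi⟩) g4)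
  have h6 := entryProb_or_le (val := val) hw E₁ fun M => E₂ M ∨ E₃ M ∨ E₄ M
  have h7 := entryProb_or_le (val := val) hw E₂ fun M => E₃ M ∨ E₄ M
  have h8 := entryProb_or_le (val := val) hw E₃ E₄
  linarith

theorem matrixProbZ_eq_entryProb {μ : ℤ → ℝ} (hfin : (Function.support μ).Finite) (n : ℕ)
    (E : Set (Matrix (Fin n) (Fin n) ℤ)) : matrixProbZ n μ E =
      entryProb (fun s : hfin.toFinset => μ s) (fun s => (s : ℤ)) n (fun M => M ∈ E) := by
  unfold matrixProbZ entryProb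
  let f : (Fin n → Fin n → hfin.toFinset) → Matrix (Fin n) (Fin n) ℤ :=
    fun M => Matrix.of fun i j => ((M i j : hfin.toFinset) : ℤ)
  have hf : Function.Injective f := fun M M' h => by
    funext i j
    exact Subtype.ext (congrFun (congrFun h i) j)
  have h := hf.tsum_eq (f := fun M : Matrix (Fin n) (Fin n) ℤ =>
    if M ∈ E then (∏ i, ∏ j, μ (M i j)) else 0) fun M hM => by
      have h1 : ∏ i, ∏ j, μ (M i j) ≠ 0 := fun h0 => hM (by simp [h0])
      have h2 : ∀ i j, μ (M i j) ≠ 0 := fun i j =>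
        Finset.prod_ne_zero_iff.1 (Finset.prod_ne_zero_iff.1 h1 i (Finset.mem_univ i)) j
          (Finset.mem_univ j)
      exact ⟨fun i j => ⟨M i j, hfin.mem_toFinset.2 (h2 i j)⟩, rfl⟩
  rw [← h, tsum_fintype]
  rfl

theorem tsum_eq_sum_support {μ : ℤ → ℝ} (hfin : (Function.support μ).Finite) (Q : ℤ → Prop)
    [DecidablePred Q] : (∑' x, if Q x then μ x else 0) = ∑ s : hfin.toFinset, if Q s then μ s else 0 := by
  rw [tsum_eq_sum (s := hfin.toFinset), ← Finset.sum_coe_sort]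
  intro x hx
  have : μ x = 0 := by
    by_contra h
    exact hx (hfin.mem_toFinset.2 h)
  simp [this]

end Assembly

theorem stmt0 (μ : ℤ → ℝ) (hpos : ∀ x, 0 ≤ μ x)
    (hfin : (Function.support μ).Finite)
    (hsum : ∑' x : ℤ, μ x = 1)
    (hnt : 1 < (Function.support μ).ncard)
    (p : Fin 4 → ℕ) (hp : ∀ i, (p i).Prime) (hpdist : Function.Injective p)
    (hunif : ∀ a : ZMod (p 0 * p 1 * p 2 * p 3),
      (∑' x : ℤ, if (x : ZMod (p 0 * p 1 * p 2 * p 3)) = a then μ x else 0) =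
        1 / ((p 0 * p 1 * p 2 * p 3 : ℕ) : ℝ)) :
    Filter.Tendsto
      (fun n : ℕ => matrixProbZ n μ
        {M : Matrix (Fin n) (Fin n) ℤ |
          Irreducible (charQ M) ∧ GalGeAlt n (charQ M)})
      Filter.atTop (nhds 1) := by
  have hprime : ∀ i, Fact (p i).Prime := fun i => ⟨hp i⟩
  have hcop : Pairwise (Function.onFun Nat.Coprime p) := fun i j hij =>
    (Nat.coprime_primes (hp i) (hp j)).2 (hpdist.ne hij)
  have hprod : ∏ i, p i = p 0 * p 1 * p 2 * p 3 := Fin.prod_univ_four p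
  obtain ⟨x, hx, y, hy, hxy⟩ := (Set.one_lt_ncard hfin).1 hnt
  have hw1 : ∑ s : hfin.toFinset, μ s = 1 := by
    rw [← hsum]
    simpa using (tsum_eq_sum_support hfin fun _ => True).symm
  have hu : ∀ z : ℤ, (∑ s : hfin.toFinset,
      if ((∏ i, p i : ℕ) : ℤ) ∣ (s : ℤ) - z then μ s else 0) ≤ 1 / ((∏ i, p i : ℕ) : ℝ) := by
    intro z
    have e := tsum_eq_sum_support hfin
      fun x : ℤ => (x : ZMod (p 0 * p 1 * p 2 * p 3)) = (z : ZMod (p 0 * p 1 * p 2 * p 3))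
    rw [hprod, ← hunif z]
    refine le_of_eq (Eq.trans (Finset.sum_congr rfl fun s _ => ?_) e.symm)
    refine if_congr ?_ rfl rfl
    rw [eq_comm, ZMod.intCast_eq_intCast_iff_dvd_sub]
  have h := tendsto_entryProb_irreducible_and_galGeAlt (val := fun s : hfin.toFinset => (s : ℤ))
    hcop (fun s => hpos s) hw1 hu
    (s₀ := ⟨x, hfin.mem_toFinset.2 hx⟩) (t₀ := ⟨y, hfin.mem_toFinset.2 hy⟩)
    (lt_of_le_of_ne (hpos _) (Ne.symm hx)) (lt_of_le_of_ne (hpos _) (Ne.symm hy)) hxy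
  refine h.congr fun n => ?_
  rw [matrixProbZ_eq_entryProb hfin]
  rfl
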